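/- If f is a primitive positive definite integral binary quadratic form of discriminant D and C is a real number with B_f(x)·√(log x)/x → C as x → ∞ and (√|D|/2)·C < 1, then D ∈ {-3, -4, -7, -15}. -/

import Mathlib

open Filter Real

/-- The number of positive integers `n ≤ x` represented by the integral binary quadratic
form `a X² + b X Y + c Y²`. -/
noncomputable def Bcount (a b c : ℤ) (x : ℝ) : ℕ :=
  Set.ncard {n : ℕ | 0 < n ∧ (n : ℝ) ≤ x ∧ ∃ u v : ℤ, (n : ℤ) = a * u ^ 2 + b * u * v + c * v ^ 2}

section

/-- An integral binary quadratic form `a X² + b X Y + c Y²`. -/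
@[ext] structure QF where
  a : ℤ
  b : ℤ
  c : ℤ

namespace QF

def eval (f : QF) (x y : ℤ) : ℤ := f.a * x ^ 2 + f.b * x * y + f.c * y ^ 2

def disc (f : QF) : ℤ := f.b ^ 2 - 4 * f.a * f.c

/-- Substitution of `(p X + q Y, r X + s Y)` in a form. -/
def act (f : QF) (p q r s : ℤ) : QF :=
  ⟨f.eval p r, 2 * f.a * p * q + f.b * (p * s + q * r) + 2 * f.c * r * s, f.eval q s⟩

/-- `f` is primitive of discriminant `D` with positive leading coefficient. -/
structure Good (D : ℤ) (f : QF) : Prop where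
  pos : 0 < f.a
  disc_eq : f.disc = D
  prim : ∀ d : ℤ, d ∣ f.a → d ∣ f.b → d ∣ f.c → IsUnit d

lemma eval_act (f : QF) (p q r s x y : ℤ) :
    (f.act p q r s).eval x y = f.eval (p * x + q * y) (r * x + s * y) := by
  simp only [eval, act]; ring

lemma disc_act (f : QF) (p q r s : ℤ) :
    (f.act p q r s).disc = (p * s - q * r) ^ 2 * f.disc := by
  simp only [eval, act, disc]; ring

lemma act_act_inv (f : QF) {p q r s : ℤ} (h : p * s - q * r = 1) :
    (f.act p q r s).act s (-q) (-r) p = f := by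
  have h2 : p * s = 1 + q * r := by linarith
  ext
  · simp only [eval, act]
    linear_combination f.a * (p * s - q * r + 1) * h
  · simp only [eval, act]
    linear_combination f.b * (p * s - q * r + 1) * h
  · simp only [eval, act]
    linear_combination f.c * (p * s - q * r + 1) * h

lemma four_a_eval (f : QF) (x y : ℤ) :
    4 * f.a * f.eval x y = (2 * f.a * x + f.b * y) ^ 2 - f.disc * y ^ 2 := by
  simp only [eval, disc]; ring

lemma Good.eval_nonneg {D : ℤ} {f : QF} (hf : f.Good D) (hD : D < 0) (x y : ℤ) :
    0 ≤ f.eval x y := by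
  have h := f.four_a_eval x y
  rw [hf.disc_eq] at h
  have := hf.pos
  by_contra hneg
  push Not at hneg
  nlinarith [sq_nonneg (2 * f.a * x + f.b * y), sq_nonneg y]

lemma Good.eval_eq_zero {D : ℤ} {f : QF} (hf : f.Good D) (hD : D < 0) {x y : ℤ}
    (h0 : f.eval x y = 0) : x = 0 ∧ y = 0 := by
  have h := f.four_a_eval x y
  rw [hf.disc_eq, h0] at h
  have ha := hf.pos
  have hy : y = 0 := by
    by_contra hy
    have : 0 < y ^ 2 := by positivity
    nlinarith [sq_nonneg (2 * f.a * x + f.b * y)]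
  subst hy
  refine ⟨?_, rfl⟩
  have : (2 * f.a * x) ^ 2 = 0 := by linarith
  have := pow_eq_zero_iff (two_ne_zero) |>.1 this
  have h3 : (2 * f.a) ≠ 0 := by positivity
  exact (mul_eq_zero.1 this).resolve_left h3

lemma Good.eval_pos {D : ℤ} {f : QF} (hf : f.Good D) (hD : D < 0) {x y : ℤ}
    (hxy : ¬ (x = 0 ∧ y = 0)) : 0 < f.eval x y :=
  lt_of_le_of_ne (hf.eval_nonneg hD x y) fun h ↦ hxy (hf.eval_eq_zero hD h.symm)

lemma Good.act {D : ℤ} {f : QF} (hf : f.Good D) (hD : D < 0) {p q r s : ℤ}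
    (h : p * s - q * r = 1) : (f.act p q r s).Good D := by
  refine ⟨?_, ?_, ?_⟩
  · refine hf.eval_pos hD ?_
    rintro ⟨rfl, rfl⟩
    simp at h
  · rw [disc_act, h, hf.disc_eq]; ring
  · intro d h1 h2 h3
    have key := f.act_act_inv h
    refine hf.prim d ?_ ?_ ?_
    · rw [← key]
      exact dvd_add (dvd_add (h1.mul_right _) ((h2.mul_right _).mul_right _)) (h3.mul_right _)
    · rw [← key]
      exact dvd_add (dvd_add (((h1.mul_left _).mul_right _).mul_right _) (h2.mul_right _))
        (((h3.mul_left _).mul_right _).mul_right _)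
    · rw [← key]
      exact dvd_add (dvd_add (h1.mul_right _) ((h2.mul_right _).mul_right _)) (h3.mul_right _)

/-- The opposite form. -/
def conj (f : QF) : QF := ⟨f.a, -f.b, f.c⟩

lemma Good.conj {D : ℤ} {f : QF} (hf : f.Good D) : f.conj.Good D :=
  ⟨hf.pos, by rw [← hf.disc_eq]; simp [QF.conj, disc], fun d h1 h2 h3 ↦
    hf.prim d h1 ((dvd_neg).1 h2) h3⟩

lemma Good.exists_bezout {D : ℤ} {f : QF} (hf : f.Good D) :
    ∃ u v w : ℤ, f.a * u + f.b * v + f.c * w = 1 := by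
  have h1 : IsUnit ((Int.gcd (Int.gcd f.a f.b) f.c : ℕ) : ℤ) := by
    refine hf.prim _ ?_ ?_ ?_
    · exact (Int.gcd_dvd_left _ _).trans (Int.gcd_dvd_left _ _)
    · exact (Int.gcd_dvd_left _ _).trans (Int.gcd_dvd_right _ _)
    · exact Int.gcd_dvd_right _ _
  have h2 : Int.gcd (Int.gcd f.a f.b) f.c = 1 := by
    have := Int.isUnit_iff.1 h1
    omega
  have b1 := Int.gcd_eq_gcd_ab (Int.gcd f.a f.b) f.c
  have b2 := Int.gcd_eq_gcd_ab f.a f.b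
  rw [h2] at b1
  rw [b2] at b1
  refine ⟨Int.gcdA f.a f.b * Int.gcdA (Int.gcd f.a f.b) f.c,
    Int.gcdB f.a f.b * Int.gcdA (Int.gcd f.a f.b) f.c, Int.gcdB (Int.gcd f.a f.b) f.c, ?_⟩
  rw [← b2] at b1
  push_cast at b1
  rw [b1, b2]
  ring

lemma ext_eval {f g : QF} (h : ∀ x y, f.eval x y = g.eval x y) : f = g := by
  have h1 := h 1 0
  have h2 := h 0 1
  have h3 := h 1 1
  simp [eval] at h1 h2 h3
  ext
  · exact h1
  · linarith
  · exact h2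

end QF

/-! ### The quadratic order of discriminant `D` and its ideal classes -/

/-- The parity of the discriminant. -/
def parD (D : ℤ) : ℤ := D % 2

/-- The constant term of the minimal polynomial `X² + parD D X + nrmD D`. -/
def nrmD (D : ℤ) : ℤ := (D % 2 - D) / 4

/-- The quadratic order of discriminant `D`. -/
abbrev QOrder (D : ℤ) := QuadraticAlgebra ℤ (-nrmD D) (-parD D)

namespace QOrder

open nonZeroDivisors

def idl (D a b : ℤ) : Ideal (QOrder D) :=
  Ideal.span {(⟨a, 0⟩ : QOrder D), ⟨-((b - parD D) / 2), 1⟩}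

/-- Two ideals are similar if they agree up to multiplication by non-zero-divisors. -/
def idealCon (R : Type*) [CommRing R] : Con (Ideal R) where
  r I J := ∃ x ∈ R⁰, ∃ y ∈ R⁰, Ideal.span {x} * I = Ideal.span {y} * J
  iseqv :=
    { refl := fun I ↦ ⟨1, one_mem _, 1, one_mem _, rfl⟩
      symm := fun ⟨x, hx, y, hy, h⟩ ↦ ⟨y, hy, x, hx, h.symm⟩
      trans := by
        rintro I J K ⟨x, hx, y, hy, h⟩ ⟨z, hz, w, hw, h'⟩
        refine ⟨z * x, mul_mem hz hx, y * w, mul_mem hy hw, ?_⟩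
        rw [← Ideal.span_singleton_mul_span_singleton, ← Ideal.span_singleton_mul_span_singleton,
          mul_assoc, h, mul_assoc, ← h', mul_left_comm] }
  mul' := by
    rintro I J K L ⟨x, hx, y, hy, h⟩ ⟨z, hz, w, hw, h'⟩
    refine ⟨x * z, mul_mem hx hz, y * w, mul_mem hy hw, ?_⟩
    rw [← Ideal.span_singleton_mul_span_singleton, ← Ideal.span_singleton_mul_span_singleton,
      mul_mul_mul_comm, h, h', mul_mul_mul_comm]

end QOrder

/-- The monoid of ideal classes of the order. -/
abbrev ClMonoid (D : ℤ) := (QOrder.idealCon (QOrder D)).Quotient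

namespace QOrder

open nonZeroDivisors

variable {D : ℤ}

lemma parD_sq (D : ℤ) : parD D ^ 2 = parD D := by
  unfold parD
  rcases Int.emod_two_eq_zero_or_one D with h | h <;> simp [h]

lemma exists_t {f : QF} (hf : f.Good D) : ∃ t, f.b = 2 * t + parD D ∧
    t ^ 2 + parD D * t + nrmD D = f.a * f.c ∧ parD D ^ 2 - 4 * nrmD D = D := by
  have hd := hf.disc_eq
  unfold QF.disc at hd
  have hb : f.b % 2 = D % 2 := by
    have : (f.b ^ 2) % 2 = D % 2 := by
      rw [mul_assoc] at hd
      omega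
    rw [← this]
    rcases Int.emod_two_eq_zero_or_one f.b with h | h <;> simp [pow_two, Int.mul_emod, h]
  have h4 : (f.b ^ 2 - D) % 4 = 0 := by
    rw [mul_assoc] at hd
    omega
  obtain ⟨t, ht⟩ : ∃ t, f.b = 2 * t + parD D := ⟨(f.b - D % 2) / 2, by unfold parD; omega⟩
  have hp := parD_sq D
  have hD : parD D ^ 2 - 4 * nrmD D = D := by
    rw [ht] at h4
    have e : (2 * t + parD D) ^ 2 - D = 4 * (t ^ 2 + t * parD D) + (parD D - D) := by
      rw [← hp]; ring_nf; rw [show parD D ^ 4 = (parD D ^ 2) ^ 2 by ring, hp, hp]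
    rw [e] at h4
    rw [hp]
    unfold nrmD
    unfold parD at h4 ⊢
    omega
  refine ⟨t, ht, ?_, hD⟩
  rw [ht] at hd
  linarith [hd, hD]

lemma idl_eq {f : QF} {t : ℤ} (ht : f.b = 2 * t + parD D) :
    idl D f.a f.b = Ideal.span {(⟨f.a, 0⟩ : QOrder D), ⟨-t, 1⟩} := by
  unfold idl
  rw [ht]
  congr
  omega

lemma nzd_int {a : ℤ} (ha : a ≠ 0) : (⟨a, 0⟩ : QOrder D) ∈ (QOrder D)⁰ := by
  rw [← QuadraticAlgebra.algebraMap_eq, QuadraticAlgebra.algebraMap_mem_nonZeroDivisors_iff]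
  exact mem_nonZeroDivisors_of_ne_zero ha

lemma norm_eq (x : QOrder D) : x.norm = x.re ^ 2 - parD D * x.re * x.im + nrmD D * x.im ^ 2 := by
  rw [QuadraticAlgebra.norm_def]; ring

lemma norm_pos (hD : D < 0) (h4 : parD D ^ 2 - 4 * nrmD D = D) {x : QOrder D}
    (hx : x ∈ (QOrder D)⁰) : 0 < x.norm := by
  have h1 := QuadraticAlgebra.norm_mem_nonZeroDivisors_iff.2 hx
  have h1 := nonZeroDivisors.ne_zero h1
  refine lt_of_le_of_ne ?_ h1.symm
  rw [norm_eq]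
  nlinarith [sq_nonneg (2 * x.re - parD D * x.im), sq_nonneg x.im]

lemma nzd_of_norm {x : QOrder D} (hx : x.norm ≠ 0) : x ∈ (QOrder D)⁰ :=
  QuadraticAlgebra.norm_mem_nonZeroDivisors_iff.1 (mem_nonZeroDivisors_of_ne_zero hx)

/-- The similarity class of the ideal attached to a form. -/
def icls (D : ℤ) (f : QF) : ClMonoid D := ((idl D f.a f.b : Ideal (QOrder D)) : ClMonoid D)

lemma span_singleton_mul_pair {R : Type*} [CommRing R] (x y z : R) :
    Ideal.span {x} * Ideal.span {y, z} = Ideal.span {x * y, x * z} := by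
  rw [Ideal.span_mul_span', Set.singleton_mul, Set.image_pair]

lemma mem_of_eq_of_mem {R : Type*} [CommRing R] {I : Ideal R} {x y : R} (h : x = y)
    (hy : y ∈ I) : x ∈ I := h ▸ hy

lemma icls_act (hD : D < 0) {f : QF} (hf : f.Good D) {p q r s : ℤ} (h : p * s - q * r = 1) :
    icls D (f.act p q r s) = icls D f := by
  obtain ⟨t, ht, hP, h4⟩ := exists_t hf
  have hpos := (hf.act hD h).pos
  set t' : ℤ := f.a * p * q + t * (p * s + q * r) + f.c * r * s + parD D * q * r with ht'
  have hb' : (f.act p q r s).b = 2 * t' + parD D := by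
    simp only [QF.act, ht, ht']
    linear_combination parD D * h
  refine ((QOrder.idealCon (QOrder D)).eq).2 ?_
  have hn : (f.act p q r s).a = f.a * p ^ 2 + (2 * t + parD D) * p * r + f.c * r ^ 2 := by
    simp [QF.act, QF.eval, ht]
  set n := (f.act p q r s).a with hn'
  let al : QOrder D := ⟨f.a * p + t * r, - r⟩
  refine ⟨⟨f.a, 0⟩, nzd_int hf.pos.ne', star al, nzd_of_norm ?_, ?_⟩
  · rw [QuadraticAlgebra.norm_star, norm_eq]
    have : al.re ^ 2 - parD D * al.re * al.im + nrmD D * al.im ^ 2 = f.a * n := by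
      simp only [al, hn]
      linear_combination (r ^ 2) * hP
    rw [this]
    exact (mul_pos hf.pos hpos).ne'
  · rw [idl_eq ht, idl_eq hb', span_singleton_mul_pair, span_singleton_mul_pair, ← hn']
    have e1 : star al * ⟨f.a, 0⟩ = (⟨f.a, 0⟩ : QOrder D) * ⟨n, 0⟩ * ⟨s, 0⟩
        + (⟨f.a, 0⟩ : QOrder D) * ⟨-t', 1⟩ * ⟨r, 0⟩ := by
      ext
      · simp [al, hn, ht']
        linear_combination (-f.a ^ 2 * p - f.a * r * t - f.a * r * parD D) * h
      · simp [al]; ring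
    have e2 : star al * ⟨-t, 1⟩ = (⟨f.a, 0⟩ : QOrder D) * ⟨n, 0⟩ * ⟨q, 0⟩
        + (⟨f.a, 0⟩ : QOrder D) * ⟨-t', 1⟩ * ⟨p, 0⟩ := by
      ext
      · simp [al, hn, ht']
        linear_combination (f.a * p * t  + f.a * r * f.c) * h - r * hP
      · simp [al]; ring
    have e3 : (⟨f.a, 0⟩ : QOrder D) * ⟨n, 0⟩ = star al * ⟨f.a, 0⟩ * ⟨p, 0⟩
        - star al * ⟨-t, 1⟩ * ⟨r, 0⟩ := by
      rw [e1, e2]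
      ext
      · simp
        linear_combination (-f.a * n) * h
      · simp
        ring
    have e4 : (⟨f.a, 0⟩ : QOrder D) * ⟨-t', 1⟩ = star al * ⟨-t, 1⟩ * ⟨s, 0⟩
        - star al * ⟨f.a, 0⟩ * ⟨q, 0⟩ := by
      rw [e1, e2]
      ext <;> simp
      · linear_combination (f.a * t') * h
      · linear_combination (-f.a) * h
    apply le_antisymm
    · rw [Ideal.span_le]
      rintro z (rfl | rfl)
      · rw [e3]
        exact sub_mem (Ideal.mul_mem_right _ _ (Ideal.subset_span (by simp)))
          (Ideal.mul_mem_right _ _ (Ideal.subset_span (by simp)))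
      · rw [e4]
        exact sub_mem (Ideal.mul_mem_right _ _ (Ideal.subset_span (by simp)))
          (Ideal.mul_mem_right _ _ (Ideal.subset_span (by simp)))
    · rw [Ideal.span_le]
      rintro z (rfl | rfl)
      · rw [e1]
        exact add_mem (Ideal.mul_mem_right _ _ (Ideal.subset_span (by simp)))
          (Ideal.mul_mem_right _ _ (Ideal.subset_span (by simp)))
      · rw [e2]
        exact add_mem (Ideal.mul_mem_right _ _ (Ideal.subset_span (by simp)))
          (Ideal.mul_mem_right _ _ (Ideal.subset_span (by simp)))

lemma mem_idl {f : QF} {t : ℤ} (ht : f.b = 2 * t + parD D)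
    (hP : t ^ 2 + parD D * t + nrmD D = f.a * f.c) {z : QOrder D} (hz : z ∈ idl D f.a f.b) :
    ∃ u v : ℤ, z = ⟨f.a * u + t * v, -v⟩ := by
  rw [idl_eq ht, Ideal.mem_span_pair] at hz
  obtain ⟨x, y, rfl⟩ := hz
  refine ⟨x.re + t * x.im - y.im * f.c, -(x.im * f.a + y.re - y.im * t - parD D * y.im), ?_⟩
  ext
  · simp
    linear_combination -y.im * hP
  · simp
    ring

lemma exists_of_icls_le {f g : QF} (hf : f.Good D) (hg : g.Good D) {x y : QOrder D}
    (h : Ideal.span {x} * idl D f.a f.b = Ideal.span {y} * idl D g.a g.b) :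
    ∃ p q r s : ℤ, x.norm * f.a = y.norm * g.a * (p * s - q * r) ∧
      ∀ u v, x.norm * f.a * f.eval u v = y.norm * g.a * g.eval (p * u + q * v) (r * u + s * v) := by
  obtain ⟨t, ht, hP, h4⟩ := exists_t hf
  obtain ⟨t', ht', hP', -⟩ := exists_t hg
  have key : ∀ z ∈ idl D f.a f.b, ∃ u v : ℤ, x * z = y * ⟨g.a * u + t' * v, -v⟩ := by
    intro z hz
    have : x * z ∈ Ideal.span {y} * idl D g.a g.b := by
      rw [← h]
      exact Ideal.mul_mem_mul (Ideal.mem_span_singleton_self _) hz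
    rw [Ideal.mem_span_singleton_mul] at this
    obtain ⟨w, hw, hw'⟩ := this
    obtain ⟨u, v, rfl⟩ := mem_idl ht' hP' hw
    exact ⟨u, v, hw'.symm⟩
  obtain ⟨p, r, h1⟩ := key ⟨f.a, 0⟩ (Ideal.subset_span (by simp))
  obtain ⟨q, s, h2⟩ := key ⟨t, -1⟩ (by
    have : (⟨t, -1⟩ : QOrder D) = - ⟨-t, 1⟩ := by simp
    rw [idl_eq ht, this]
    exact neg_mem (Ideal.subset_span (by simp)))
  refine ⟨p, q, r, s, ?_, fun u v ↦ ?_⟩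
  · have r1 := congrArg QuadraticAlgebra.re h1
    have i1 := congrArg QuadraticAlgebra.im h1
    have r2 := congrArg QuadraticAlgebra.re h2
    have i2 := congrArg QuadraticAlgebra.im h2
    have e1 : x.norm * f.a = -((x * ⟨f.a, 0⟩).re * (x * ⟨t, -1⟩).im
        - (x * ⟨f.a, 0⟩).im * (x * ⟨t, -1⟩).re) := by
      rw [norm_eq]; simp; ring
    rw [e1, h1, h2, norm_eq]
    simp
    ring
  · have h3 : x * ⟨f.a * u + t * v, -v⟩ =
        y * ⟨g.a * (p * u + q * v) + t' * (r * u + s * v), -(r * u + s * v)⟩ := by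
      have : (⟨f.a * u + t * v, -v⟩ : QOrder D) = ⟨f.a, 0⟩ * ⟨u, 0⟩ + ⟨t, -1⟩ * ⟨v, 0⟩ := by
        ext <;> simp
      rw [this, mul_add, ← mul_assoc, h1, ← mul_assoc, h2, mul_assoc, mul_assoc, ← mul_add]
      congr 1
      ext <;> simp <;> ring
    have h5 := congrArg QuadraticAlgebra.norm h3
    rw [map_mul, map_mul] at h5
    have e1 : (⟨f.a * u + t * v, -v⟩ : QOrder D).norm = f.a * f.eval u v := by
      rw [norm_eq]; simp only [QF.eval, ht]
      linear_combination (v ^ 2) * hP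
    have e2 : ∀ u v : ℤ, (⟨g.a * u + t' * v, -v⟩ : QOrder D).norm = g.a * g.eval u v := by
      intro u v
      rw [norm_eq]; simp only [QF.eval, ht']
      linear_combination (v ^ 2) * hP'
    rw [e1, e2] at h5
    linarith

lemma exists_act_of_icls_eq (hD : D < 0) {f g : QF} (hf : f.Good D) (hg : g.Good D)
    (h : icls D f = icls D g) : ∃ p q r s : ℤ, p * s - q * r = 1 ∧ f = g.act p q r s := by
  obtain ⟨x, hx, y, hy, h⟩ := ((QOrder.idealCon (QOrder D)).eq).1 h
  obtain ⟨t, ht, hP, h4⟩ := exists_t hf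
  obtain ⟨p, q, r, s, h1, h2⟩ := exists_of_icls_le hf hg h
  obtain ⟨p', q', r', s', h1', -⟩ := exists_of_icls_le hg hf h.symm
  have px := mul_pos (norm_pos hD h4 hx) hf.pos
  have py := mul_pos (norm_pos hD h4 hy) hg.pos
  have hdet : p * s - q * r = 1 := by
    have h3 : y.norm * g.a * ((p * s - q * r) * (p' * s' - q' * r')) = y.norm * g.a * 1 := by
      rw [← mul_assoc, ← h1, ← h1', mul_one]
    have h4 := mul_left_cancel₀ py.ne' h3
    have h5 : 0 < p * s - q * r := by
      by_contra hneg
      push Not at hneg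
      nlinarith
    have := Int.isUnit_iff.1 (IsUnit.of_mul_eq_one _ h4)
    omega
  refine ⟨p, q, r, s, hdet, QF.ext_eval fun u v ↦ ?_⟩
  rw [QF.eval_act]
  have := h2 u v
  rw [h1, hdet, mul_one] at this
  exact mul_left_cancel₀ py.ne' this

lemma icls_mul {a₁ a₂ b c : ℤ} {u v w : ℤ} (hb : a₁ * u + a₂ * v + b * w = 1)
    (h1 : (⟨a₁, b, a₂ * c⟩ : QF).Good D) :
    icls D ⟨a₁, b, a₂ * c⟩ * icls D ⟨a₂, b, a₁ * c⟩ = icls D ⟨a₁ * a₂, b, c⟩ := by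
  obtain ⟨t, ht, hP, h4⟩ := exists_t h1
  have e1 := idl_eq (f := ⟨a₁, b, a₂ * c⟩) ht
  have e2 := idl_eq (f := ⟨a₂, b, a₁ * c⟩) ht
  have e3 := idl_eq (f := ⟨a₁ * a₂, b, c⟩) ht
  simp only at ht hP e1 e2 e3
  unfold icls
  rw [← Con.coe_mul]
  congr 1
  simp only [e1, e2, e3]
  rw [Ideal.span_pair_mul_span_pair]
  set T : QOrder D := ⟨-t, 1⟩ with hT
  apply le_antisymm
  · rw [Ideal.span_le]
    rintro z (rfl | rfl | rfl | rfl)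
    · apply Ideal.subset_span
      left
      ext <;> simp
    · exact Ideal.mul_mem_left _ _ (Ideal.subset_span (by simp))
    · exact Ideal.mul_mem_right _ _ (Ideal.subset_span (by simp))
    · exact Ideal.mul_mem_left _ _ (Ideal.subset_span (by simp))
  · rw [Ideal.span_le]
    rintro z (rfl | rfl)
    · apply Ideal.subset_span
      left
      ext <;> simp
    · have : T = (⟨a₁, 0⟩ * T) * ⟨u, 0⟩ + (T * ⟨a₂, 0⟩) * ⟨v, 0⟩
          + (T * T) * ⟨-w, 0⟩ + (⟨a₁, 0⟩ * ⟨a₂, 0⟩) * ⟨- c * w, 0⟩ := by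
        ext
        · simp [hT]
          linear_combination t * hb - w * hP - w * t * ht
        · simp [hT]
          linear_combination -hb + w * ht
      refine mem_of_eq_of_mem this (add_mem (add_mem (add_mem ?_ ?_) ?_) ?_) <;>
        exact Ideal.mul_mem_right _ _ (Ideal.subset_span (by simp))

lemma icls_mul_conj {f : QF} (hf : f.Good D) : icls D f * icls D f.conj = 1 := by
  obtain ⟨t, ht, hP, h4⟩ := exists_t hf
  have ht2 : f.conj.b = 2 * (-t - parD D) + parD D := by
    simp only [QF.conj, ht]; ring
  unfold icls
  rw [← Con.coe_mul, ← Con.coe_one]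
  refine ((QOrder.idealCon (QOrder D)).eq).2 ⟨1, one_mem _, ⟨f.a, 0⟩, nzd_int hf.pos.ne', ?_⟩
  rw [idl_eq ht, idl_eq ht2, Ideal.span_pair_mul_span_pair, Ideal.span_singleton_one,
    ← Ideal.one_eq_top, one_mul, mul_one]
  have ha : f.conj.a = f.a := rfl
  obtain ⟨u, v, w, huvw⟩ := hf.exists_bezout
  apply le_antisymm
  · rw [Ideal.span_le, ha]
    rintro z (rfl | rfl | rfl | rfl)
    · exact Ideal.mul_mem_left _ _ (Ideal.subset_span (by simp))
    · exact Ideal.mul_mem_right _ _ (Ideal.subset_span (by simp))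
    · exact Ideal.mul_mem_left _ _ (Ideal.subset_span (by simp))
    · have : (⟨-t, 1⟩ : QOrder D) * ⟨-(-t - parD D), 1⟩ = ⟨f.a, 0⟩ * ⟨-f.c, 0⟩ := by
        ext
        · simp
          linear_combination -hP
        · simp
      rw [this]
      exact Ideal.mul_mem_right _ _ (Ideal.subset_span (by simp))
  · rw [Ideal.span_le, ha]
    rintro z rfl
    have : (⟨f.a, 0⟩ : QOrder D) = (⟨f.a, 0⟩ * ⟨f.a, 0⟩) * ⟨u, 0⟩
        + (⟨f.a, 0⟩ * ⟨-(-t - parD D), 1⟩) * ⟨v, 0⟩ - (⟨-t, 1⟩ * ⟨f.a, 0⟩) * ⟨v, 0⟩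
        + (⟨-t, 1⟩ * ⟨-(-t - parD D), 1⟩) * ⟨-w, 0⟩ := by
      ext
      · simp
        linear_combination -f.a * huvw + f.a * v * ht - w * hP
      · simp
    show (⟨f.a, 0⟩ : QOrder D) ∈ _
    refine mem_of_eq_of_mem this (add_mem (sub_mem (add_mem ?_ ?_) ?_) ?_) <;>
      exact Ideal.mul_mem_right _ _ (Ideal.subset_span (by simp))

end QOrder

namespace QF

lemma dvd_congr_right {m n k : ℤ} (h : m = n) : k ∣ m ↔ k ∣ n := by rw [h]

lemma prime_dvd_prod_iff {S : Finset ℕ} (hS : ∀ p ∈ S, p.Prime) {q : ℕ} (hq : q.Prime) :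
    (q : ℤ) ∣ ∏ p ∈ S, (p : ℤ) ↔ q ∈ S := by
  rw [(Nat.prime_iff_prime_int.1 hq).dvd_finsetProd_iff]
  constructor
  · rintro ⟨p, hp, h⟩
    rw [(Nat.prime_dvd_prime_iff_eq hq (hS p hp)).1 (Int.natCast_dvd_natCast.1 h)]
    exact hp
  · exact fun h ↦ ⟨q, h, dvd_rfl⟩

lemma isCoprime_of_forall_prime {m n : ℤ}
    (h : ∀ p : ℕ, p.Prime → (p : ℤ) ∣ m → ¬ (p : ℤ) ∣ n) : IsCoprime m n := by
  rw [Int.isCoprime_iff_gcd_eq_one]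
  by_contra hg
  obtain ⟨p, hp, hd⟩ := Nat.exists_prime_and_dvd hg
  have hd : (p : ℤ) ∣ (Int.gcd m n : ℤ) := Int.natCast_dvd_natCast.2 hd
  exact h p hp (hd.trans (Int.gcd_dvd_left _ _)) (hd.trans (Int.gcd_dvd_right _ _))

lemma Good.not_all_dvd {D : ℤ} {f : QF} (hf : f.Good D) {p : ℕ} (hp : p.Prime)
    (h1 : (p : ℤ) ∣ f.a) (h2 : (p : ℤ) ∣ f.b) (h3 : (p : ℤ) ∣ f.c) : False :=
  (Nat.prime_iff_prime_int.1 hp).not_isUnit (hf.prim _ h1 h2 h3)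

/-- A primitive form properly represents a value coprime to a given integer. -/
lemma Good.exists_coprime {D : ℤ} {f : QF} (hf : f.Good D) {N : ℤ} (hN : N ≠ 0) :
    ∃ x y : ℤ, IsCoprime x y ∧ IsCoprime (f.eval x y) N := by
  classical
  set P := N.natAbs.primeFactors with hP
  have hPp : ∀ p : ℕ, p ∈ P → p.Prime := fun p hp ↦ Nat.prime_of_mem_primeFactors hp
  set S := P.filter fun p : ℕ ↦ (p : ℤ) ∣ f.a ∧ ¬ (p : ℤ) ∣ f.c with hS
  set T := P.filter fun p : ℕ ↦ ¬ (p : ℤ) ∣ f.a with hT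
  have hSp : ∀ p : ℕ, p ∈ S → p.Prime := fun p hp ↦ hPp p (Finset.filter_subset _ _ hp)
  have hTp : ∀ p : ℕ, p ∈ T → p.Prime := fun p hp ↦ hPp p (Finset.filter_subset _ _ hp)
  have hT0 : (∏ p ∈ T, (p : ℤ)) ≠ 0 :=
    Finset.prod_ne_zero_iff.2 fun q hq ↦ Nat.cast_ne_zero.2 (hTp q hq).ne_zero
  refine ⟨∏ p ∈ S, (p : ℤ), ∏ p ∈ T, (p : ℤ), isCoprime_of_forall_prime ?_,
    isCoprime_of_forall_prime ?_⟩
  · intro p hp h1 h2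
    rw [prime_dvd_prod_iff hSp hp, hS, Finset.mem_filter] at h1
    rw [prime_dvd_prod_iff hTp hp, hT, Finset.mem_filter] at h2
    exact h2.2 h1.2.1
  · intro p hp h1 h2
    have hpP : p ∈ P := by
      rw [hP, Nat.mem_primeFactors]
      exact ⟨hp, Int.natCast_dvd.1 h2, by simpa using hN⟩
    have iS := prime_dvd_prod_iff hSp hp
    have iT := prime_dvd_prod_iff hTp hp
    rw [hS, Finset.mem_filter] at iS
    rw [hT, Finset.mem_filter] at iT
    generalize ∏ p ∈ S, (p : ℤ) = x at *
    generalize ∏ p ∈ T, (p : ℤ) = y at *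
    have hpi := Nat.prime_iff_prime_int.1 hp
    unfold eval at h1
    by_cases ha : (p : ℤ) ∣ f.a
    · by_cases hc : (p : ℤ) ∣ f.c
      · have hx : ¬ (p : ℤ) ∣ x := fun h ↦ (iS.1 h).2.2 hc
        have hy : ¬ (p : ℤ) ∣ y := fun h ↦ (iT.1 h).2 ha
        have h3 : (p : ℤ) ∣ f.b * x * y := by
          exact (dvd_congr_right (by ring)).1
              (dvd_sub h1 (dvd_add (ha.mul_right (x ^ 2)) (hc.mul_right (y ^ 2))))
        rcases hpi.dvd_or_dvd h3 with h | h
        · rcases hpi.dvd_or_dvd h with h | h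
          · exact hf.not_all_dvd hp ha h hc
          · exact hx h
        · exact hy h
      · have hx : (p : ℤ) ∣ x := iS.2 ⟨hpP, ha, hc⟩
        have hy : ¬ (p : ℤ) ∣ y := fun h ↦ (iT.1 h).2 ha
        have h3 : (p : ℤ) ∣ f.c * y ^ 2 := by
          exact (dvd_congr_right (by ring)).1 (dvd_sub h1 (hx.mul_right (f.a * x + f.b * y)))
        rcases hpi.dvd_or_dvd h3 with h | h
        · exact hc h
        · exact hy (hpi.dvd_of_dvd_pow h)
    · have hx : ¬ (p : ℤ) ∣ x := fun h ↦ ha (iS.1 h).2.1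
      have hy : (p : ℤ) ∣ y := iT.2 ⟨hpP, ha⟩
      have h3 : (p : ℤ) ∣ f.a * x ^ 2 := by
        exact (dvd_congr_right (by ring)).1 (dvd_sub h1 (hy.mul_right (f.b * x + f.c * y)))
      rcases hpi.dvd_or_dvd h3 with h | h
      · exact ha h
      · exact hx (hpi.dvd_of_dvd_pow h)

lemma act_shift (f : QF) (k : ℤ) : f.act 1 k 0 1 = ⟨f.a, f.b + 2 * f.a * k, f.eval k 1⟩ := by
  ext <;> simp [act, eval]; ring

/-- Every form is properly equivalent to one with `|b| ≤ a ≤ c`. -/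
lemma Good.exists_reduced {D : ℤ} (hD : D < 0) (n : ℕ) : ∀ {f : QF}, f.Good D → f.a.natAbs ≤ n →
    ∃ g : QF, g.Good D ∧ QOrder.icls D g = QOrder.icls D f ∧ |g.b| ≤ g.a ∧ g.a ≤ g.c := by
  induction n with
  | zero =>
    intro f hf h
    have := hf.pos
    omega
  | succ n ih =>
    intro f hf h
    have ha := hf.pos
    obtain ⟨k, hk⟩ : ∃ k, |f.b + 2 * f.a * k| ≤ f.a := by
      refine ⟨-((f.b + f.a) / (2 * f.a)), ?_⟩
      have h1 := Int.emod_nonneg (f.b + f.a) (show 2 * f.a ≠ 0 by positivity)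
      have h2 := Int.emod_lt_of_pos (f.b + f.a) (show 0 < 2 * f.a by positivity)
      have h3 := Int.emod_add_mul_ediv (f.b + f.a) (2 * f.a)
      rw [abs_le]
      constructor <;> linarith
    have hdet : (1 : ℤ) * 1 - k * 0 = 1 := by ring
    have hg := hf.act hD hdet
    have hcl := QOrder.icls_act hD hf hdet
    rw [act_shift] at hg hcl
    by_cases hc : f.a ≤ f.eval k 1
    · exact ⟨_, hg, hcl, hk, hc⟩
    · have hdet2 : (0 : ℤ) * 0 - (-1) * 1 = 1 := by ring
      have hg2 := hg.act hD hdet2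
      have hcl2 := QOrder.icls_act hD hg hdet2
      obtain ⟨g, h1, h2, h3⟩ := ih hg2 (by
        have := hg2.pos
        have e : (QF.act ⟨f.a, f.b + 2 * f.a * k, f.eval k 1⟩ 0 (-1) 1 0).a = f.eval k 1 := by
          rw [QF.act]
          simp [eval]
        omega)
      exact ⟨g, h1, h2.trans (hcl2.trans hcl), h3⟩

end QF

namespace QOrder

variable {D : ℤ}

lemma exists_icls_mul (hD : D < 0) {f g : QF} (hf : f.Good D) (hg : g.Good D) :
    ∃ h : QF, h.Good D ∧ icls D f * icls D g = icls D h := by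
  obtain ⟨x, y, hxy, hco⟩ := hg.exists_coprime hf.pos.ne'
  obtain ⟨u, v, huv⟩ := hxy
  have hdet : x * u - (-v) * y = 1 := by linarith
  have hg' := hg.act hD hdet
  rw [← icls_act hD hg hdet]
  have hco' : IsCoprime (g.act x (-v) y u).a f.a := hco
  generalize g.act x (-v) y u = g' at *
  clear hco hdet huv hg
  obtain ⟨k, l, hkl⟩ := hco'
  obtain ⟨t₁, ht₁, -, -⟩ := exists_t hf
  obtain ⟨t₂, ht₂, -, -⟩ := exists_t hg'
  have d1 : (1 : ℤ) * 1 - (l * (t₂ - t₁)) * 0 = 1 := by ring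
  have d2 : (1 : ℤ) * 1 - (-k * (t₂ - t₁)) * 0 = 1 := by ring
  have hf1 := hf.act hD d1
  have hg1 := hg'.act hD d2
  rw [← icls_act hD hf d1, ← icls_act hD hg' d2]
  rw [QF.act_shift] at hf1 hg1 ⊢
  rw [QF.act_shift]
  have hb : g'.b + 2 * g'.a * (-k * (t₂ - t₁)) = f.b + 2 * f.a * (l * (t₂ - t₁)) := by
    rw [ht₁, ht₂]
    linear_combination (-2 * (t₂ - t₁)) * hkl
  rw [hb] at hg1 ⊢
  generalize f.b + 2 * f.a * (l * (t₂ - t₁)) = b at *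
  generalize f.eval (l * (t₂ - t₁)) 1 = c₁ at *
  generalize g'.eval (-k * (t₂ - t₁)) 1 = c₂ at *
  have ha1 := hf.pos
  generalize f.a = a₁ at *
  generalize g'.a = a₂ at *
  have e : a₁ * c₁ = a₂ * c₂ := by
    have h1 := hf1.disc_eq
    have h2 := hg1.disc_eq
    simp only [QF.disc] at h1 h2
    linarith
  obtain ⟨c, hc⟩ : a₂ ∣ c₁ := by
    have : IsCoprime a₂ a₁ := ⟨k, l, hkl⟩
    exact this.dvd_of_dvd_mul_left (Dvd.intro _ e.symm)
  subst hc
  have hc2 : c₂ = a₁ * c := by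
    have := hg1.pos
    simp only at this
    apply mul_left_cancel₀ this.ne'
    rw [← e]; ring
  subst hc2
  refine ⟨⟨a₁ * a₂, b, c⟩, ⟨mul_pos ha1 hg1.pos, ?_, ?_⟩,
    icls_mul (u := l) (v := k) (w := 0) (by linarith) hf1⟩
  · rw [← hf1.disc_eq]
    simp only [QF.disc]
    ring
  · intro d h1 h2 h3
    simp only at h1 h2 h3
    have h5 : IsCoprime d a₁ := by
      rw [Int.isCoprime_iff_gcd_eq_one]
      have := hf1.prim (Int.gcd d a₁) (Int.gcd_dvd_right _ _)
        ((Int.gcd_dvd_left _ _).trans h2) (((Int.gcd_dvd_left _ _).trans h3).mul_left _)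
      simpa using Int.isUnit_iff_natAbs_eq.1 this
    exact hg1.prim d (h5.dvd_of_dvd_mul_left h1) h2 (h3.mul_left _)

/-- The form class group, as a group of units in the monoid of ideal classes. -/
def clSub (D : ℤ) : Subgroup (ClMonoid D)ˣ :=
  Subgroup.closure {u | ∃ f : QF, f.Good D ∧ (u : ClMonoid D) = icls D f}

end QOrder

/-- The form class group of discriminant `D`. -/
def Cl (D : ℤ) : Type := QOrder.clSub D

noncomputable instance (D : ℤ) : CommGroup (Cl D) := inferInstanceAs (CommGroup (QOrder.clSub D))

/-- The element of the form class group given by a unit. -/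
def Cl.mk {D : ℤ} (u : (ClMonoid D)ˣ) (h : u ∈ QOrder.clSub D) : Cl D :=
  (⟨u, h⟩ : QOrder.clSub D)

/-- The underlying ideal class. -/
noncomputable def clVal (D : ℤ) : Cl D →* ClMonoid D :=
  (Units.coeHom (ClMonoid D)).comp (QOrder.clSub D).subtype

/-- The class of a form, as a unit. -/
noncomputable def QF.Good.clUnit {D : ℤ} {f : QF} (hf : f.Good D) : (ClMonoid D)ˣ :=
  ⟨QOrder.icls D f, QOrder.icls D f.conj, QOrder.icls_mul_conj hf, by
    rw [mul_comm]; exact QOrder.icls_mul_conj hf⟩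

lemma QF.Good.clUnit_mem {D : ℤ} {f : QF} (hf : f.Good D) : hf.clUnit ∈ QOrder.clSub D :=
  Subgroup.subset_closure ⟨f, hf, rfl⟩

open Classical in
/-- The class of a form. -/
noncomputable def cls (D : ℤ) (f : QF) : Cl D :=
  if hf : f.Good D then Cl.mk hf.clUnit hf.clUnit_mem else 1

variable {D : ℤ}

lemma cls_val {f : QF} (hf : f.Good D) : clVal D (cls D f) = QOrder.icls D f := by
  unfold cls
  rw [dif_pos hf]
  rfl

lemma cls_ext {A B : Cl D} (h : clVal D A = clVal D B) : A = B :=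
  Subtype.ext (Units.ext h)

lemma cls_eq_iff (hD : D < 0) {f g : QF} (hf : f.Good D) (hg : g.Good D) :
    cls D f = cls D g ↔ ∃ p q r s : ℤ, p * s - q * r = 1 ∧ f = g.act p q r s := by
  constructor
  · intro h
    apply QOrder.exists_act_of_icls_eq hD hf hg
    rw [← cls_val hf, ← cls_val hg, h]
  · rintro ⟨p, q, r, s, h, rfl⟩
    apply cls_ext
    rw [cls_val hf, cls_val hg, QOrder.icls_act hD hg h]

lemma cls_mul_conj {f : QF} (hf : f.Good D) : cls D f * cls D f.conj = 1 := by
  apply cls_ext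
  simp [cls_val hf, cls_val hf.conj, QOrder.icls_mul_conj hf]

lemma cls_conj {f : QF} (hf : f.Good D) : cls D f.conj = (cls D f)⁻¹ :=
  (inv_eq_of_mul_eq_one_right (cls_mul_conj hf)).symm

lemma cls_mul {a₁ a₂ b c : ℤ} {u v w : ℤ} (hb : a₁ * u + a₂ * v + b * w = 1)
    (h1 : (⟨a₁, b, a₂ * c⟩ : QF).Good D) (h2 : (⟨a₂, b, a₁ * c⟩ : QF).Good D)
    (h3 : (⟨a₁ * a₂, b, c⟩ : QF).Good D) :
    cls D ⟨a₁ * a₂, b, c⟩ = cls D ⟨a₁, b, a₂ * c⟩ * cls D ⟨a₂, b, a₁ * c⟩ := by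
  apply cls_ext
  rw [cls_val h3, map_mul, cls_val h1, cls_val h2, QOrder.icls_mul hb h1]

lemma exists_cls_eq (hD : D < 0) {f₀ : QF} (hf₀ : f₀.Good D) (A : Cl D) :
    ∃ f : QF, f.Good D ∧ cls D f = A := by
  have key : ∀ u ∈ QOrder.clSub D, ∃ f : QF, f.Good D ∧ (u : ClMonoid D) = QOrder.icls D f := by
    intro u hu
    induction hu using Subgroup.closure_induction with
    | mem x hx => exact hx
    | one =>
      obtain ⟨h, h1, h2⟩ := QOrder.exists_icls_mul hD hf₀ hf₀.conj
      rw [QOrder.icls_mul_conj hf₀] at h2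
      exact ⟨h, h1, by simpa using h2⟩
    | mul x y _ _ hx hy =>
      obtain ⟨f, hf, hx⟩ := hx
      obtain ⟨g, hg, hy⟩ := hy
      obtain ⟨h, h1, h2⟩ := QOrder.exists_icls_mul hD hf hg
      exact ⟨h, h1, by rw [Units.val_mul, hx, hy, h2]⟩
    | inv x _ hx =>
      obtain ⟨f, hf, hx⟩ := hx
      refine ⟨f.conj, hf.conj, ?_⟩
      have : x * Units.mk (QOrder.icls D f.conj) (QOrder.icls D f)
          (by rw [mul_comm]; exact QOrder.icls_mul_conj hf) (QOrder.icls_mul_conj hf) = 1 := by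
        ext
        simp [hx, QOrder.icls_mul_conj hf]
      rw [inv_eq_of_mul_eq_one_right this]
  obtain ⟨f, hf, h⟩ := key _ (show QOrder.clSub D from A).2
  exact ⟨f, hf, cls_ext ((cls_val hf).trans h.symm)⟩

lemma finite_Cl (hD : D < 0) {f₀ : QF} (hf₀ : f₀.Good D) : Finite (Cl D) := by
  classical
  let F : Finset ℤ := Finset.Icc (-(-D)) (-D)
  let e : F × F → Cl D := fun x ↦
    cls D ⟨x.1, x.2, ((x.2 : ℤ) ^ 2 - D) / (4 * (x.1 : ℤ))⟩
  apply Finite.of_surjective e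
  intro A
  obtain ⟨f, hf, rfl⟩ := exists_cls_eq hD hf₀ A
  obtain ⟨g, hg, h1, h2, h3⟩ := QF.Good.exists_reduced hD _ hf le_rfl
  have h4 := hg.disc_eq
  unfold QF.disc at h4
  have hpos := hg.pos
  have h5 : 3 * g.a ^ 2 ≤ -D := by
    have := sq_le_sq' (neg_le_of_abs_le h2) (le_of_abs_le h2)
    nlinarith
  have ha : g.a ≤ -D := by nlinarith
  have hb := abs_le.1 (h2.trans ha)
  refine ⟨⟨⟨g.a, ?_⟩, ⟨g.b, ?_⟩⟩, ?_⟩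
  · simp only [F, Finset.mem_Icc]; constructor <;> linarith
  · simp only [F, Finset.mem_Icc]; exact hb
  · have hc : (g.b ^ 2 - D) / (4 * g.a) = g.c := by
      rw [← h4]
      apply Int.ediv_eq_of_eq_mul_right (by positivity)
      ring
    apply cls_ext
    simp only [e, hc]
    rw [cls_val hf, ← h1, ← cls_val hg]

/-- `D` is a negative discriminant. -/
structure NegDisc (D : ℤ) : Prop where
  neg : D < 0
  eq : parD D ^ 2 - 4 * nrmD D = D

/-- The minimal polynomial of the generator of the quadratic order. -/
def polD (D t : ℤ) : ℤ := t ^ 2 + parD D * t + nrmD D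

/-- The form `(n, 2 t + parD D, polD D t / n)`. -/
def solForm (D n t : ℤ) : QF := ⟨n, 2 * t + parD D, polD D t / n⟩

lemma QF.Good.negDisc {f : QF} (hf : f.Good D) (hD : D < 0) : NegDisc D := by
  obtain ⟨t, -, -, h⟩ := QOrder.exists_t hf
  exact ⟨hD, h⟩

lemma NegDisc.disc_eq (h : NegDisc D) (t : ℤ) : (2 * t + parD D) ^ 2 - 4 * polD D t = D := by
  unfold polD
  linear_combination h.eq

lemma isUnit_of_forall_prime {d : ℤ}
    (h : ∀ p : ℕ, p.Prime → (p : ℤ) ∣ d → False) : IsUnit d := by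
  rw [Int.isUnit_iff_natAbs_eq]
  by_contra h1
  obtain ⟨p, hp, hpd⟩ := Nat.exists_prime_and_dvd h1
  exact h p hp (Int.natCast_dvd.2 hpd)

lemma NegDisc.good_solForm (h : NegDisc D) {n t : ℤ} (hn : 0 < n) (hco : IsCoprime n D)
    (hdvd : n ∣ polD D t) : (solForm D n t).Good D := by
  obtain ⟨c, hc⟩ := hdvd
  have e : polD D t / n = c := by rw [hc]; exact Int.mul_ediv_cancel_left c hn.ne'
  have hD := h.disc_eq t
  refine ⟨hn, ?_, ?_⟩
  · simp only [QF.disc, solForm, e]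
    linear_combination hD + 4 * hc
  · simp only [solForm, e]
    intro d h1 h2 h3
    refine isUnit_of_forall_prime fun p hp hpd ↦ ?_
    have hpD : (p : ℤ) ∣ D := by
      rw [← hD, hc]
      exact dvd_sub (dvd_pow (hpd.trans h2) two_ne_zero) (((hpd.trans h1).mul_right _).mul_left _)
    exact (Nat.prime_iff_prime_int.1 hp).not_isUnit (hco.isUnit_of_dvd' (hpd.trans h1) hpD)

lemma NegDisc.good_principal (h : NegDisc D) : (solForm D 1 0).Good D :=
  h.good_solForm one_pos isCoprime_one_left (one_dvd _)

lemma NegDisc.finite (h : NegDisc D) : Finite (Cl D) := finite_Cl h.neg h.good_principal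

lemma NegDisc.exists_cls_eq (h : NegDisc D) (A : Cl D) : ∃ f : QF, f.Good D ∧ cls D f = A :=
  _root_.exists_cls_eq h.neg h.good_principal A

lemma NegDisc.eq_solForm (_ : NegDisc D) {f : QF} (hf : f.Good D) :
    ∃ t, f.a ∣ polD D t ∧ f = solForm D f.a t := by
  obtain ⟨t, h1, h2, -⟩ := QOrder.exists_t hf
  have h3 : polD D t = f.a * f.c := h2
  refine ⟨t, ⟨_, h3⟩, ?_⟩
  ext
  · rfl
  · exact h1
  · simp only [solForm, h3]
    exact (Int.mul_ediv_cancel_left _ hf.pos.ne').symm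

lemma solForm_shift {n t : ℤ} (hn : n ≠ 0) (hdvd : n ∣ polD D t) (k : ℤ) :
    solForm D n (t + n * k) = (solForm D n t).act 1 k 0 1 := by
  obtain ⟨c, hc⟩ := hdvd
  have e : polD D (t + n * k) = n * (n * k ^ 2 + (2 * t + parD D) * k + c) := by
    unfold polD at hc ⊢
    linear_combination hc
  rw [QF.act_shift]
  ext
  · simp [solForm]
  · simp only [solForm]; ring
  · simp only [solForm, QF.eval, e, hc, Int.mul_ediv_cancel_left _ hn]; ring

lemma dvd_polD_congr {n t t' : ℤ} (h : t ≡ t' [ZMOD n]) : n ∣ polD D t ↔ n ∣ polD D t' := by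
  have : polD D t ≡ polD D t' [ZMOD n] := by
    unfold polD
    exact Int.ModEq.add (Int.ModEq.add (h.pow 2) (h.mul_left _)) rfl
  exact this.dvd_iff

lemma NegDisc.cls_solForm_congr (h : NegDisc D) {n t t' : ℤ} (hn : 0 < n) (hco : IsCoprime n D)
    (hdvd : n ∣ polD D t) (ht : t ≡ t' [ZMOD n]) :
    cls D (solForm D n t') = cls D (solForm D n t) := by
  obtain ⟨k, hk⟩ := ht.dvd
  have e : t' = t + n * k := by linarith
  rw [e]
  rw [cls_eq_iff h.neg (h.good_solForm hn hco ?_) (h.good_solForm hn hco hdvd)]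
  · exact ⟨1, k, 0, 1, by ring, solForm_shift hn.ne' hdvd k⟩
  · rw [← e]
    exact (dvd_polD_congr ht).1 hdvd

/-- The class of the form attached to a residue class modulo `n`. -/
noncomputable def solCls (D : ℤ) (n : ℕ) (t : ZMod n) : Cl D := cls D (solForm D n (t.val : ℤ))

/-- The roots of the minimal polynomial modulo `n`. -/
def IsSol (D : ℤ) (n : ℕ) (t : ZMod n) : Prop :=
    t ^ 2 + (parD D : ZMod n) * t + (nrmD D : ZMod n) = 0

lemma isSol_intCast {n : ℕ} (t : ℤ) : IsSol D n (t : ZMod n) ↔ (n : ℤ) ∣ polD D t := by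
  rw [← ZMod.intCast_zmod_eq_zero_iff_dvd]
  unfold IsSol polD
  push_cast
  rfl

lemma intCast_val {n : ℕ} [NeZero n] (t : ZMod n) : (((t.val : ℕ) : ℤ) : ZMod n) = t := by
  simp

lemma NegDisc.solCls_intCast (h : NegDisc D) {n : ℕ} (hn : 0 < n) (hco : IsCoprime (n : ℤ) D)
    {t : ℤ}
    (hdvd : (n : ℤ) ∣ polD D t) : solCls D n (t : ZMod n) = cls D (solForm D n t) := by
  have : NeZero n := ⟨hn.ne'⟩
  unfold solCls
  refine h.cls_solForm_congr (by exact_mod_cast hn) hco hdvd ?_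
  rw [← ZMod.intCast_eq_intCast_iff, intCast_val]

/-- The only proper automorphs of a form of discriminant less than `-4` are `± 1`. -/
lemma QF.Good.automorph {f : QF} (hf : f.Good D) (hD : D < -4) {p q r s : ℤ}
    (hdet : p * s - q * r = 1) (h : f.act p q r s = f) :
    (p = 1 ∧ q = 0 ∧ r = 0 ∧ s = 1) ∨ (p = -1 ∧ q = 0 ∧ r = 0 ∧ s = -1) := by
  have h1 := congrArg QF.a h
  have h2 := congrArg QF.b h
  have h3 := congrArg QF.c h
  have ha := hf.pos
  have hd := hf.disc_eq
  obtain ⟨u, v, w, huvw⟩ := hf.exists_bezout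
  simp only [QF.act, QF.eval, QF.disc] at h1 h2 h3 hd
  have e1 : f.a * (p - s) = - f.b * r := by
    have : 2 * (f.a * (p - s)) = 2 * (- f.b * r) := by
      linear_combination -(2 * f.a * p + f.b * r) * hdet + 2 * s * h1 - r * h2
    linarith
  have e2 : f.a * q = - f.c * r := by
    have : 2 * (f.a * q) = 2 * (- f.c * r) := by
      linear_combination -(2 * f.a * q + f.b * s) * hdet + s * h2 - 2 * r * h3
    linarith
  have e3 : r = f.a * (u * r - v * (p - s) - w * q) := by
    linear_combination (-r) * huvw + v * e1 + w * e2
  set k := u * r - v * (p - s) - w * q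
  have e4 : f.a ^ 2 * ((p + s) ^ 2 - 4) = f.a ^ 2 * (D * k ^ 2) := by
    rw [← hd]
    have : f.a ^ 2 * ((p + s) ^ 2 - 4) = (f.b ^ 2 - 4 * f.a * f.c) * r ^ 2 := by
      linear_combination (f.a * (p - s) - f.b * r) * e1 + 4 * f.a * r * e2 + 4 * f.a ^ 2 * hdet
    rw [this, e3]
    ring
  have e5 := mul_left_cancel₀ (by positivity) e4
  have hk : k = 0 := by
    by_contra hk
    have : 0 < k ^ 2 := by positivity
    nlinarith [sq_nonneg (p + s)]
  rw [hk, mul_zero] at e3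
  subst e3
  have hq : q = 0 := by
    have : f.a * q = 0 := by linarith
    exact (mul_eq_zero.1 this).resolve_left ha.ne'
  have hps : p = s := by
    have : f.a * (p - s) = 0 := by linarith
    have := (mul_eq_zero.1 this).resolve_left ha.ne'
    linarith
  subst hq hps
  have : p * p = 1 := by linarith
  rcases mul_self_eq_one_iff.1 this with rfl | rfl
  · simp
  · simp

/-- The primitive representations of `n` by `f`. -/
def primReps (f : QF) (n : ℕ) : Set (ℤ × ℤ) := {z | IsCoprime z.1 z.2 ∧ f.eval z.1 z.2 = n}

/-- The roots modulo `n` in a given class. -/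
def solSet (D : ℤ) (A : Cl D) (n : ℕ) : Set (ZMod n) := {t | IsSol D n t ∧ solCls D n t = A}

lemma QF.act_act (f : QF) (p q r s p' q' r' s' : ℤ) : (f.act p q r s).act p' q' r' s' =
    f.act (p * p' + q * r') (p * q' + q * s') (r * p' + s * r') (r * q' + s * s') := by
  ext <;> simp only [act, eval] <;> ring

lemma QF.Good.act_eq_act {f : QF} (hf : f.Good D) (hD : D < -4) {p q r s p' q' r' s' : ℤ}
    (hdet : p * s - q * r = 1) (hdet' : p' * s' - q' * r' = 1)
    (h : f.act p q r s = f.act p' q' r' s') :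
    (p' = p ∧ q' = q ∧ r' = r ∧ s' = s) ∨ (p' = -p ∧ q' = -q ∧ r' = -r ∧ s' = -s) := by
  have h1 : (f.act p q r s).act s (-q) (-r) p = (f.act p' q' r' s').act s (-q) (-r) p := by rw [h]
  rw [QF.act_act_inv f hdet, QF.act_act] at h1
  have hd : (p' * s + q' * -r) * (r' * -q + s' * p) - (p' * -q + q' * p) * (r' * s + s' * -r) =
      1 := by
    linear_combination (p' * s' - q' * r') * hdet + hdet'
  rcases hf.automorph hD hd h1.symm with ⟨e1, e2, e3, e4⟩ | ⟨e1, e2, e3, e4⟩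
  · left
    refine ⟨?_, ?_, ?_, ?_⟩
    · linear_combination (-p') * hdet + p * e1 + r * e2
    · linear_combination (-q') * hdet + q * e1 + s * e2
    · linear_combination (-r') * hdet + p * e3 + r * e4
    · linear_combination (-s') * hdet + q * e3 + s * e4
  · right
    refine ⟨?_, ?_, ?_, ?_⟩
    · linear_combination (-p') * hdet + p * e1 + r * e2
    · linear_combination (-q') * hdet + q * e1 + s * e2
    · linear_combination (-r') * hdet + p * e3 + r * e4
    · linear_combination (-s') * hdet + q * e3 + s * e4

lemma NegDisc.good_val (h : NegDisc D) {n : ℕ} (hn : 0 < n) (hco : IsCoprime (n : ℤ) D)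
    {t : ZMod n} (ht : IsSol D n t) : (solForm D n (t.val : ℤ)).Good D := by
  have : NeZero n := ⟨hn.ne'⟩
  refine h.good_solForm (by exact_mod_cast hn) hco ?_
  rw [← isSol_intCast, intCast_val]
  exact ht

theorem ncard_primReps (hD : D < -4) {f : QF} (hf : f.Good D) {n : ℕ} (hn : 0 < n)
    (hco : IsCoprime (n : ℤ) D) : (primReps f n).ncard = 2 * (solSet D (cls D f) n).ncard := by
  have hD0 : D < 0 := by linarith
  have h := hf.negDisc hD0
  have : NeZero n := ⟨hn.ne'⟩
  have hn' : (0 : ℤ) < n := by exact_mod_cast hn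
  have key : ∀ t : solSet D (cls D f) n, ∃ p q r s : ℤ, p * s - q * r = 1 ∧
      solForm D n (t.1.val : ℤ) = f.act p q r s := fun t ↦
    (cls_eq_iff hD0 (h.good_val hn hco t.2.1) hf).1 t.2.2
  choose p q r s hdet hact using key
  have hval : ∀ t, f.eval (p t) (r t) = n := fun t ↦ by
    have := congrArg QF.a (hact t)
    exact this.symm
  let σ : solSet D (cls D f) n × ℤˣ → primReps f n := fun x ↦
    ⟨((x.2 : ℤ) * p x.1, (x.2 : ℤ) * r x.1), by
      rcases Int.units_eq_one_or x.2 with hu | hu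
      · rw [hu]
        refine ⟨⟨s x.1, -q x.1, ?_⟩, ?_⟩
        · simp only [Units.val_one]; linarith [hdet x.1]
        · simpa using hval x.1
      · rw [hu]
        refine ⟨⟨-s x.1, q x.1, ?_⟩, ?_⟩
        · simp only [Units.val_neg, Units.val_one]; linarith [hdet x.1]
        · rw [← hval x.1]; simp [QF.eval]⟩
  have hσ : Function.Bijective σ := by
    constructor
    · rintro ⟨t, ε⟩ ⟨t', ε'⟩ heq
      have e1 : (ε : ℤ) * p t = ε' * p t' := congrArg (fun z ↦ z.1.1) heq
      have e2 : (ε : ℤ) * r t = ε' * r t' := congrArg (fun z ↦ z.1.2) heq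
      have hε : (ε : ℤ) * ε = 1 := by rcases Int.units_eq_one_or ε with h | h <;> simp [h]
      obtain ⟨δ, hδ2, hp, hr⟩ : ∃ δ : ℤ, δ * δ = 1 ∧ p t = δ * p t' ∧ r t = δ * r t' := by
        refine ⟨ε * ε', ?_, ?_, ?_⟩
        · have : (ε' : ℤ) * ε' = 1 := by rcases Int.units_eq_one_or ε' with h | h <;> simp [h]
          calc (ε * ε' : ℤ) * (ε * ε') = (ε * ε) * (ε' * ε') := by ring
            _ = 1 := by rw [hε, this, one_mul]
        · linear_combination ε * e1 - p t * hε
        · linear_combination ε * e2 - r t * hε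
      have hb := congrArg QF.b (hact t)
      have hb' := congrArg QF.b (hact t')
      simp only [solForm, QF.act] at hb hb'
      have hfn := hval t'
      simp only [QF.eval] at hfn
      have d1 := hdet t
      have d2 := hdet t'
      rw [hp, hr] at d1 hb
      have hdiff : ((t.1.val : ℕ) : ℤ) - ((t'.1.val : ℕ) : ℤ) =
          n * (δ * (q t * s t' - s t * q t')) := by
        have e1 : δ * q t - q t' = δ * (q t * s t' - s t * q t') * p t' := by
          linear_combination q t' * d1 - δ * q t * d2
        have e2 : δ * s t - s t' = δ * (q t * s t' - s t * q t') * r t' := by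
          linear_combination s t' * d1 - δ * s t * d2
        have : 2 * (((t.1.val : ℕ) : ℤ) - ((t'.1.val : ℕ) : ℤ)) =
            2 * (n * (δ * (q t * s t' - s t * q t'))) := by
          rw [← hfn]
          linear_combination hb - hb' + (2 * f.a * p t' + f.b * r t') * e1 +
            (f.b * p t' + 2 * f.c * r t') * e2
        linarith
      have ht : t = t' := by
        apply Subtype.ext
        rw [← intCast_val t.1, ← intCast_val t'.1, ZMod.intCast_eq_intCast_iff]
        apply Int.ModEq.symm
        exact (Int.modEq_iff_dvd).2 ⟨_, hdiff⟩
      subst ht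
      have : ε = ε' := by
        have d := hdet t
        ext
        linear_combination (- (ε : ℤ) + ε') * d + s t * e1 - q t * e2
      rw [this]
    · rintro ⟨⟨x, y⟩, ⟨u, v, huv⟩, hxy⟩
      simp only at huv hxy
      have hd : x * u - (-v) * y = 1 := by linarith
      have hg := hf.act hD0 hd
      obtain ⟨T, hT, hgT⟩ := h.eq_solForm hg
      have ha : (f.act x (-v) y u).a = n := hxy
      rw [ha] at hT hgT
      have hsol : IsSol D n (T : ZMod n) := (isSol_intCast T).2 hT
      have hcl : cls D (solForm D n T) = cls D f := by
        rw [← hgT]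
        exact (cls_eq_iff hD0 hg hf).2 ⟨_, _, _, _, hd, rfl⟩
      let t : solSet D (cls D f) n := ⟨T, hsol, by rw [h.solCls_intCast hn hco hT, hcl]⟩
      obtain ⟨k, hk⟩ : ∃ k, T = ((t.1.val : ℕ) : ℤ) + n * k := by
        have : (((t.1.val : ℕ) : ℤ) : ZMod n) = (T : ZMod n) := intCast_val t.1
        rw [ZMod.intCast_eq_intCast_iff] at this
        obtain ⟨k, hk⟩ := this.dvd
        exact ⟨k, by linarith⟩
      have hdv : (n : ℤ) ∣ polD D ((t.1.val : ℕ) : ℤ) := by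
        rw [← isSol_intCast, intCast_val]
        exact hsol
      have h1 := solForm_shift hn'.ne' hdv k
      rw [← hk, ← hgT, hact t, QF.act_act] at h1
      have d2 : (p t * 1 + q t * 0) * (r t * k + s t * 1) -
          (p t * k + q t * 1) * (r t * 1 + s t * 0) = 1 := by
        linear_combination hdet t
      rcases hf.act_eq_act hD hd d2 h1 with ⟨e1, -, e3, -⟩ | ⟨e1, -, e3, -⟩
      · refine ⟨(t, 1), ?_⟩
        apply Subtype.ext
        simp only [σ]
        ext
        · simp; linarith
        · simp; linarith
      · refine ⟨(t, -1), ?_⟩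
        apply Subtype.ext
        simp only [σ]
        ext
        · simp; linarith
        · simp; linarith
  have := Nat.card_eq_of_bijective σ hσ
  rw [Nat.card_prod] at this
  rw [← Nat.card_coe_set_eq, ← this, ← Nat.card_coe_set_eq]
  simp [mul_comm]

/-- `p` is a prime not dividing `D` modulo which the minimal polynomial has a root. -/
def IsSplit (D : ℤ) (p : ℕ) : Prop :=
  p.Prime ∧ IsCoprime (p : ℤ) D ∧ ∃ t, (p : ℤ) ∣ polD D t

open Classical in
/-- The class of a form with leading coefficient the split prime `p`. -/
noncomputable def primeCls (D : ℤ) (p : ℕ) : Cl D :=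
  if h : IsSplit D p then cls D (solForm D p h.2.2.choose) else 1

lemma isCoprime_deriv (h : NegDisc D) {p : ℕ} (hp : p.Prime) (hco : IsCoprime (p : ℤ) D) {t : ℤ}
    (ht : (p : ℤ) ∣ polD D t) : IsCoprime (p : ℤ) (2 * t + parD D) := by
  rw [Prime.coprime_iff_not_dvd (Nat.prime_iff_prime_int.1 hp)]
  intro hd
  have : (p : ℤ) ∣ D := by
    rw [← h.disc_eq t]
    exact dvd_sub (dvd_pow hd two_ne_zero) (ht.mul_left _)
  exact (Nat.prime_iff_prime_int.1 hp).not_isUnit (hco.isUnit_of_dvd' dvd_rfl this)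

lemma hensel (h : NegDisc D) {p : ℕ} (hp : p.Prime) (hco : IsCoprime (p : ℤ) D) {t₀ : ℤ}
    (ht₀ : (p : ℤ) ∣ polD D t₀) (k : ℕ) :
    ∃ t, t₀ ≡ t [ZMOD p] ∧ ((p ^ (k + 1) : ℕ) : ℤ) ∣ polD D t := by
  induction k with
  | zero => exact ⟨t₀, rfl, by simpa using ht₀⟩
  | succ k ih =>
    obtain ⟨t, h1, c, hc⟩ := ih
    have hpt : (p : ℤ) ∣ polD D t := (dvd_polD_congr h1).1 ht₀
    obtain ⟨u, v, huv⟩ := isCoprime_deriv h hp hco hpt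
    refine ⟨t + p ^ (k + 1) * (-c * v), ?_, v * p ^ k * (c ^ 2 * v) * 1 + c * u, ?_⟩
    · refine h1.trans ?_
      refine (Int.modEq_iff_dvd).2 ⟨p ^ k * (-c * v), ?_⟩
      ring
    · unfold polD at hc ⊢
      push_cast at hc ⊢
      linear_combination hc - c * p ^ (k + 1) * huv

lemma cls_prime_pow (h : NegDisc D) {p : ℕ} (hp : p.Prime) (hco : IsCoprime (p : ℤ) D) (k : ℕ) :
    ∀ {t : ℤ}, ((p ^ (k + 1) : ℕ) : ℤ) ∣ polD D t →
      cls D (solForm D (p ^ (k + 1) : ℕ) t) = cls D (solForm D p t) ^ (k + 1) := by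
  induction k with
  | zero => intro t _; simp
  | succ k ih =>
    intro t ht
    have hp0 : (0 : ℤ) < p := by exact_mod_cast hp.pos
    have hp1 : ∀ j : ℕ, (0 : ℤ) < ((p ^ j : ℕ) : ℤ) := fun j ↦ by exact_mod_cast pow_pos hp.pos j
    have hd1 : ((p ^ (k + 1) : ℕ) : ℤ) ∣ polD D t :=
        (Int.natCast_dvd_natCast.2 (pow_dvd_pow p (by omega))).trans ht
    have hd2 : (p : ℤ) ∣ polD D t :=
      (Int.natCast_dvd_natCast.2 (dvd_pow_self p (by omega))).trans ht
    rw [pow_succ (cls D _), ← ih hd1]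
    obtain ⟨v, w, hvw⟩ := isCoprime_deriv h hp hco hd2
    have hpow : ∀ j : ℕ, IsCoprime ((p ^ j : ℕ) : ℤ) D := fun j ↦ by
      push_cast; exact hco.pow_left
    have g1 := h.good_solForm (hp1 _) (hpow _) hd1
    have g2 := h.good_solForm hp0 hco hd2
    have g3 := h.good_solForm (hp1 _) (hpow _) ht
    obtain ⟨c, hc⟩ := ht
    have q1 : solForm D ((p ^ (k + 1) : ℕ) : ℤ) t = ⟨(p ^ (k + 1) : ℕ), 2 * t + parD D, p * c⟩ := by
      ext <;> simp only [solForm]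
      apply Int.ediv_eq_of_eq_mul_right (hp1 _).ne'
      rw [hc]; push_cast; ring
    have q2 : solForm D (p : ℤ) t = ⟨p, 2 * t + parD D, (p ^ (k + 1) : ℕ) * c⟩ := by
      ext <;> simp only [solForm]
      apply Int.ediv_eq_of_eq_mul_right (by positivity)
      rw [hc]; push_cast; ring
    have q3 : solForm D ((p ^ (k + 1 + 1) : ℕ) : ℤ) t =
        ⟨(p ^ (k + 1) : ℕ) * p, 2 * t + parD D, c⟩ := by
      ext <;> simp only [solForm]
      · push_cast; ring
      · apply Int.ediv_eq_of_eq_mul_right (hp1 _).ne'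
        rw [hc]
    rw [q1] at g1 ⊢
    rw [q2] at g2 ⊢
    rw [q3] at g3 ⊢
    exact cls_mul (u := 0) (v := v) (w := w) (by linarith) g1 g2 g3

lemma solForm_conj (n t : ℤ) : solForm D n (-parD D - t) = (solForm D n t).conj := by
  have : polD D (-parD D - t) = polD D t := by unfold polD; ring
  ext <;> simp only [solForm, QF.conj, this]
  ring

lemma root_cases (h : NegDisc D) {p : ℕ} (hp : p.Prime) (hco : IsCoprime (p : ℤ) D) {k : ℕ}
    {t t' : ℤ} (ht : ((p ^ (k + 1) : ℕ) : ℤ) ∣ polD D t)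
    (ht' : ((p ^ (k + 1) : ℕ) : ℤ) ∣ polD D t') :
    t ≡ t' [ZMOD (p ^ (k + 1) : ℕ)] ∨ -parD D - t ≡ t' [ZMOD (p ^ (k + 1) : ℕ)] := by
  have hpi := Nat.prime_iff_prime_int.1 hp
  have hmul : ((p ^ (k + 1) : ℕ) : ℤ) ∣ (t' - t) * (t' - (-parD D - t)) := by
    have e : (t' - t) * (t' - (-parD D - t)) = polD D t' - polD D t := by unfold polD; ring
    rw [e]
    exact dvd_sub ht' ht
  have hd2 : (p : ℤ) ∣ polD D t :=
    (Int.natCast_dvd_natCast.2 (dvd_pow_self p (by omega))).trans ht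
  rw [Int.modEq_iff_dvd, Int.modEq_iff_dvd]
  push_cast at hmul ⊢
  by_cases h1 : (p : ℤ) ∣ t' - t
  · left
    refine (IsCoprime.pow_left ?_).dvd_of_dvd_mul_right hmul
    rw [Prime.coprime_iff_not_dvd hpi]
    intro h2
    have h3 := dvd_sub h2 h1
    have h4 := isCoprime_deriv h hp hco hd2
    rw [Prime.coprime_iff_not_dvd hpi] at h4
    exact h4 ((dvd_congr_right' (by ring)).1 h3)
  · right
    refine (IsCoprime.pow_left ?_).dvd_of_dvd_mul_left hmul
    rwa [Prime.coprime_iff_not_dvd hpi]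
  where dvd_congr_right' {m n k : ℤ} (h : m = n) : k ∣ m ↔ k ∣ n := by rw [h]

open Classical in
/-- The sum of `χ` over the classes of the roots modulo `n`. -/
noncomputable def rootSum (χ : Cl D →* ℂ) (n : ℕ) : ℂ :=
  ∑ᶠ t : ZMod n, if IsSol D n t then χ (solCls D n t) else 0

open Classical in
lemma rootSum_eq (χ : Cl D →* ℂ) (n : ℕ) [NeZero n] :
    rootSum χ n = ∑ t : ZMod n, if IsSol D n t then χ (solCls D n t) else 0 :=
  finsum_eq_sum_of_fintype _

lemma NegDisc.cls_principal (h : NegDisc D) : cls D (solForm D 1 0) = 1 := by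
  have g := h.good_principal
  have h2 := cls_mul (D := D) (a₁ := 1) (a₂ := 1) (b := parD D) (c := nrmD D) (u := 1) (v := 0)
    (w := 0) (by ring)
  have e : solForm D 1 0 = ⟨1, parD D, nrmD D⟩ := by
    ext <;> simp [solForm, polD]
  simp only [one_mul] at h2
  rw [← e] at h2
  exact (mul_eq_left (a := cls D (solForm D 1 0))).1 (h2 g g g).symm

lemma rootSum_one (h : NegDisc D) (χ : Cl D →* ℂ) : rootSum χ 1 = 1 := by
  classical
  rw [rootSum_eq]
  have h0 : IsSol D 1 0 := Subsingleton.elim _ _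
  have h1 : solCls D 1 0 = 1 := by
    rw [← h.cls_principal]
    simp [solCls]
  have : ∀ t : ZMod 1, t = 0 := fun t ↦ Subsingleton.elim _ _
  rw [Fintype.sum_eq_single 0 fun x hx ↦ absurd (this x) hx, if_pos h0, h1, map_one]

lemma rootSum_mul (h : NegDisc D) (χ : Cl D →* ℂ) {m n : ℕ} (hmn : m.Coprime n)
    (hm0 : m ≠ 0) (hn0 : n ≠ 0) (hm : IsCoprime (m : ℤ) D) (hn : IsCoprime (n : ℤ) D) :
    rootSum χ (m * n) = rootSum χ m * rootSum χ n := by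
  classical
  have : NeZero m := ⟨hm0⟩
  have : NeZero n := ⟨hn0⟩
  have hm1 : (0 : ℤ) < m := by exact_mod_cast Nat.pos_of_ne_zero hm0
  have hn1 : (0 : ℤ) < n := by exact_mod_cast Nat.pos_of_ne_zero hn0
  have hco : IsCoprime ((m * n : ℕ) : ℤ) D := by push_cast; exact hm.mul_left hn
  rw [rootSum_eq, rootSum_eq, rootSum_eq, Fintype.sum_mul_sum, ← Fintype.sum_prod_type',
    ← (ZMod.chineseRemainder hmn).toEquiv.sum_comp]
  refine Finset.sum_congr rfl fun t _ ↦ ?_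
  obtain ⟨T, rfl⟩ : ∃ T : ℤ, (T : ZMod (m * n)) = t := ⟨_, intCast_val t⟩
  have e : (ZMod.chineseRemainder hmn).toEquiv (T : ZMod (m * n)) =
      ((T : ZMod m), (T : ZMod n)) := by
    have := map_intCast (ZMod.chineseRemainder hmn) T
    exact this
  rw [e]
  simp only [isSol_intCast]
  by_cases h1 : (m : ℤ) ∣ polD D T
  · by_cases h2 : (n : ℤ) ∣ polD D T
    · have h3 : ((m * n : ℕ) : ℤ) ∣ polD D T := by
        push_cast
        exact (Nat.isCoprime_iff_coprime.2 hmn).mul_dvd h1 h2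
      rw [if_pos h1, if_pos h2, if_pos h3, h.solCls_intCast (by positivity) hco h3,
        h.solCls_intCast (by positivity) hm h1, h.solCls_intCast (by positivity) hn h2, ← map_mul]
      congr 1
      have g1 := h.good_solForm hm1 hm h1
      have g2 := h.good_solForm hn1 hn h2
      have g3 := h.good_solForm (by positivity) hco h3
      obtain ⟨c, hc⟩ := h3
      have q1 : solForm D m T = ⟨m, 2 * T + parD D, n * c⟩ := by
        ext <;> simp only [solForm]
        apply Int.ediv_eq_of_eq_mul_right (by positivity)
        rw [hc]; push_cast; ring
      have q2 : solForm D n T = ⟨n, 2 * T + parD D, m * c⟩ := by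
        ext <;> simp only [solForm]
        apply Int.ediv_eq_of_eq_mul_right (by positivity)
        rw [hc]; push_cast; ring
      have q3 : solForm D (m * n : ℕ) T = ⟨m * n, 2 * T + parD D, c⟩ := by
        ext <;> simp only [solForm]
        · push_cast; ring
        · apply Int.ediv_eq_of_eq_mul_right (by positivity)
          rw [hc]
      obtain ⟨u, v, huv⟩ := Nat.isCoprime_iff_coprime.2 hmn
      rw [q1] at g1 ⊢
      rw [q2] at g2 ⊢
      rw [q3] at g3 ⊢
      exact cls_mul (u := u) (v := v) (w := 0) (by linarith) g1 g2 g3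
    · rw [if_neg h2, mul_zero, if_neg]
      intro h3
      exact h2 ((Dvd.intro_left _ (by push_cast; rfl)).trans h3)
  · rw [if_neg h1, zero_mul, if_neg]
    intro h3
    exact h1 ((Dvd.intro _ (by push_cast; rfl)).trans h3)

lemma rootSum_prime_pow_of_split (h : NegDisc D) (χ : Cl D →* ℂ) {p : ℕ} (hp : IsSplit D p)
    (k : ℕ) :
    rootSum χ (p ^ (k + 1)) = χ (primeCls D p) ^ (k + 1) + χ (primeCls D p)⁻¹ ^ (k + 1) := by
  classical
  have : NeZero (p ^ (k + 1)) := ⟨(pow_pos hp.1.pos _).ne'⟩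
  have hpos := pow_pos hp.1.pos (k + 1)
  have hco : IsCoprime ((p ^ (k + 1) : ℕ) : ℤ) D := by
    push_cast; exact hp.2.1.pow_left
  have hp0 : (0 : ℤ) < p := by exact_mod_cast hp.1.pos
  have hcl : primeCls D p = cls D (solForm D p hp.2.2.choose) := by
    unfold primeCls; rw [dif_pos hp]
  have hroot := hp.2.2.choose_spec
  obtain ⟨t, h1, ht⟩ := hensel h hp.1 hp.2.1 hroot k
  have hpt : (p : ℤ) ∣ polD D t := (dvd_polD_congr h1).1 hroot
  have ht2 : ((p ^ (k + 1) : ℕ) : ℤ) ∣ polD D (-parD D - t) := by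
    have : polD D (-parD D - t) = polD D t := by unfold polD; ring
    rwa [this]
  have c1 : solCls D (p ^ (k + 1)) (t : ZMod (p ^ (k + 1))) = primeCls D p ^ (k + 1) := by
    rw [h.solCls_intCast hpos hco ht, cls_prime_pow h hp.1 hp.2.1 k ht, hcl,
      h.cls_solForm_congr hp0 hp.2.1 hroot h1]
  have c2 : solCls D (p ^ (k + 1)) ((-parD D - t : ℤ) : ZMod (p ^ (k + 1))) =
      (primeCls D p)⁻¹ ^ (k + 1) := by
    rw [inv_pow, ← c1, h.solCls_intCast hpos hco ht, h.solCls_intCast hpos hco ht2, solForm_conj,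
      cls_conj (h.good_solForm (by exact_mod_cast hpos) hco ht)]
  rw [rootSum_eq, ← map_pow, ← map_pow, ← c1, ← c2, Finset.sum_eq_add (t : ZMod (p ^ (k + 1)))
    ((-parD D - t : ℤ) : ZMod (p ^ (k + 1)))]
  · rw [if_pos ((isSol_intCast t).2 ht), if_pos ((isSol_intCast _).2 ht2)]
  · rw [Ne, ZMod.intCast_eq_intCast_iff, Int.modEq_iff_dvd]
    intro hd
    have hd2 : (p : ℤ) ∣ (2 * t + parD D) := by
      have := (Int.natCast_dvd_natCast.2 (dvd_pow_self p (show k + 1 ≠ 0 by omega))).trans hd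
      rw [← dvd_neg]
      exact (dvd_congr (by ring)).1 this
    have h4 := isCoprime_deriv h hp.1 hp.2.1 hpt
    exact (Nat.prime_iff_prime_int.1 hp.1).not_isUnit (h4.isUnit_of_dvd' dvd_rfl hd2)
  · rintro x - ⟨hx1, hx2⟩
    rw [if_neg]
    intro hx
    obtain ⟨T, rfl⟩ : ∃ T : ℤ, (T : ZMod (p ^ (k + 1))) = x := ⟨_, intCast_val x⟩
    rw [isSol_intCast] at hx
    rcases root_cases h hp.1 hp.2.1 ht hx with h5 | h5
    · exact hx1 ((ZMod.intCast_eq_intCast_iff _ _ _).2 h5).symm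
    · exact hx2 ((ZMod.intCast_eq_intCast_iff _ _ _).2 h5).symm
  · simp
  · simp
  where dvd_congr {m n k : ℤ} (h : m = n) : k ∣ m ↔ k ∣ n := by rw [h]

lemma rootSum_prime_pow_of_not_split (χ : Cl D →* ℂ) {p : ℕ} (hp : p.Prime)
    (hco : IsCoprime (p : ℤ) D) (hs : ¬ IsSplit D p) (k : ℕ) : rootSum χ (p ^ (k + 1)) = 0 := by
  classical
  have : NeZero (p ^ (k + 1)) := ⟨(pow_pos hp.pos _).ne'⟩
  rw [rootSum_eq]
  refine Finset.sum_eq_zero fun x _ ↦ ?_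
  rw [if_neg]
  intro hx
  obtain ⟨T, rfl⟩ : ∃ T : ℤ, (T : ZMod (p ^ (k + 1))) = x := ⟨_, intCast_val x⟩
  rw [isSol_intCast] at hx
  exact hs ⟨hp, hco, T, (Int.natCast_dvd_natCast.2 (dvd_pow_self p (by omega))).trans hx⟩

lemma rootSum_eq_sum_cls [Fintype (Cl D)] (χ : Cl D →* ℂ) (n : ℕ) [NeZero n] :
    rootSum χ n = ∑ A : Cl D, χ A * ((solSet D A n).ncard : ℂ) := by
  classical
  rw [rootSum_eq, ← Finset.sum_filter, ← Finset.sum_fiberwise _ (fun t ↦ solCls D n t)]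
  refine Finset.sum_congr rfl fun A _ ↦ ?_
  rw [Finset.filter_filter]
  have : solSet D A n = (Finset.univ.filter fun t : ZMod n ↦ IsSol D n t ∧ solCls D n t = A) := by
    ext t; simp [solSet]
  rw [this, Set.ncard_coe_finset, Finset.sum_congr rfl (g := fun _ ↦ χ A)]
  · simp [mul_comm]
  · intro x hx
    rw [(Finset.mem_filter.1 hx).2.2]

/-- The multiplicative function with value `ℓ p k` at the prime power `p ^ k`, `k ≠ 0`. -/
noncomputable def mulFn (ℓ : ℕ → ℕ → ℝ) (n : ℕ) : ℝ :=
  if n = 0 then 0 else n.factorization.prod ℓ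

section mulFn

variable (ℓ : ℕ → ℕ → ℝ)

@[simp] lemma mulFn_zero : mulFn ℓ 0 = 0 := by simp [mulFn]

@[simp] lemma mulFn_one : mulFn ℓ 1 = 1 := by simp [mulFn]

lemma mulFn_mul {m n : ℕ} (h : m.Coprime n) : mulFn ℓ (m * n) = mulFn ℓ m * mulFn ℓ n := by
  unfold mulFn
  rcases eq_or_ne m 0 with rfl | hm
  · simp
  rcases eq_or_ne n 0 with rfl | hn
  · simp
  rw [if_neg hm, if_neg hn, if_neg (mul_ne_zero hm hn),
    Nat.factorization_mul_of_coprime h, Finsupp.prod_add_index_of_disjoint]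
  exact h.disjoint_primeFactors

lemma mulFn_prime_pow {p : ℕ} (hp : p.Prime) (k : ℕ) : mulFn ℓ (p ^ (k + 1)) = ℓ p (k + 1) := by
  unfold mulFn
  rw [if_neg (pow_pos hp.pos _).ne', hp.factorization_pow, Finsupp.prod,
    Finsupp.support_single _ (by omega)]
  simp

variable {ℓ}

lemma abs_mulFn_le {ℓ' : ℕ → ℕ → ℝ} (h : ∀ p k, |ℓ p k| ≤ ℓ' p k) (n : ℕ) :
    |mulFn ℓ n| ≤ mulFn ℓ' n := by
  unfold mulFn
  split_ifs
  · simp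
  · rw [Finsupp.prod, Finsupp.prod, Finset.abs_prod]
    exact Finset.prod_le_prod (fun _ _ ↦ abs_nonneg _) fun _ _ ↦ h _ _

lemma mulFn_nonneg (h : ∀ p k, 0 ≤ ℓ p k) (n : ℕ) : 0 ≤ mulFn ℓ n := by
  unfold mulFn
  split_ifs
  · simp
  · exact Finset.prod_nonneg fun _ _ ↦ h _ _

lemma abs_mulFn (n : ℕ) : |mulFn ℓ n| = mulFn (fun p k ↦ |ℓ p k|) n := by
  unfold mulFn
  split_ifs
  · simp
  · rw [Finsupp.prod, Finsupp.prod, Finset.abs_prod]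

lemma mulFn_le_one (h0 : ∀ p k, 0 ≤ ℓ p k) (h : ∀ p k, ℓ p k ≤ 1) (n : ℕ) : mulFn ℓ n ≤ 1 := by
  unfold mulFn
  split_ifs
  · simp
  · exact Finset.prod_le_one (fun _ _ ↦ h0 _ _) fun _ _ ↦ h _ _

end mulFn

section chars

variable {G : Type*} [CommGroup G]

lemma sum_char_eq_zero [Fintype G] {ψ : G →* ℂˣ} (hψ : ψ ≠ 1) : ∑ A : G, (ψ A : ℂ) = 0 := by
  obtain ⟨B, hB⟩ : ∃ B, ψ B ≠ 1 := by
    by_contra! h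
    exact hψ (MonoidHom.ext h)
  have h1 : (ψ B : ℂ) * ∑ A : G, (ψ A : ℂ) = ∑ A : G, (ψ A : ℂ) := by
    rw [Finset.mul_sum]
    exact Fintype.sum_equiv (Equiv.mulLeft B) _ _ fun A ↦ by simp
  have h2 : (ψ B : ℂ) ≠ 1 := fun h ↦ hB (Units.ext h)
  have h3 : ((ψ B : ℂ) - 1) * ∑ A : G, (ψ A : ℂ) = 0 := by rw [sub_mul, h1]; ring
  exact (mul_eq_zero.1 h3).resolve_left (sub_ne_zero.2 h2)

variable [Finite G]

lemma norm_char (ψ : G →* ℂˣ) (A : G) : ‖(ψ A : ℂ)‖ = 1 := by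
  have h : (ψ A : ℂ) ^ Nat.card G = 1 := by
    rw [← Units.val_pow_eq_pow_val, ← map_pow, pow_card_eq_one']
    simp
  exact Complex.norm_eq_one_of_pow_eq_one h Nat.card_pos.ne'

lemma inv_char (ψ : G →* ℂˣ) (A : G) : ((ψ A)⁻¹ : ℂ) = (starRingEnd ℂ) (ψ A : ℂ) := by
  rw [Complex.inv_def, Complex.normSq_eq_norm_sq, norm_char]
  simp

lemma sum_char_apply_eq_zero [Fintype (G →* ℂˣ)] {A : G} (hA : A ≠ 1) :
    ∑ ψ : G →* ℂˣ, (ψ A : ℂ) = 0 := by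
  obtain ⟨φ, hφ⟩ := CommGroup.exists_apply_ne_one_of_hasEnoughRootsOfUnity G ℂ hA
  have h1 : (φ A : ℂ) * ∑ ψ : G →* ℂˣ, (ψ A : ℂ) = ∑ ψ : G →* ℂˣ, (ψ A : ℂ) := by
    rw [Finset.mul_sum]
    exact Fintype.sum_equiv (Equiv.mulLeft φ) _ _ fun ψ ↦ by simp
  have h2 : (φ A : ℂ) ≠ 1 := fun h ↦ hφ (Units.ext h)
  have h3 : ((φ A : ℂ) - 1) * ∑ ψ : G →* ℂˣ, (ψ A : ℂ) = 0 := by rw [sub_mul, h1]; ring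
  exact (mul_eq_zero.1 h3).resolve_left (sub_ne_zero.2 h2)

lemma card_mul_eq_sum_char [Fintype G] [Fintype (G →* ℂˣ)] {w : G → ℝ} {c : (G →* ℂˣ) → ℝ}
    (h : ∀ ψ : G →* ℂˣ, ∑ B, (w B : ℂ) * (ψ B : ℂ) = c ψ) (A : G) :
    Nat.card G * w A = ∑ ψ : G →* ℂˣ, (ψ A : ℂ).re * c ψ := by
  classical
  have hcard : (Fintype.card (G →* ℂˣ) : ℂ) = Nat.card G := by
    rw [← Nat.card_eq_fintype_card, CommGroup.card_monoidHom_of_hasEnoughRootsOfUnity]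
  have h1 : ∑ ψ : G →* ℂˣ, ((ψ A)⁻¹ : ℂ) * c ψ = Nat.card G * w A := by
    simp_rw [← h, Finset.mul_sum]
    rw [Finset.sum_comm, Finset.sum_eq_single A]
    · rw [Finset.sum_congr rfl (g := fun _ ↦ (w A : ℂ))]
      · rw [Finset.sum_const, Finset.card_univ, nsmul_eq_mul, hcard]
      · intro ψ _
        field_simp
    · intro B _ hB
      have : ∀ ψ : G →* ℂˣ, ((ψ A)⁻¹ : ℂ) * ((w B : ℂ) * (ψ B : ℂ)) =
          (w B : ℂ) * (ψ (A⁻¹ * B) : ℂ) := by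
        intro ψ
        simp only [map_mul, map_inv, Units.val_mul, Units.val_inv_eq_inv_val]
        ring
      simp_rw [this]
      rw [← Finset.mul_sum, sum_char_apply_eq_zero, mul_zero]
      intro hh
      exact hB (inv_mul_eq_one.1 hh).symm
    · simp
  have h2 := congrArg Complex.re h1
  rw [Complex.re_sum] at h2
  simp only [inv_char, ← Complex.ofReal_natCast, ← Complex.ofReal_mul, Complex.ofReal_re,
    Complex.re_mul_ofReal, Complex.conj_re] at h2
  exact h2.symm

lemma abs_re_char_le (ψ : G →* ℂˣ) (A : G) : |(ψ A : ℂ).re| ≤ 1 :=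
  (Complex.abs_re_le_norm _).trans (norm_char ψ A).le

/-- If the Fourier transform of `w` is `c` and `|c| ≤ 1`, the quadratic part of the Fourier
expansion bounds the support of `w`. -/
lemma sum_sq_one_le [Fintype G] [Fintype (G →* ℂˣ)] [DecidableEq (G →* ℂˣ)]
    {w : G → ℝ} {c : (G →* ℂˣ) → ℝ}
    (h : ∀ ψ : G →* ℂˣ, ∑ B, (w B : ℂ) * (ψ B : ℂ) = c ψ) (hc : ∀ ψ, |c ψ| ≤ 1) (A : G) {I : ℝ}
    (hI0 : 0 ≤ I) (hI : w A ≠ 0 → I = 1) :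
    ∑ ψ : G →* ℂˣ with ψ ^ 2 = 1, (ψ A : ℂ).re * c ψ -
      ∑ ψ : G →* ℂˣ with ¬ ψ ^ 2 = 1, |c ψ| ≤
        ((Finset.univ.filter fun ψ : G →* ℂˣ ↦ ψ ^ 2 = 1).card : ℝ) * I := by
  have hab : ∀ ψ : G →* ℂˣ, |(ψ A : ℂ).re * c ψ| ≤ |c ψ| := fun ψ ↦ by
    rw [abs_mul]
    exact mul_le_of_le_one_left (abs_nonneg _) (abs_re_char_le ψ A)
  by_cases hw : w A = 0
  · have h1 := card_mul_eq_sum_char h A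
    rw [hw, mul_zero, ← Finset.sum_filter_add_sum_filter_not _ (fun ψ : G →* ℂˣ ↦ ψ ^ 2 = 1)] at h1
    have h2 : -∑ ψ : G →* ℂˣ with ¬ ψ ^ 2 = 1, (ψ A : ℂ).re * c ψ ≤
        ∑ ψ : G →* ℂˣ with ¬ ψ ^ 2 = 1, |c ψ| := by
      rw [← Finset.sum_neg_distrib]
      exact Finset.sum_le_sum fun ψ _ ↦ (neg_le_abs _).trans (hab ψ)
    have h3 : 0 ≤ ((Finset.univ.filter fun ψ : G →* ℂˣ ↦ ψ ^ 2 = 1).card : ℝ) * I := by positivity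
    linarith
  · rw [hI hw, mul_one]
    have h1 : ∑ ψ : G →* ℂˣ with ψ ^ 2 = 1, (ψ A : ℂ).re * c ψ ≤
        ((Finset.univ.filter fun ψ : G →* ℂˣ ↦ ψ ^ 2 = 1).card : ℝ) := by
      rw [← nsmul_one, ← Finset.sum_const]
      exact Finset.sum_le_sum fun ψ _ ↦ ((le_abs_self _).trans (hab ψ)).trans (hc ψ)
    have h2 : 0 ≤ ∑ ψ : G →* ℂˣ with ¬ ψ ^ 2 = 1, |c ψ| := Finset.sum_nonneg fun _ _ ↦ abs_nonneg _
    linarith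

lemma card_sq_one_chars [Fintype (G →* ℂˣ)] [DecidableEq (G →* ℂˣ)] :
    (Finset.univ.filter fun ψ : G →* ℂˣ ↦ ψ ^ 2 = 1).card = {A : G | A ^ 2 = 1}.ncard := by
  obtain ⟨e⟩ := CommGroup.monoidHom_mulEquiv_of_hasEnoughRootsOfUnity G ℂ
  have : ((Finset.univ.filter fun ψ : G →* ℂˣ ↦ ψ ^ 2 = 1 : Finset (G →* ℂˣ)) : Set (G →* ℂˣ)) =
      e ⁻¹' {A : G | A ^ 2 = 1} := by
    ext ψ
    simp only [Finset.coe_filter, Finset.mem_univ, true_and, Set.mem_preimage, Set.mem_ofPred_eq,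
      ← map_pow, map_eq_one_iff e e.injective]
  rw [← Set.ncard_coe_finset, this, Set.ncard_preimage_of_injective_subset_range e.injective]
  exact fun x _ ↦ e.surjective x

end chars

/-- The indicator function of even numbers. -/
noncomputable def evenInd (k : ℕ) : ℝ := if Even k then 1 else 0

open Classical in
/-- Local data vanishing at primes dividing `D`, equal to `c` at split primes and to `e` at inert
primes. -/
noncomputable def splitLoc (D : ℤ) (c : ℕ → ℕ → ℝ) (e : ℕ → ℝ) (p k : ℕ) : ℝ :=
  if (p : ℤ) ∣ D then 0 else if IsSplit D p then c p k else e k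

/-- The real part of `ψ (A_p ^ k)`, where `A_p` is the class of the split prime `p`. -/
noncomputable def charRe (ψ : Cl D →* ℂˣ) (p k : ℕ) : ℝ := ((ψ (primeCls D p) : ℂ) ^ k).re

/-- The local data of the normalised character sum. -/
noncomputable def charLoc (ψ : Cl D →* ℂˣ) : ℕ → ℕ → ℝ := splitLoc D (charRe ψ) evenInd

/-- The local data of the set of `n` coprime to `D` with even exponents at inert primes. -/
noncomputable def normLoc (D : ℤ) : ℕ → ℕ → ℝ := splitLoc D (fun _ _ ↦ 1) evenInd

/-- The local data of `rootSum`. -/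
noncomputable def rootLoc (ψ : Cl D →* ℂˣ) : ℕ → ℕ → ℝ :=
  splitLoc D (fun p k ↦ 2 * charRe ψ p k) 0

/-- A character with values in `ℂ`. -/
noncomputable def charC (ψ : Cl D →* ℂˣ) : Cl D →* ℂ := (Units.coeHom ℂ).comp ψ

lemma charC_apply (ψ : Cl D →* ℂˣ) (A : Cl D) : charC ψ A = (ψ A : ℂ) := rfl

lemma evenInd_nonneg (k : ℕ) : 0 ≤ evenInd k := by unfold evenInd; split_ifs <;> norm_num

lemma evenInd_le_one (k : ℕ) : evenInd k ≤ 1 := by unfold evenInd; split_ifs <;> norm_num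

lemma abs_splitLoc_le {c c' : ℕ → ℕ → ℝ} {e e' : ℕ → ℝ} (hc : ∀ p k, |c p k| ≤ c' p k)
    (he : ∀ k, |e k| ≤ e' k) (p k : ℕ) : |splitLoc D c e p k| ≤ splitLoc D c' e' p k := by
  unfold splitLoc
  split_ifs
  · simp
  · exact hc _ _
  · exact he _

lemma abs_charRe_le [Finite (Cl D)] (ψ : Cl D →* ℂˣ) (p k : ℕ) : |charRe ψ p k| ≤ 1 := by
  have := abs_re_char_le ψ (primeCls D p ^ k)
  simpa [charRe] using this

lemma abs_charLoc_le [Finite (Cl D)] (ψ : Cl D →* ℂˣ) (p k : ℕ) :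
    |charLoc ψ p k| ≤ normLoc D p k :=
  abs_splitLoc_le (abs_charRe_le ψ) (fun k ↦ by rw [abs_of_nonneg (evenInd_nonneg k)]) p k

lemma normLoc_nonneg (p k : ℕ) : 0 ≤ normLoc D p k := by
  unfold normLoc splitLoc
  split_ifs
  · simp
  · simp
  · exact evenInd_nonneg k

lemma normLoc_le_one (p k : ℕ) : normLoc D p k ≤ 1 := by
  unfold normLoc splitLoc
  split_ifs
  · simp
  · simp
  · exact evenInd_le_one k

lemma not_isCoprime_of_dvd {p : ℕ} (hp : p.Prime) (hd : (p : ℤ) ∣ D) (k : ℕ) :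
    ¬ IsCoprime ((p ^ (k + 1) : ℕ) : ℤ) D := by
  intro h
  have : (p : ℤ) ∣ ((p ^ (k + 1) : ℕ) : ℤ) := Int.natCast_dvd_natCast.2 (dvd_pow_self p (by omega))
  exact (Nat.prime_iff_prime_int.1 hp).not_isUnit (h.isUnit_of_dvd' this hd)

lemma isCoprime_of_not_dvd {p : ℕ} (hp : p.Prime) (hd : ¬ (p : ℤ) ∣ D) : IsCoprime (p : ℤ) D :=
  (Prime.coprime_iff_not_dvd (Nat.prime_iff_prime_int.1 hp)).2 hd

lemma rootSum_eq_mulFn [Finite (Cl D)] (h : NegDisc D) (ψ : Cl D →* ℂˣ) (n : ℕ) (hn : n ≠ 0)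
    (hco : IsCoprime (n : ℤ) D) : rootSum (charC ψ) n = (mulFn (rootLoc ψ) n : ℂ) := by
  induction n using Nat.recOnPosPrimePosCoprime with
  | prime_pow p k hp hk =>
    obtain ⟨k, rfl⟩ : ∃ j, k = j + 1 := ⟨k - 1, by omega⟩
    have hd : ¬ (p : ℤ) ∣ D := fun hd ↦ not_isCoprime_of_dvd hp hd k hco
    have hcp := isCoprime_of_not_dvd hp hd
    rw [mulFn_prime_pow _ hp]
    unfold rootLoc splitLoc
    rw [if_neg hd]
    split_ifs with hs
    · rw [rootSum_prime_pow_of_split h _ hs, charC_apply, charC_apply, map_inv,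
        Units.val_inv_eq_inv_val, inv_char, ← map_pow, Complex.add_conj]
      simp [charRe]
    · rw [rootSum_prime_pow_of_not_split _ hp hcp hs]
      simp
  | zero => exact absurd rfl hn
  | one => simp [rootSum_one h]
  | coprime a b ha hb hab iha ihb =>
    have h1 : IsCoprime (a : ℤ) D := by push_cast at hco; exact hco.of_mul_left_left
    have h2 : IsCoprime (b : ℤ) D := by push_cast at hco; exact hco.of_mul_left_right
    rw [rootSum_mul h _ hab (by omega) (by omega) h1 h2, mulFn_mul _ hab, iha (by omega) h1,
      ihb (by omega) h2]
    push_cast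
    rfl

lemma isCoprime_of_mulFn_ne_zero {c : ℕ → ℕ → ℝ} {e : ℕ → ℝ} {n : ℕ}
    (h : mulFn (splitLoc D c e) n ≠ 0) : IsCoprime (n : ℤ) D := by
  induction n using Nat.recOnPosPrimePosCoprime with
  | prime_pow p k hp hk =>
    obtain ⟨k, rfl⟩ : ∃ j, k = j + 1 := ⟨k - 1, by omega⟩
    rw [mulFn_prime_pow _ hp] at h
    push_cast
    refine (isCoprime_of_not_dvd hp fun hd ↦ h ?_).pow_left
    unfold splitLoc
    rw [if_pos hd]
  | zero => simp at h
  | one => exact isCoprime_one_left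
  | coprime a b ha hb hab iha ihb =>
    rw [mulFn_mul _ hab] at h
    push_cast
    exact (iha (left_ne_zero_of_mul h)).mul_left (ihb (right_ne_zero_of_mul h))

lemma exists_split_part [Finite (Cl D)] (h : NegDisc D) {n : ℕ} (hn : mulFn (normLoc D) n ≠ 0) :
    ∃ m d : ℕ, 0 < m ∧ n = m * d ^ 2 ∧ IsCoprime (m : ℤ) D ∧ rootSum (1 : Cl D →* ℂ) m ≠ 0 ∧
      ∀ ψ : Cl D →* ℂˣ, rootSum (charC ψ) m = mulFn (charLoc ψ) n * rootSum (1 : Cl D →* ℂ) m := by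
  induction n using Nat.recOnPosPrimePosCoprime with
  | prime_pow p k hp hk =>
    obtain ⟨k, rfl⟩ : ∃ j, k = j + 1 := ⟨k - 1, by omega⟩
    rw [mulFn_prime_pow _ hp] at hn
    simp only [mulFn_prime_pow _ hp]
    unfold normLoc splitLoc at hn
    unfold charLoc splitLoc
    split_ifs at hn with hd hs
    · exact absurd rfl hn
    · simp only [if_neg hd, if_pos hs]
      refine ⟨p ^ (k + 1), 1, pow_pos hp.pos _, by simp, ?_, ?_, fun ψ ↦ ?_⟩
      · push_cast; exact hs.2.1.pow_left
      · rw [rootSum_prime_pow_of_split h _ hs]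
        norm_num
      · rw [rootSum_prime_pow_of_split h _ hs, rootSum_prime_pow_of_split h _ hs, charC_apply,
          charC_apply, map_inv, Units.val_inv_eq_inv_val, inv_char, ← map_pow, Complex.add_conj]
        simp [charRe]
        ring
    · simp only [if_neg hd, if_neg hs]
      have hev : Even (k + 1) := by
        by_contra hev
        simp [evenInd, hev] at hn
      obtain ⟨j, hj⟩ := hev
      refine ⟨1, p ^ j, one_pos, ?_, isCoprime_one_left, ?_, fun ψ ↦ ?_⟩
      · rw [hj, one_mul, ← pow_mul]; ring_nf
      · rw [rootSum_one h]; exact one_ne_zero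
      · rw [rootSum_one h, rootSum_one h, evenInd, if_pos ⟨j, hj⟩]
        simp
  | zero => simp at hn
  | one =>
    exact ⟨1, 1, one_pos, by simp, isCoprime_one_left, by simp [rootSum_one h],
      by simp [rootSum_one h]⟩
  | coprime a b ha hb hab iha ihb =>
    rw [mulFn_mul _ hab] at hn
    obtain ⟨m, d, h1, h2, h3, h4, h5⟩ := iha (left_ne_zero_of_mul hn)
    obtain ⟨m', d', h1', h2', h3', h4', h5'⟩ := ihb (right_ne_zero_of_mul hn)
    have hmm : m.Coprime m' :=
      (hab.coprime_dvd_left (h2 ▸ Dvd.intro _ rfl)).coprime_dvd_right (h2' ▸ Dvd.intro _ rfl)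
    refine ⟨m * m', d * d', Nat.mul_pos h1 h1', ?_, ?_, ?_, fun ψ ↦ ?_⟩
    · rw [h2, h2']; ring
    · push_cast; exact h3.mul_left h3'
    · rw [rootSum_mul h _ hmm h1.ne' h1'.ne' h3 h3']
      exact mul_ne_zero h4 h4'
    · rw [rootSum_mul h _ hmm h1.ne' h1'.ne' h3 h3', rootSum_mul h _ hmm h1.ne' h1'.ne' h3 h3',
        mulFn_mul _ hab, h5, h5']
      push_cast
      ring

/-- Lower bound for the indicator function of the integers coprime to `D` represented by `f`. -/
theorem le_card_mul_indicator (hD : D < -4) {f : QF} (hf : f.Good D) [Finite (Cl D)]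
    [Fintype (Cl D →* ℂˣ)] [DecidableEq (Cl D →* ℂˣ)] {n : ℕ} {I : ℝ} (hI0 : 0 ≤ I)
    (hI : 0 < n → IsCoprime (n : ℤ) D → (∃ u v, f.eval u v = n) → I = 1) :
    ∑ ψ : Cl D →* ℂˣ with ψ ^ 2 = 1, (ψ (cls D f) : ℂ).re * mulFn (charLoc ψ) n -
      ∑ ψ : Cl D →* ℂˣ with ¬ ψ ^ 2 = 1, |mulFn (charLoc ψ) n| ≤
        (({A : Cl D | A ^ 2 = 1}.ncard : ℕ) : ℝ) * I := by
  classical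
  have h := hf.negDisc (by omega)
  have := Fintype.ofFinite (Cl D)
  have hle : ∀ ψ : Cl D →* ℂˣ, |mulFn (charLoc ψ) n| ≤ mulFn (normLoc D) n := fun ψ ↦
    abs_mulFn_le (abs_charLoc_le ψ) n
  rw [← card_sq_one_chars]
  by_cases hn : mulFn (normLoc D) n = 0
  · have hz : ∀ ψ : Cl D →* ℂˣ, mulFn (charLoc ψ) n = 0 := fun ψ ↦ by
      have := hle ψ
      rw [hn] at this
      exact abs_nonpos_iff.1 this
    simp only [hz, mul_zero, abs_zero, Finset.sum_const_zero, sub_zero]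
    positivity
  have hcop := isCoprime_of_mulFn_ne_zero hn
  obtain ⟨m, d, hm, hmd, hco, hne, hψ⟩ := exists_split_part h hn
  have : NeZero m := ⟨hm.ne'⟩
  set S : ℝ := ∑ B : Cl D, ((solSet D B m).ncard : ℝ) with hS
  have hS1 : rootSum (1 : Cl D →* ℂ) m = S := by
    rw [rootSum_eq_sum_cls, hS]
    simp
  have hS0 : S ≠ 0 := fun h0 ↦ hne (by rw [hS1, h0]; simp)
  refine sum_sq_one_le (w := fun B ↦ ((solSet D B m).ncard : ℝ) / S)
    (c := fun ψ ↦ mulFn (charLoc ψ) n) (fun ψ ↦ ?_) (fun ψ ↦ ?_) (cls D f) hI0 fun hw ↦ ?_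
  · have h1 := hψ ψ
    rw [rootSum_eq_sum_cls, hS1] at h1
    have h2 : (S : ℂ) ≠ 0 := by exact_mod_cast hS0
    rw [← mul_right_cancel_iff_of_pos_or_ne h2, ← h1, Finset.sum_mul]
    refine Finset.sum_congr rfl fun B _ ↦ ?_
    rw [charC_apply]
    push_cast
    field_simp
  · exact (hle ψ).trans (mulFn_le_one normLoc_nonneg normLoc_le_one n)
  · have h3 : (solSet D (cls D f) m).ncard ≠ 0 := fun h0 ↦ hw (by simp [h0])
    have h4 := ncard_primReps hD hf hm hco
    obtain ⟨⟨x, y⟩, -, hxy⟩ : (primReps f m).Nonempty := Set.nonempty_of_ncard_ne_zero (by omega)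
    have hn0 : 0 < n := Nat.pos_of_ne_zero fun h0 ↦ hn (by simp [h0])
    refine hI hn0 hcop ⟨d * x, d * y, ?_⟩
    have h5 : f.eval x y = m := hxy
    rw [hmd]
    push_cast
    rw [← h5]
    simp only [QF.eval]
    ring
  where
  mul_right_cancel_iff_of_pos_or_ne {a b c : ℂ} (h : c ≠ 0) : a * c = b * c ↔ a = b :=
    mul_left_inj' h

namespace QF

/-- A complex number `τ` with `f(x, y) = |√a x + τ y|²`. -/
noncomputable def tau (f : QF) : ℂ :=
  ⟨f.b / (2 * Real.sqrt f.a), Real.sqrt (-f.disc) / (2 * Real.sqrt f.a)⟩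

/-- The linear embedding of `ℤ²` into `ℂ` for which `f` is the squared norm. -/
noncomputable def emb (f : QF) (z : ℤ × ℤ) : ℂ := z.1 * (Real.sqrt f.a : ℂ) + z.2 * f.tau

variable {f : QF}

lemma sqrt_a_pos (ha : 0 < f.a) : 0 < Real.sqrt f.a := Real.sqrt_pos.2 (by exact_mod_cast ha)

lemma sqrt_disc_pos (hd : f.disc < 0) : 0 < Real.sqrt (-f.disc) :=
  Real.sqrt_pos.2 (by exact_mod_cast neg_pos.2 hd)

lemma norm_sq_emb (ha : 0 < f.a) (hd : f.disc < 0) (z : ℤ × ℤ) :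
    ‖f.emb z‖ ^ 2 = (f.eval z.1 z.2 : ℤ) := by
  have h1 := sqrt_a_pos ha
  have h2 : Real.sqrt f.a ^ 2 = f.a := Real.sq_sqrt (by exact_mod_cast ha.le)
  have h3 : Real.sqrt (-f.disc) ^ 2 = -f.disc := Real.sq_sqrt (by exact_mod_cast (neg_pos.2 hd).le)
  rw [← Complex.normSq_eq_norm_sq, Complex.normSq_apply]
  simp only [emb, tau, Complex.add_re, Complex.add_im, Complex.mul_re, Complex.mul_im,
    Complex.intCast_re, Complex.intCast_im, Complex.ofReal_re, Complex.ofReal_im]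
  have h4 : (4 * f.a : ℝ) * (f.eval z.1 z.2 : ℤ) =
      (2 * f.a * z.1 + f.b * z.2) ^ 2 - f.disc * z.2 ^ 2 := by
    exact_mod_cast f.four_a_eval z.1 z.2
  have ha' : (0 : ℝ) < f.a := by exact_mod_cast ha
  have h5 : (f.eval z.1 z.2 : ℤ) = ((2 * f.a * z.1 + f.b * z.2) ^ 2 - f.disc * z.2 ^ 2) /
      (4 * f.a : ℝ) := by
    rw [eq_div_iff (by positivity)]
    linarith
  rw [h5]
  generalize Real.sqrt f.a = s at *
  generalize Real.sqrt (-f.disc) = t at *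
  rw [show (f.disc : ℝ) = - t ^ 2 by linarith, ← h2]
  field_simp
  ring

lemma emb_injective (ha : 0 < f.a) (hd : f.disc < 0) : Function.Injective f.emb := by
  intro z w h
  have h1 := sqrt_a_pos ha
  have h2 := sqrt_disc_pos hd
  have him := congrArg Complex.im h
  have hre := congrArg Complex.re h
  simp only [emb, tau, Complex.add_re, Complex.add_im, Complex.mul_re, Complex.mul_im,
    Complex.intCast_re, Complex.intCast_im, Complex.ofReal_re, Complex.ofReal_im] at him hre
  have e2 : (z.2 : ℝ) = w.2 := by
    have h3 : Real.sqrt (-f.disc) / (2 * Real.sqrt f.a) ≠ 0 := by positivity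
    apply mul_right_cancel₀ h3
    linarith
  have e1 : (z.1 : ℝ) = w.1 := by
    rw [e2] at hre
    apply mul_right_cancel₀ h1.ne'
    linarith
  exact Prod.ext (by exact_mod_cast e1) (by exact_mod_cast e2)

lemma linearIndependent_tau (ha : 0 < f.a) (hd : f.disc < 0) :
    LinearIndependent ℝ ![(Real.sqrt f.a : ℂ), f.tau] := by
  have h1 := sqrt_a_pos ha
  have h2 := sqrt_disc_pos hd
  rw [LinearIndependent.pair_iff]
  intro s t h
  have him := congrArg Complex.im h
  have hre := congrArg Complex.re h
  simp only [tau, Complex.add_re, Complex.add_im, Complex.real_smul, Complex.mul_re, Complex.mul_im,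
    Complex.ofReal_re, Complex.ofReal_im, Complex.zero_re, Complex.zero_im] at him hre
  have e2 : t = 0 := by
    have h3 : Real.sqrt (-f.disc) / (2 * Real.sqrt f.a) ≠ 0 := by positivity
    apply (mul_eq_zero.1
        (?_ : t * (Real.sqrt (-f.disc) / (2 * Real.sqrt f.a)) = 0)).resolve_right h3
    linarith
  have e1 : s = 0 := by
    apply (mul_eq_zero.1 (?_ : s * Real.sqrt f.a = 0)).resolve_right h1.ne'
    rw [e2] at hre
    linarith
  exact ⟨e1, e2⟩

/-- The number of lattice points in the ellipse `f ≤ N` is asymptotic to its area. -/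
theorem tendsto_ncard_eval_le (ha : 0 < f.a) (hd : f.disc < 0) :
    Filter.Tendsto (fun N : ℝ ↦ ({z : ℤ × ℤ | (f.eval z.1 z.2 : ℝ) ≤ N}.ncard : ℝ) / N)
      Filter.atTop (nhds (2 * Real.pi / Real.sqrt (-f.disc))) := by
  have h1 := sqrt_a_pos ha
  have h2 := sqrt_disc_pos hd
  let B : Module.Basis (Fin 2) ℝ ℂ := basisOfLinearIndependentOfCardEqFinrank
    (linearIndependent_tau ha hd) (by simp [Complex.finrank_real_complex])
  have hB : ⇑B = ![(Real.sqrt f.a : ℂ), f.tau] := coe_basisOfLinearIndependentOfCardEqFinrank _ _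
  let L : Submodule ℤ ℂ := Submodule.span ℤ (Set.range B)
  have hball : {x : ℂ | x ∈ Set.univ ∧ ‖x‖ ^ 2 ≤ 1} = Metric.closedBall 0 1 := by
    ext x
    simp [sq_le_one_iff_abs_le_one]
  have key := ZLattice.covolume.tendsto_card_le_div' (E := ℂ) L (X := Set.univ)
    (F := fun x ↦ ‖x‖ ^ 2) (by simp) (fun x r hr ↦ by
      simp [Complex.finrank_real_complex, mul_pow])
          (by rw [hball]; exact Metric.isBounded_closedBall)
    (by rw [hball]; exact Metric.isClosed_closedBall.measurableSet) (by
      rw [hball]; exact (convex_closedBall (0 : ℂ) 1).addHaar_frontier _)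
  have hcov : ZLattice.covolume L = Real.sqrt (-f.disc) / 2 := by
    rw [ZLattice.covolume_eq_det_mul_measureReal L _ (B.restrictScalars ℤ) Complex.basisOneI]
    have e1 : MeasureTheory.volume.real (ZSpan.fundamentalDomain Complex.basisOneI) = 1 := by
      rw [MeasureTheory.measureReal_congr (ZSpan.fundamentalDomain_ae_parallelepiped _ _)]
      have := Complex.orthonormalBasisOneI.volume_parallelepiped
      rw [Complex.coe_orthonormalBasisOneI] at this
      rw [Complex.coe_basisOneI, MeasureTheory.measureReal_def, this]
      simp
    have e2 : (fun i ↦ ((B.restrictScalars ℤ i : L) : ℂ)) = ![(Real.sqrt f.a : ℂ), f.tau] := by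
      rw [← hB]
      ext i
      simp
    rw [e1, mul_one]
    change |Complex.basisOneI.det fun i ↦ ((B.restrictScalars ℤ i : L) : ℂ)| = _
    rw [e2, Module.Basis.det_apply, Matrix.det_fin_two]
    simp only [Module.Basis.toMatrix_apply, Complex.coe_basisOneI_repr, tau]
    simp
    rw [abs_of_pos h1, abs_of_pos (by positivity)]
    field_simp
  have hvol : MeasureTheory.volume.real (Metric.closedBall (0 : ℂ) 1) = Real.pi := by
    rw [MeasureTheory.measureReal_def, Complex.volume_closedBall]
    simp
  rw [hball, hcov, hvol] at key
  have e : Real.pi / (Real.sqrt (-f.disc) / 2) = 2 * Real.pi / Real.sqrt (-f.disc) := by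
    field_simp
  rw [e] at key
  refine key.congr fun N ↦ ?_
  congr 2
  rw [← Set.ncard_image_of_injective _ (emb_injective ha hd), ← Nat.card_coe_set_eq]
  congr 2
  ext x
  simp only [Set.mem_inter_iff, Set.mem_ofPred_eq, Set.mem_univ, true_and, SetLike.mem_coe,
    Set.mem_image, L, Submodule.mem_span_range_iff_exists_fun, hB, Fin.sum_univ_two]
  constructor
  · rintro ⟨hx, c, rfl⟩
    refine ⟨(c 0, c 1), ?_, by simp [emb]⟩
    rw [← norm_sq_emb ha hd]
    simpa [emb] using hx
  · rintro ⟨z, hz, rfl⟩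
    refine ⟨?_, ![z.1, z.2], by simp [emb]⟩
    rwa [norm_sq_emb ha hd]

end QF

namespace QF

variable {f : QF}

lemma eval_pos_of_ne (ha : 0 < f.a) (hd : f.disc < 0) {x y : ℤ} (h : ¬(x = 0 ∧ y = 0)) :
    0 < f.eval x y := by
  have h1 := norm_sq_emb ha hd (x, y)
  have h2 : f.emb (x, y) ≠ 0 := by
    intro h0
    have : f.emb (x, y) = f.emb (0, 0) := by rw [h0]; simp [emb]
    have := emb_injective ha hd this
    simp only [Prod.mk.injEq] at this
    exact h this
  have : (0 : ℝ) < (f.eval x y : ℤ) := by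
    rw [← h1]
    positivity
  exact_mod_cast this

lemma finite_eval_le (ha : 0 < f.a) (hd : f.disc < 0) (N : ℝ) :
    {z : ℤ × ℤ | (f.eval z.1 z.2 : ℝ) ≤ N}.Finite := by
  set M : ℤ := 4 * f.a * ⌊N⌋ with hM
  refine ((Set.finite_Icc (-(M + |f.b| * M)) (M + |f.b| * M)).prod
    (Set.finite_Icc (-M) M)).subset ?_
  rintro ⟨x, y⟩ hz
  have hz' : f.eval x y ≤ ⌊N⌋ := Int.le_floor.2 hz
  have h4 := f.four_a_eval x y
  have h5 : 4 * f.a * f.eval x y ≤ M := by rw [hM]; gcongr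
  have h6 : y ^ 2 ≤ M := by nlinarith [sq_nonneg (2 * f.a * x + f.b * y), sq_nonneg y]
  have h7 : (2 * f.a * x + f.b * y) ^ 2 ≤ M := by nlinarith [sq_nonneg y]
  have key : ∀ t : ℤ, t ^ 2 ≤ M → |t| ≤ M := fun t ht ↦
    (by rw [← sq_abs] at ht; nlinarith [abs_nonneg t, sq_nonneg (|t| - 1),
      Int.le_self_sq |t|])
  have h8 := key _ h6
  have h9 := key _ h7
  refine ⟨Set.mem_Icc.2 (abs_le.1 ?_), Set.mem_Icc.2 (abs_le.1 h8)⟩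
  have h10 : |2 * f.a * x| ≤ M + |f.b| * M := by
    calc |2 * f.a * x| = |(2 * f.a * x + f.b * y) - f.b * y| := by ring_nf
      _ ≤ |2 * f.a * x + f.b * y| + |f.b * y| := abs_sub _ _
      _ ≤ M + |f.b| * M := by rw [abs_mul f.b]; gcongr
  rw [abs_mul, abs_of_pos (by positivity)] at h10
  nlinarith [abs_nonneg x]

/-- The condition `q ∣ f(x, y)` is a nontrivial linear condition modulo `q`. -/
def LinAt (f : QF) (q : ℕ) : Prop :=
  ∃ k l : ℤ, ¬((q : ℤ) ∣ k ∧ (q : ℤ) ∣ l) ∧ ∀ x y : ℤ, (q : ℤ) ∣ f.eval x y ↔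
      (q : ℤ) ∣ k * x + l * y

lemma Good.linAt {D : ℤ} (hf : f.Good D) {q : ℕ} (hq : q.Prime) (hd : (q : ℤ) ∣ D) :
    f.LinAt q := by
  have hqp := Nat.prime_iff_prime_int.1 hq
  have hdisc := hf.disc_eq
  unfold disc at hdisc
  by_cases ha : (q : ℤ) ∣ f.a
  · have hb : (q : ℤ) ∣ f.b := by
      apply hqp.dvd_of_dvd_pow (n := 2)
      have : f.b ^ 2 = D + f.a * (4 * f.c) := by linarith
      rw [this]
      exact dvd_add hd (ha.mul_right _)
    have hc : ¬ (q : ℤ) ∣ f.c := fun hc ↦ hqp.not_isUnit (hf.prim _ ha hb hc)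
    refine ⟨0, 1, fun h ↦ hqp.not_isUnit (isUnit_of_dvd_one h.2), fun x y ↦ ?_⟩
    have : f.eval x y = (f.a * x ^ 2 + f.b * x * y) + f.c * y ^ 2 := rfl
    rw [this, dvd_add_right (dvd_add (ha.mul_right _) ((hb.mul_right _).mul_right _)),
      hqp.dvd_mul, or_iff_right hc, hqp.dvd_pow_iff_dvd two_ne_zero]
    simp
  · rcases hq.eq_two_or_odd' with rfl | hodd
    · refine ⟨1, f.c, fun h ↦ hqp.not_isUnit (isUnit_of_dvd_one h.1), fun x y ↦ ?_⟩
      have hb : (2 : ℤ) ∣ f.b := by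
        apply Int.prime_two.dvd_of_dvd_pow (n := 2)
        have : f.b ^ 2 = D + 2 * (2 * f.a * f.c) := by linarith
        rw [this]
        exact dvd_add hd (dvd_mul_right _ _)
      have ha' : f.a % 2 = 1 := by push_cast at ha; omega
      obtain ⟨a, ha2⟩ : ∃ a, f.a = 2 * a + 1 := ⟨f.a / 2, by omega⟩
      obtain ⟨b, hb2⟩ := hb
      have hx : (2 : ℤ) ∣ x ^ 2 - x := by
        have := Int.even_mul_pred_self x
        rw [show x ^ 2 - x = x * (x - 1) by ring]
        exact this.two_dvd
      have hy : (2 : ℤ) ∣ y ^ 2 - y := by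
        have := Int.even_mul_pred_self y
        rw [show y ^ 2 - y = y * (y - 1) by ring]
        exact this.two_dvd
      have e : f.eval x y = (2 * (a * x ^ 2 + b * x * y) + (x ^ 2 - x) + (y ^ 2 - y) * f.c)
          + (1 * x + f.c * y) := by
        unfold eval
        rw [ha2, hb2]; ring
      push_cast
      rw [e, dvd_add_right]
      exact dvd_add (dvd_add (dvd_mul_right _ _) hx) (hy.mul_right _)
    · have h2 : ¬ (q : ℤ) ∣ 2 := fun h ↦ by
        have := (Nat.prime_dvd_prime_iff_eq hq Nat.prime_two).1 (by exact_mod_cast h)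
        subst this
        exact absurd hodd (by decide)
      have h2a : ¬ (q : ℤ) ∣ 2 * f.a := fun h ↦ (hqp.dvd_mul.1 h).elim h2 ha
      refine ⟨2 * f.a, f.b, fun h ↦ h2a h.1, fun x y ↦ ?_⟩
      have h4 : ¬ (q : ℤ) ∣ 4 * f.a := fun h ↦ by
        rw [show 4 * f.a = 2 * (2 * f.a) by ring] at h
        exact (hqp.dvd_mul.1 h).elim h2 h2a
      have e : (q : ℤ) ∣ f.eval x y ↔ (q : ℤ) ∣ 4 * f.a * f.eval x y := by
        rw [hqp.dvd_mul, or_iff_right h4]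
      rw [e, four_a_eval, hf.disc_eq, dvd_sub_left (hd.mul_right _),
        hqp.dvd_pow_iff_dvd two_ne_zero]

lemma exists_matrix {q : ℕ} (hq : q.Prime) {k l : ℤ} (hkl : ¬((q : ℤ) ∣ k ∧ (q : ℤ) ∣ l)) :
    ∃ a b c d : ℤ, a * d - b * c = q ∧ ∀ x y : ℤ, (q : ℤ) ∣ k * x + l * y ↔
      ∃ u v : ℤ, x = a * u + b * v ∧ y = c * u + d * v := by
  have hqp := Nat.prime_iff_prime_int.1 hq
  by_cases hk : (q : ℤ) ∣ k
  · have hl : ¬ (q : ℤ) ∣ l := fun h ↦ hkl ⟨hk, h⟩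
    refine ⟨1, 0, 0, q, by ring, fun x y ↦ ?_⟩
    rw [dvd_add_right (hk.mul_right _), hqp.dvd_mul, or_iff_right hl]
    constructor
    · rintro ⟨v, hv⟩
      exact ⟨x, v, by ring, by rw [hv]; ring⟩
    · rintro ⟨u, v, -, hv⟩
      exact ⟨v, by rw [hv]; ring⟩
  · obtain ⟨u, w, huw⟩ := (Prime.coprime_iff_not_dvd hqp).2 hk
    refine ⟨q, -l * w, 0, 1, by ring, fun x y ↦ ?_⟩
    have e : k * x + l * y = k * (x + l * w * y) + q * (u * l * y) := by
      linear_combination (-l * y) * huw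
    rw [e, dvd_add_left (dvd_mul_right _ _), hqp.dvd_mul, or_iff_right hk]
    constructor
    · rintro ⟨t, ht⟩
      exact ⟨t, y, by linarith, by ring⟩
    · rintro ⟨t, v, h1, h2⟩
      exact ⟨t, by rw [h1, h2]; ring⟩

lemma LinAt.act {q p : ℕ} (hq : q.Prime) (hp : p.Prime) (hqp : q ≠ p) (h : f.LinAt q)
    {a b c d : ℤ} (hdet : a * d - b * c = p) : (f.act a b c d).LinAt q := by
  obtain ⟨k, l, hkl, H⟩ := h
  have hqp' : ¬ (q : ℤ) ∣ p := fun h ↦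
    hqp ((Nat.prime_dvd_prime_iff_eq hq hp).1 (by exact_mod_cast h))
  have hqi := Nat.prime_iff_prime_int.1 hq
  refine ⟨k * a + l * c, k * b + l * d, fun ⟨h1, h2⟩ ↦ hkl ⟨?_, ?_⟩, fun x y ↦ ?_⟩
  · have : (q : ℤ) ∣ k * p := by
      rw [← hdet, show k * (a * d - b * c) = (k * a + l * c) * d - (k * b + l * d) * c by ring]
      exact dvd_sub (h1.mul_right _) (h2.mul_right _)
    exact (hqi.dvd_mul.1 this).resolve_right hqp'
  · have : (q : ℤ) ∣ l * p := by
      rw [← hdet, show l * (a * d - b * c) = (k * b + l * d) * a - (k * a + l * c) * b by ring]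
      exact dvd_sub (h2.mul_right _) (h1.mul_right _)
    exact (hqi.dvd_mul.1 this).resolve_right hqp'
  · rw [eval_act, H, show k * (a * x + b * y) + l * (c * x + d * y) =
      (k * a + l * c) * x + (k * b + l * d) * y by ring]

/-- Pairs with `f ≤ N` and `f` prime to all elements of `S`. -/
def cpPairs (f : QF) (S : Finset ℕ) (N : ℝ) : Set (ℤ × ℤ) :=
  {z | (f.eval z.1 z.2 : ℝ) ≤ N ∧ ∀ p ∈ S, ¬ (p : ℤ) ∣ f.eval z.1 z.2}

lemma finite_cpPairs (ha : 0 < f.a) (hd : f.disc < 0) (S : Finset ℕ) (N : ℝ) :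
    (f.cpPairs S N).Finite :=
  (finite_eval_le ha hd N).subset fun _ hz ↦ hz.1

/-- The number of pairs with `f ≤ N` and `f` prime to all elements of `S`. -/
theorem tendsto_cpPairs (S : Finset ℕ) : ∀ {f : QF}, 0 < f.a → f.disc < 0 →
    (∀ p ∈ S, p.Prime) → (∀ p ∈ S, f.LinAt p) →
    Filter.Tendsto (fun N : ℝ ↦ ((f.cpPairs S N).ncard : ℝ) / N) Filter.atTop
      (nhds (2 * Real.pi / Real.sqrt (-f.disc) * ∏ p ∈ S, (1 - (p : ℝ)⁻¹))) := by
  classical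
  induction S using Finset.induction_on with
  | empty =>
    intro f ha hd _ _
    simpa [cpPairs] using tendsto_ncard_eval_le ha hd
  | insert p S hpS ih =>
    intro f ha hd hS hlin
    have hp : p.Prime := hS p (Finset.mem_insert_self _ _)
    have hp0 : (0 : ℝ) < p := by exact_mod_cast hp.pos
    obtain ⟨k, l, hkl, H⟩ := hlin p (Finset.mem_insert_self _ _)
    obtain ⟨a, b, c, d, hdet, hM⟩ := exists_matrix hp hkl
    have hdisc : (f.act a b c d).disc = (p : ℤ) ^ 2 * f.disc := by rw [disc_act, hdet]
    have hgd : (f.act a b c d).disc < 0 := by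
      rw [hdisc]
      exact mul_neg_of_pos_of_neg (by have := hp.pos; positivity) hd
    have hga : 0 < (f.act a b c d).a := by
      refine eval_pos_of_ne ha hd ?_
      rintro ⟨rfl, rfl⟩
      have := hp.pos
      simp at hdet
      omega
    have h1 := ih ha hd (fun q hq ↦ hS q (Finset.mem_insert_of_mem hq))
      fun q hq ↦ hlin q (Finset.mem_insert_of_mem hq)
    have h2 := ih hga hgd (fun q hq ↦ hS q (Finset.mem_insert_of_mem hq))
      fun q hq ↦ (hlin q (Finset.mem_insert_of_mem hq)).act (hS q (Finset.mem_insert_of_mem hq)) hp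
        (by rintro rfl; exact hpS hq) hdet
    have hsq : Real.sqrt (-((f.act a b c d).disc : ℝ)) = p * Real.sqrt (-f.disc) := by
      rw [hdisc]
      push_cast
      rw [show -((p : ℝ) ^ 2 * f.disc) = (p : ℝ) ^ 2 * (-f.disc) by ring,
        Real.sqrt_mul (by positivity), Real.sqrt_sq hp0.le]
    rw [hsq] at h2
    have h3 := h1.sub h2
    have hs := sqrt_disc_pos hd
    have e : 2 * Real.pi / Real.sqrt (-f.disc) * ∏ p ∈ S, (1 - (p : ℝ)⁻¹) -
        2 * Real.pi / (p * Real.sqrt (-f.disc)) * ∏ p ∈ S, (1 - (p : ℝ)⁻¹) =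
        2 * Real.pi / Real.sqrt (-f.disc) * ∏ p ∈ insert p S, (1 - (p : ℝ)⁻¹) := by
      rw [Finset.prod_insert hpS]
      field_simp
    rw [e] at h3
    refine h3.congr fun N ↦ ?_
    rw [← sub_div]
    congr 1
    let T : ℤ × ℤ → ℤ × ℤ := fun z ↦ (a * z.1 + b * z.2, c * z.1 + d * z.2)
    have hT : Function.Injective T := by
      rintro ⟨x, y⟩ ⟨x', y'⟩ h
      simp only [T, Prod.mk.injEq] at h
      have hp' : (p : ℤ) ≠ 0 := by exact_mod_cast hp.ne_zero
      refine Prod.ext (mul_left_cancel₀ hp' ?_) (mul_left_cancel₀ hp' ?_)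
      · simp only
        rw [← hdet]
        linear_combination d * h.1 - b * h.2
      · simp only
        rw [← hdet]
        linear_combination a * h.2 - c * h.1
    have hsub : T '' (f.act a b c d).cpPairs S N ⊆ f.cpPairs S N := by
      rintro _ ⟨z, hz, rfl⟩
      simpa [cpPairs, eval_act, T] using hz
    have hdiff : f.cpPairs (insert p S) N = f.cpPairs S N \ T '' (f.act a b c d).cpPairs S N := by
      ext ⟨x, y⟩
      simp only [cpPairs, Finset.forall_mem_insert, Set.mem_ofPred_eq, Set.mem_sdiff, Set.mem_image]
      rw [H, hM]
      constructor
      · rintro ⟨hx, h0, hS'⟩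
        refine ⟨⟨hx, hS'⟩, ?_⟩
        rintro ⟨⟨u, v⟩, -, h⟩
        simp only [T, Prod.mk.injEq] at h
        exact h0 ⟨u, v, h.1.symm, h.2.symm⟩
      · rintro ⟨⟨hx, hS'⟩, h0⟩
        refine ⟨hx, ?_, hS'⟩
        rintro ⟨u, v, rfl, rfl⟩
        exact h0 ⟨(u, v), by simpa [eval_act] using ⟨hx, hS'⟩, rfl⟩
    rw [hdiff, Set.ncard_sdiff hsub ((finite_cpPairs hga hgd S N).image _),
      Set.ncard_image_of_injective _ hT, Nat.cast_sub]
    rw [← Set.ncard_image_of_injective _ hT]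
    exact Set.ncard_le_ncard hsub (finite_cpPairs ha hd S N)

end QF

/-- The Dirichlet series with real coefficients `a` at a real point. -/
noncomputable def dSer (a : ℕ → ℝ) (s : ℝ) : ℝ := ∑' n : ℕ, a n * (n : ℝ) ^ (-s)

lemma term_ofReal (a : ℕ → ℝ) {s : ℝ} (hs : s ≠ 0) (n : ℕ) :
    LSeries.term (fun n ↦ (a n : ℂ)) s n = ((a n * (n : ℝ) ^ (-s) : ℝ) : ℂ) := by
  rcases eq_or_ne n 0 with rfl | hn
  · simp [Real.zero_rpow (neg_ne_zero.2 hs)]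
  · rw [LSeries.term_of_ne_zero hn, Real.rpow_neg n.cast_nonneg]
    push_cast
    rw [Complex.ofReal_cpow n.cast_nonneg, div_eq_mul_inv]
    simp

lemma lSeriesSummable_ofReal {a : ℕ → ℝ} {s : ℝ} (hs : s ≠ 0) :
    LSeriesSummable (fun n ↦ (a n : ℂ)) s ↔ Summable fun n : ℕ ↦ a n * (n : ℝ) ^ (-s) := by
  unfold LSeriesSummable
  rw [funext (term_ofReal a hs), Complex.summable_ofReal]

lemma lSeries_ofReal (a : ℕ → ℝ) {s : ℝ} (hs : s ≠ 0) :
    LSeries (fun n ↦ (a n : ℂ)) s = (dSer a s : ℂ) := by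
  unfold LSeries dSer
  rw [funext (term_ofReal a hs), Complex.ofReal_tsum]

lemma dSer_conv {a b c : ℕ → ℝ} {s : ℝ} (hs : s ≠ 0)
    (ha : Summable fun n : ℕ ↦ a n * (n : ℝ) ^ (-s))
    (hb : Summable fun n : ℕ ↦ b n * (n : ℝ) ^ (-s))
    (hc : ∀ n, n ≠ 0 → c n = ∑ p ∈ n.divisorsAntidiagonal, a p.1 * b p.2) :
    dSer c s = dSer a s * dSer b s := by
  have h := LSeries_convolution' ((lSeriesSummable_ofReal hs).2 ha)
      ((lSeriesSummable_ofReal hs).2 hb)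
  rw [lSeries_ofReal _ hs, lSeries_ofReal _ hs] at h
  have h2 : LSeries (fun n ↦ (c n : ℂ)) s =
      LSeries (LSeries.convolution (fun n ↦ (a n : ℂ)) fun n ↦ (b n : ℂ)) s := by
    refine LSeries_congr (fun {n} hn ↦ ?_) _
    rw [LSeries.convolution_def, hc n hn]
    push_cast
    rfl
  rw [← h2, lSeries_ofReal _ hs] at h
  exact_mod_cast h

lemma summable_of_tendsto {a : ℕ → ℝ} {l s : ℝ} (h0 : ∀ n, 0 ≤ a n) (hs : 1 < s)
    (h : Tendsto (fun n : ℕ ↦ (∑ k ∈ Finset.Icc 1 n, a k) / (n : ℝ)) atTop (nhds l)) :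
    Summable fun n : ℕ ↦ a n * (n : ℝ) ^ (-s) := by
  refine (lSeriesSummable_ofReal (by positivity)).1 ?_
  refine LSeriesSummable_of_sum_norm_bigO_and_nonneg ?_ h0 zero_le_one hs
  exact Asymptotics.isBigO_atTop_natCast_rpow_of_tendsto_div_rpow (by simpa)

lemma tendsto_sub_mul_dSer {a : ℕ → ℝ} {l : ℝ} (h0 : ∀ n, 0 ≤ a n)
    (h : Tendsto (fun n : ℕ ↦ (∑ k ∈ Finset.Icc 1 n, a k) / (n : ℝ)) atTop (nhds l)) :
    Tendsto (fun s : ℝ ↦ (s - 1) * dSer a s) (nhdsWithin 1 (Set.Ioi 1)) (nhds l) := by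
  have key := LSeries_tendsto_sub_mul_nhds_one_of_tendsto_sum_div_and_nonneg a h h0
  have key2 := (Complex.continuous_re.tendsto _).comp key
  refine (key2.congr' ?_)
  filter_upwards [self_mem_nhdsWithin] with s hs
  have hs' : s ≠ 0 := (zero_lt_one.trans hs).ne'
  simp only [Function.comp_apply]
  rw [lSeries_ofReal _ hs', ← Complex.ofReal_one, ← Complex.ofReal_sub, ← Complex.ofReal_mul,
    Complex.ofReal_re]

lemma Nat.isSquare_mul_iff_of_coprime {a b : ℕ} (h : a.Coprime b) :
    IsSquare (a * b) ↔ IsSquare a ∧ IsSquare b := by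
  constructor
  · intro hs
    obtain ⟨c, hc⟩ := (isSquare_iff_exists_sq _).1 hs
    obtain ⟨d, hd⟩ := exists_eq_pow_of_mul_eq_pow
        (by rw [gcd_eq_nat_gcd]; exact Nat.isUnit_iff.2 h) hc
    obtain ⟨e, he⟩ := exists_eq_pow_of_mul_eq_pow (a := b) (b := a)
        (by rw [gcd_eq_nat_gcd]; exact Nat.isUnit_iff.2 h.symm)
      (by rw [mul_comm]; exact hc)
    exact ⟨(isSquare_iff_exists_sq _).2 ⟨d, hd⟩, (isSquare_iff_exists_sq _).2 ⟨e, he⟩⟩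
  · rintro ⟨h1, h2⟩
    exact h1.mul h2

lemma Nat.Prime.isSquare_pow_iff {p : ℕ} (hp : p.Prime) (k : ℕ) : IsSquare (p ^ k) ↔ Even k := by
  constructor
  · rintro ⟨c, hc⟩
    obtain ⟨j, -, rfl⟩ := (Nat.dvd_prime_pow hp).1 (Dvd.intro _ hc.symm)
    rw [← pow_add] at hc
    exact ⟨j, Nat.pow_right_injective hp.two_le hc⟩
  · rintro ⟨j, rfl⟩
    exact ⟨p ^ j, pow_add _ _ _⟩

/-- Local data of the indicator of the squares prime to `D`. -/
noncomputable def sqLoc (D : ℤ) : ℕ → ℕ → ℝ := splitLoc D (fun _ ↦ evenInd) evenInd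

lemma sqLoc_of_dvd {p : ℕ} (h : (p : ℤ) ∣ D) (k : ℕ) : sqLoc D p k = 0 := by
  simp [sqLoc, splitLoc, h]

lemma sqLoc_of_not_dvd {p : ℕ} (h : ¬ (p : ℤ) ∣ D) (k : ℕ) : sqLoc D p k = evenInd k := by
  simp [sqLoc, splitLoc, h]

open Classical in
lemma mulFn_sqLoc {n : ℕ} (hn : n ≠ 0) :
    mulFn (sqLoc D) n = if IsSquare n ∧ IsCoprime (n : ℤ) D then 1 else 0 := by
  induction n using Nat.recOnPosPrimePosCoprime with
  | prime_pow p k hp hk =>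
    obtain ⟨k, rfl⟩ : ∃ j, k = j + 1 := ⟨k - 1, by omega⟩
    rw [mulFn_prime_pow _ hp]
    simp only [hp.isSquare_pow_iff]
    by_cases hd : (p : ℤ) ∣ D
    · rw [sqLoc_of_dvd hd, if_neg fun h ↦ not_isCoprime_of_dvd hp hd k h.2]
    · have : IsCoprime ((p ^ (k + 1) : ℕ) : ℤ) D := by
        push_cast
        exact (isCoprime_of_not_dvd hp hd).pow_left
      rw [sqLoc_of_not_dvd hd, evenInd]
      simp only [this, and_true]
  | zero => exact absurd rfl hn
  | one => simp [isCoprime_one_left]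
  | coprime a b ha hb hab iha ihb =>
    rw [mulFn_mul _ hab, iha (by omega), ihb (by omega)]
    have : IsCoprime ((a * b : ℕ) : ℤ) D ↔ IsCoprime (a : ℤ) D ∧ IsCoprime (b : ℤ) D := by
      push_cast
      exact IsCoprime.mul_left_iff
    simp only [Nat.isSquare_mul_iff_of_coprime hab, this]
    clear iha ihb this hn
    split_ifs <;> first | (exfalso; tauto) | simp

open Classical in
/-- The number of representations by `f` of `n` prime to `D`. -/
noncomputable def repCoeff (D : ℤ) (f : QF) (n : ℕ) : ℝ :=
  if IsCoprime (n : ℤ) D then ({z : ℤ × ℤ | f.eval z.1 z.2 = n}.ncard : ℝ) else 0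

open Classical in
/-- The number of primitive representations by `f` of `n` prime to `D`. -/
noncomputable def primCoeff (D : ℤ) (f : QF) (n : ℕ) : ℝ :=
  if IsCoprime (n : ℤ) D then ((primReps f n).ncard : ℝ) else 0

lemma repCoeff_nonneg (f : QF) (n : ℕ) : 0 ≤ repCoeff D f n := by
  unfold repCoeff; split_ifs <;> positivity

lemma primCoeff_nonneg (f : QF) (n : ℕ) : 0 ≤ primCoeff D f n := by
  unfold primCoeff; split_ifs <;> positivity

lemma QF.eval_mul_mul (f : QF) (e x y : ℤ) : f.eval (e * x) (e * y) = e ^ 2 * f.eval x y := by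
  unfold QF.eval; ring

lemma QF.Good.finite_reps {f : QF} (hf : f.Good D) (hD : D < 0) (n : ℕ) :
    {z : ℤ × ℤ | f.eval z.1 z.2 = n}.Finite :=
  (QF.finite_eval_le hf.pos (hf.disc_eq ▸ hD) n).subset fun z hz ↦ by
    have : f.eval z.1 z.2 = n := hz
    change (f.eval z.1 z.2 : ℝ) ≤ n
    rw [this]
    simp

lemma QF.Good.repCoeff_eq {f : QF} (hf : f.Good D) (hD : D < 0) {n : ℕ} (hn : n ≠ 0) :
    repCoeff D f n =
      ∑ p ∈ n.divisorsAntidiagonal, mulFn (sqLoc D) p.1 * primCoeff D f p.2 := by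
  classical
  by_cases hco : IsCoprime (n : ℤ) D
  swap
  · rw [repCoeff, if_neg hco]
    refine (Finset.sum_eq_zero fun p hp ↦ ?_).symm
    obtain ⟨h1, h2⟩ := Nat.mem_divisorsAntidiagonal.1 hp
    by_cases h3 : mulFn (sqLoc D) p.1 = 0
    · rw [h3, zero_mul]
    · have h4 := isCoprime_of_mulFn_ne_zero h3
      rw [primCoeff, if_neg, mul_zero]
      intro h5
      refine hco ?_
      rw [← h1]
      push_cast
      exact h4.mul_left h5
  rw [repCoeff, if_pos hco]
  have hfin := hf.finite_reps hD n
  rw [Set.ncard_eq_toFinset_card _ hfin]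
  let φ : ℤ × ℤ → ℕ × ℕ := fun z ↦ (Int.gcd z.1 z.2 ^ 2, n / Int.gcd z.1 z.2 ^ 2)
  have hgcd : ∀ z : ℤ × ℤ, f.eval z.1 z.2 = n → Int.gcd z.1 z.2 ^ 2 ∣ n := by
    intro z hz
    have : ((Int.gcd z.1 z.2 : ℕ) : ℤ) ^ 2 ∣ n := by
      obtain ⟨x, hx⟩ := Int.gcd_dvd_left z.1 z.2
      obtain ⟨y, hy⟩ := Int.gcd_dvd_right z.1 z.2
      rw [← hz]
      nth_rewrite 2 [hx]
      nth_rewrite 3 [hy]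
      rw [QF.eval_mul_mul]
      exact dvd_mul_right _ _
    exact_mod_cast this
  have hφ : ∀ z ∈ hfin.toFinset, φ z ∈ n.divisorsAntidiagonal := by
    intro z hz
    have hz' : f.eval z.1 z.2 = n := by simpa using hz
    exact Nat.mem_divisorsAntidiagonal.2 ⟨Nat.mul_div_cancel' (hgcd z hz'), hn⟩
  rw [Finset.card_eq_sum_card_fiberwise hφ, Nat.cast_sum]
  refine Finset.sum_congr rfl fun p hp ↦ ?_
  obtain ⟨h1, -⟩ := Nat.mem_divisorsAntidiagonal.1 hp
  have hp1 : p.1 ≠ 0 := by rintro h; simp [h] at h1; exact hn h1.symm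
  have hcop : IsCoprime (p.1 : ℤ) D ∧ IsCoprime (p.2 : ℤ) D := by
    rw [← h1] at hco
    push_cast at hco
    exact IsCoprime.mul_left_iff.1 hco
  rw [mulFn_sqLoc hp1, primCoeff, if_pos hcop.2]
  by_cases hsq : IsSquare p.1
  · rw [if_pos ⟨hsq, hcop.1⟩, one_mul]
    obtain ⟨e, he⟩ := (isSquare_iff_exists_sq _).1 hsq
    have he0 : e ≠ 0 := by rintro rfl; simp at he; exact hp1 he
    have he0' : (e : ℤ) ≠ 0 := by exact_mod_cast he0
    have hinj : Function.Injective fun z : ℤ × ℤ ↦ ((e : ℤ) * z.1, (e : ℤ) * z.2) := by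
      rintro ⟨x, y⟩ ⟨x', y'⟩ h
      simp only [Prod.mk.injEq] at h
      exact Prod.ext (mul_left_cancel₀ he0' h.1) (mul_left_cancel₀ he0' h.2)
    rw [← Set.ncard_image_of_injective _ hinj, ← Set.ncard_coe_finset]
    congr 2
    have hn' : (n : ℤ) = (e : ℤ) ^ 2 * p.2 := by rw [← h1, he]; push_cast; ring
    ext z
    simp only [Finset.coe_filter, Set.Finite.mem_toFinset, Set.mem_ofPred_eq, Set.mem_image,
      primReps, φ]
    constructor
    · rintro ⟨hz, rfl⟩
      have hg : Int.gcd z.1 z.2 = e := by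
        simp only at he
        exact Nat.pow_left_injective two_ne_zero he
      obtain ⟨x, hx⟩ := Int.gcd_dvd_left z.1 z.2
      obtain ⟨y, hy⟩ := Int.gcd_dvd_right z.1 z.2
      rw [hg] at hx hy
      refine ⟨(x, y), ⟨?_, ?_⟩, Prod.ext hx.symm hy.symm⟩
      · rw [hx, hy, Int.gcd_mul_left] at hg
        rw [Int.isCoprime_iff_gcd_eq_one]
        simp only [Int.natAbs_natCast] at hg
        exact Nat.eq_of_mul_eq_mul_left (Nat.pos_of_ne_zero he0) (by simpa using hg)
      · rw [hx, hy, QF.eval_mul_mul, hn'] at hz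
        exact mul_left_cancel₀ (pow_ne_zero 2 he0') hz
    · rintro ⟨⟨x, y⟩, ⟨hxy, hev⟩, rfl⟩
      have hg : Int.gcd (e * x) (e * y) = e := by
        rw [Int.gcd_mul_left, Int.isCoprime_iff_gcd_eq_one.1 hxy]
        simp
      simp only at hev ⊢
      refine ⟨by rw [QF.eval_mul_mul, hev, hn'], ?_⟩
      rw [hg]
      refine Prod.ext he.symm ?_
      simp only
      rw [← h1, ← he]
      exact Nat.mul_div_cancel_left _ (Nat.pos_of_ne_zero hp1)
  · rw [if_neg fun h ↦ hsq h.1, zero_mul, Nat.cast_eq_zero, Finset.card_eq_zero]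
    refine Finset.filter_eq_empty_iff.2 fun z _ hz ↦ hsq ?_
    rw [← hz]
    exact (isSquare_iff_exists_sq _).2 ⟨_, rfl⟩

lemma QF.isCoprime_iff_primeFactors (hD : D ≠ 0) (m : ℤ) :
    IsCoprime m D ↔ ∀ p ∈ D.natAbs.primeFactors, ¬ (p : ℤ) ∣ m := by
  constructor
  · intro h p hp hm
    obtain ⟨h1, h2, -⟩ := Nat.mem_primeFactors.1 hp
    exact (Nat.prime_iff_prime_int.1 h1).not_isUnit
      (h.isUnit_of_dvd' hm (Int.natCast_dvd.2 h2))
  · intro h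
    rw [Int.isCoprime_iff_gcd_eq_one, Int.gcd_def]
    by_contra h1
    obtain ⟨p, hp, hd⟩ := Nat.exists_prime_and_dvd h1
    exact h p (Nat.mem_primeFactors.2 ⟨hp, hd.trans (Nat.gcd_dvd_right _ _), by simpa using hD⟩)
      (Int.natCast_dvd.2 (hd.trans (Nat.gcd_dvd_left _ _)))

lemma QF.Good.sum_repCoeff {f : QF} (hf : f.Good D) (hD : D < -1) (N : ℕ) :
    ∑ n ∈ Finset.Icc 1 N, repCoeff D f n = (f.cpPairs D.natAbs.primeFactors N).ncard := by
  classical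
  have hd : f.disc < 0 := by rw [hf.disc_eq]; omega
  have hfin := QF.finite_cpPairs hf.pos hd D.natAbs.primeFactors N
  rw [Set.ncard_eq_toFinset_card _ hfin]
  have h0 : ¬ IsCoprime (0 : ℤ) D := by
    rw [isCoprime_zero_left, Int.isUnit_iff]
    omega
  have hmem : ∀ z, z ∈ f.cpPairs D.natAbs.primeFactors N ↔
      f.eval z.1 z.2 ≤ N ∧ IsCoprime (f.eval z.1 z.2) D := by
    intro z
    rw [QF.isCoprime_iff_primeFactors (by omega)]
    unfold QF.cpPairs
    simp only [Set.mem_ofPred_eq, and_congr_left_iff]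
    intro _
    exact_mod_cast Iff.rfl
  have hmap : ∀ z ∈ hfin.toFinset, (f.eval z.1 z.2).natAbs ∈ Finset.Icc 1 N := by
    intro z hz
    rw [Set.Finite.mem_toFinset, hmem] at hz
    have h1 := hf.eval_nonneg (by omega) z.1 z.2
    have h2 : f.eval z.1 z.2 ≠ 0 := fun h ↦ h0 (h ▸ hz.2)
    rw [Finset.mem_Icc]
    omega
  rw [Finset.card_eq_sum_card_fiberwise hmap, Nat.cast_sum]
  refine Finset.sum_congr rfl fun n hn ↦ ?_
  rw [Finset.mem_Icc] at hn
  rw [← Set.ncard_coe_finset, repCoeff]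
  have hset : ∀ z : ℤ × ℤ, f.eval z.1 z.2 = n ↔ (f.eval z.1 z.2).natAbs = n := by
    intro z
    have := hf.eval_nonneg (by omega) z.1 z.2
    omega
  split_ifs with hco
  · congr 2
    ext z
    simp only [Finset.coe_filter, Set.Finite.mem_toFinset, Set.mem_ofPred_eq, hmem, ← hset]
    constructor
    · intro h
      rw [h]
      exact ⟨⟨by exact_mod_cast hn.2, hco⟩, rfl⟩
    · exact fun h ↦ h.2
  · symm
    rw [Nat.cast_eq_zero, Set.ncard_coe_finset, Finset.card_eq_zero]
    refine Finset.filter_eq_empty_iff.2 fun z hz h ↦ hco ?_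
    rw [Set.Finite.mem_toFinset, hmem] at hz
    rw [← (hset z).2 h]
    exact hz.2

/-- The residue at `1` of the Dirichlet series with coefficients `repCoeff`. -/
noncomputable def resConst (D : ℤ) : ℝ :=
  2 * Real.pi / Real.sqrt (-D) * ∏ p ∈ D.natAbs.primeFactors, (1 - (p : ℝ)⁻¹)

lemma resConst_pos (hD : D < 0) : 0 < resConst D := by
  have h1 : 0 < Real.sqrt (-D) := Real.sqrt_pos.2 (by exact_mod_cast neg_pos.2 hD)
  refine mul_pos (by positivity) (Finset.prod_pos fun p hp ↦ ?_)
  have := (Nat.prime_of_mem_primeFactors hp).one_lt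
  rw [sub_pos]
  exact inv_lt_one_of_one_lt₀ (by exact_mod_cast this)

lemma QF.Good.tendsto_sum_repCoeff {f : QF} (hf : f.Good D) (hD : D < -1) :
    Tendsto (fun N : ℕ ↦ (∑ n ∈ Finset.Icc 1 N, repCoeff D f n) / (N : ℝ)) atTop
      (nhds (resConst D)) := by
  have h := QF.tendsto_cpPairs D.natAbs.primeFactors hf.pos (by rw [hf.disc_eq]; omega)
    (fun p hp ↦ Nat.prime_of_mem_primeFactors hp) fun p hp ↦
      hf.linAt (Nat.prime_of_mem_primeFactors hp)
        (Int.natCast_dvd.2 (Nat.dvd_of_mem_primeFactors hp))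
  rw [hf.disc_eq] at h
  refine (h.comp tendsto_natCast_atTop_atTop).congr fun N ↦ ?_
  rw [hf.sum_repCoeff hD]
  rfl

lemma QF.Good.summable_repCoeff {f : QF} (hf : f.Good D) (hD : D < -1) {s : ℝ} (hs : 1 < s) :
    Summable fun n : ℕ ↦ repCoeff D f n * (n : ℝ) ^ (-s) :=
  summable_of_tendsto (repCoeff_nonneg f) hs (hf.tendsto_sum_repCoeff hD)

lemma QF.Good.tendsto_dSer_repCoeff {f : QF} (hf : f.Good D) (hD : D < -1) :
    Tendsto (fun s : ℝ ↦ (s - 1) * dSer (repCoeff D f) s) (nhdsWithin 1 (Set.Ioi 1))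
      (nhds (resConst D)) :=
  tendsto_sub_mul_dSer (repCoeff_nonneg f) (hf.tendsto_sum_repCoeff hD)

lemma QF.Good.primCoeff_le {f : QF} (hf : f.Good D) (hD : D < 0) (n : ℕ) :
    primCoeff D f n ≤ repCoeff D f n := by
  unfold primCoeff repCoeff
  split_ifs
  · exact_mod_cast Set.ncard_le_ncard (fun z (hz : z ∈ primReps f n) ↦ hz.2) (hf.finite_reps hD n)
  · exact le_rfl

lemma summable_of_abs_le_one {a : ℕ → ℝ} (h : ∀ n, |a n| ≤ 1) {s : ℝ} (hs : 1 < s) :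
    Summable fun n : ℕ ↦ a n * (n : ℝ) ^ (-s) := by
  refine Summable.of_norm_bounded (g := fun n : ℕ ↦ (n : ℝ) ^ (-s))
    (Real.summable_nat_rpow.2 (by linarith)) fun n ↦ ?_
  have h0 : 0 ≤ (n : ℝ) ^ (-s) := Real.rpow_nonneg n.cast_nonneg _
  rw [Real.norm_eq_abs, abs_mul, abs_of_nonneg h0]
  exact mul_le_of_le_one_left h0 (h n)

lemma sqLoc_nonneg (p k : ℕ) : 0 ≤ sqLoc D p k := by
  unfold sqLoc splitLoc
  split_ifs <;> first | exact le_rfl | exact evenInd_nonneg k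

lemma sqLoc_le_one (p k : ℕ) : sqLoc D p k ≤ 1 := by
  unfold sqLoc splitLoc
  split_ifs <;> first | exact zero_le_one | exact evenInd_le_one k

lemma abs_mulFn_le_one {ℓ : ℕ → ℕ → ℝ} (h0 : ∀ p k, |ℓ p k| ≤ 1) (n : ℕ) : |mulFn ℓ n| ≤ 1 := by
  rw [abs_mulFn]
  exact mulFn_le_one (fun _ _ ↦ abs_nonneg _) h0 n

lemma abs_sqLoc_le_one (p k : ℕ) : |sqLoc D p k| ≤ 1 := by
  rw [abs_of_nonneg (sqLoc_nonneg p k)]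
  exact sqLoc_le_one p k

lemma sum_char_primCoeff (hD : D < -4) [Fintype (Cl D)] {F : Cl D → QF}
    (hF : ∀ A, (F A).Good D ∧ cls D (F A) = A) (φ : Cl D →* ℂˣ) {n : ℕ} (hn : n ≠ 0) :
    ∑ A : Cl D, (φ A : ℂ).re * primCoeff D (F A) n = 2 * mulFn (rootLoc φ) n := by
  have h := (hF 1).1.negDisc (by omega)
  by_cases hco : IsCoprime (n : ℤ) D
  · have : NeZero n := ⟨hn⟩
    have h1 := rootSum_eq_mulFn h φ n hn hco
    rw [rootSum_eq_sum_cls] at h1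
    have h2 := congrArg Complex.re h1
    rw [Complex.ofReal_re, Complex.re_sum] at h2
    rw [← h2, Finset.mul_sum]
    refine Finset.sum_congr rfl fun A _ ↦ ?_
    rw [primCoeff, if_pos hco, ncard_primReps hD (hF A).1 (Nat.pos_of_ne_zero hn) hco, (hF A).2,
      charC_apply, ← Complex.ofReal_natCast, Complex.re_mul_ofReal]
    push_cast
    ring
  · have h1 : mulFn (rootLoc φ) n = 0 := by
      by_contra h1
      exact hco (isCoprime_of_mulFn_ne_zero h1)
    rw [h1]
    simp [primCoeff, hco]

lemma QF.Good.summable_primCoeff {f : QF} (hf : f.Good D) (hD : D < -1) {s : ℝ} (hs : 1 < s) :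
    Summable fun n : ℕ ↦ primCoeff D f n * (n : ℝ) ^ (-s) := by
  refine Summable.of_nonneg_of_le (fun n ↦ ?_) (fun n ↦ ?_) (hf.summable_repCoeff hD hs)
  · exact mul_nonneg (primCoeff_nonneg f n) (Real.rpow_nonneg n.cast_nonneg _)
  · exact mul_le_mul_of_nonneg_right (hf.primCoeff_le (by omega) n)
      (Real.rpow_nonneg n.cast_nonneg _)

lemma rpow_neg_zero {s : ℝ} (hs : 1 < s) : ((0 : ℕ) : ℝ) ^ (-s) = 0 := by
  rw [Nat.cast_zero, Real.zero_rpow (by linarith)]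

lemma summable_rootLoc (hD : D < -4) (h : NegDisc D) (φ : Cl D →* ℂˣ) {s : ℝ} (hs : 1 < s) :
    Summable fun n : ℕ ↦ mulFn (rootLoc φ) n * (n : ℝ) ^ (-s) := by
  have := h.finite
  have := Fintype.ofFinite (Cl D)
  choose F hF using fun A : Cl D ↦ h.exists_cls_eq A
  have h1 : Summable fun n : ℕ ↦ ∑ A : Cl D, (φ A : ℂ).re / 2 * (primCoeff D (F A) n *
      (n : ℝ) ^ (-s)) :=
    summable_sum fun A _ ↦ ((hF A).1.summable_primCoeff (by omega) hs).mul_left _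
  refine h1.congr fun n ↦ ?_
  rcases eq_or_ne n 0 with rfl | hn
  · rw [rpow_neg_zero hs]
    simp
  · rw [show mulFn (rootLoc φ) n = (2 * mulFn (rootLoc φ) n) / 2 by ring,
      ← sum_char_primCoeff hD hF φ hn, Finset.sum_div, Finset.sum_mul]
    exact Finset.sum_congr rfl fun A _ ↦ by ring

lemma sum_char_dSer (hD : D < -4) (h : NegDisc D) [Fintype (Cl D)] {F : Cl D → QF}
    (hF : ∀ A, (F A).Good D ∧ cls D (F A) = A) (φ : Cl D →* ℂˣ) {s : ℝ} (hs : 1 < s) :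
    ∑ A : Cl D, (φ A : ℂ).re * dSer (repCoeff D (F A)) s =
      2 * (dSer (mulFn (sqLoc D)) s * dSer (mulFn (rootLoc φ)) s) := by
  have hs0 : s ≠ 0 := by positivity
  have h1 := dSer_conv (c := fun n ↦ (∑ A : Cl D, (φ A : ℂ).re * repCoeff D (F A) n) / 2) hs0
    (summable_of_abs_le_one (abs_mulFn_le_one (abs_sqLoc_le_one (D := D))) hs)
    (summable_rootLoc hD h φ hs) fun n hn ↦ by
      simp_rw [fun A ↦ (hF A).1.repCoeff_eq (by omega) hn, Finset.mul_sum]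
      rw [Finset.sum_comm, Finset.sum_div]
      refine Finset.sum_congr rfl fun p hp ↦ ?_
      have hp2 : p.2 ≠ 0 := (Nat.ne_zero_of_mem_divisorsAntidiagonal hp).2
      rw [show mulFn (rootLoc φ) p.2 = (2 * mulFn (rootLoc φ) p.2) / 2 by ring,
        ← sum_char_primCoeff hD hF φ hp2, ← mul_div_assoc, Finset.mul_sum]
      congr 1
      exact Finset.sum_congr rfl fun A _ ↦ by ring
  rw [← h1]
  unfold dSer
  simp_rw [div_mul_eq_mul_div, tsum_div_const, Finset.sum_mul, mul_assoc]
  rw [Summable.tsum_finsetSum fun A _ ↦ ((hF A).1.summable_repCoeff (by omega) hs).mul_left _]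
  simp_rw [tsum_mul_left]
  ring

lemma tendsto_dSer_sq_mul (hD : D < -4) (h : NegDisc D) (φ : Cl D →* ℂˣ) :
    Tendsto (fun s : ℝ ↦ (s - 1) * (dSer (mulFn (sqLoc D)) s * dSer (mulFn (rootLoc φ)) s))
      (nhdsWithin 1 (Set.Ioi 1))
      (nhds ((∑ᶠ A : Cl D, (φ A : ℂ).re) * resConst D / 2)) := by
  have := h.finite
  have := Fintype.ofFinite (Cl D)
  choose F hF using fun A : Cl D ↦ h.exists_cls_eq A
  have h1 : Tendsto (fun s : ℝ ↦ ∑ A : Cl D, (φ A : ℂ).re / 2 *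
      ((s - 1) * dSer (repCoeff D (F A)) s)) (nhdsWithin 1 (Set.Ioi 1))
      (nhds (∑ A : Cl D, (φ A : ℂ).re / 2 * resConst D)) :=
    tendsto_finsetSum _ fun A _ ↦ ((hF A).1.tendsto_dSer_repCoeff (by omega)).const_mul _
  rw [finsum_eq_sum_of_fintype, Finset.sum_mul, Finset.sum_div]
  have e : ∀ A : Cl D, (φ A : ℂ).re * resConst D / 2 = (φ A : ℂ).re / 2 * resConst D :=
    fun A ↦ by ring
  simp_rw [e]
  refine h1.congr' ?_
  filter_upwards [self_mem_nhdsWithin] with s hs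
  have h2 := sum_char_dSer hD h hF φ hs
  rw [show dSer (mulFn (sqLoc D)) s * dSer (mulFn (rootLoc φ)) s =
    (2 * (dSer (mulFn (sqLoc D)) s * dSer (mulFn (rootLoc φ)) s)) / 2 by ring, ← h2,
    Finset.sum_div, Finset.mul_sum]
  exact Finset.sum_congr rfl fun A _ ↦ by ring

lemma finsum_char_eq_zero (h : NegDisc D) {φ : Cl D →* ℂˣ} (hφ : φ ≠ 1) :
    ∑ᶠ A : Cl D, (φ A : ℂ).re = 0 := by
  have := h.finite
  have := Fintype.ofFinite (Cl D)
  rw [finsum_eq_sum_of_fintype, ← Complex.re_sum, sum_char_eq_zero hφ, Complex.zero_re]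

lemma finsum_char_one (h : NegDisc D) :
    ∑ᶠ A : Cl D, ((1 : Cl D →* ℂˣ) A : ℂ).re = Nat.card (Cl D) := by
  have := h.finite
  have := Fintype.ofFinite (Cl D)
  rw [finsum_eq_sum_of_fintype]
  simp

/-- The product of the `F p` over all primes is `P`. -/
def HasPrimeProd (F : ℕ → ℝ) (P : ℝ) : Prop :=
  Tendsto (fun N : ℕ ↦ ∏ p ∈ Nat.primesBelow N, F p) atTop (nhds P)

lemma HasPrimeProd.mul {F F' : ℕ → ℝ} {P P' : ℝ} (h : HasPrimeProd F P) (h' : HasPrimeProd F' P') :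
    HasPrimeProd (fun p ↦ F p * F' p) (P * P') := by
  unfold HasPrimeProd
  simp_rw [Finset.prod_mul_distrib]
  exact Tendsto.mul h h'

lemma HasPrimeProd.abs_le {F F' w : ℕ → ℝ} {P P' K : ℝ} (h : HasPrimeProd F P)
    (h' : HasPrimeProd F' P') (hF' : ∀ p, p.Prime → 0 ≤ F' p)
    (hle : ∀ p, p.Prime → |F p| ≤ w p * F' p)
    (hw : ∀ᶠ N in atTop, ∏ p ∈ Nat.primesBelow N, w p ≤ K) : |P| ≤ K * P' := by
  refine le_of_tendsto_of_tendsto h.abs (h'.const_mul K) ?_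
  filter_upwards [hw] with N hN
  rw [Finset.abs_prod]
  calc ∏ p ∈ Nat.primesBelow N, |F p| ≤ ∏ p ∈ Nat.primesBelow N, (w p * F' p) :=
        Finset.prod_le_prod (fun _ _ ↦ abs_nonneg _) fun p hp ↦
          hle p (Nat.prime_of_mem_primesBelow hp)
    _ ≤ K * ∏ p ∈ Nat.primesBelow N, F' p := by
        rw [Finset.prod_mul_distrib]
        exact mul_le_mul_of_nonneg_right hN (Finset.prod_nonneg fun p hp ↦
          hF' p (Nat.prime_of_mem_primesBelow hp))

/-- The Euler factor `1 + ∑ ℓ p k u ^ k`. -/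
noncomputable def locF (ℓ : ℕ → ℕ → ℝ) (p : ℕ) (u : ℝ) : ℝ := 1 + ∑' k, ℓ p (k + 1) * u ^ (k + 1)

lemma hasPrimeProd_mulFn {ℓ : ℕ → ℕ → ℝ} {s : ℝ}
    (h : Summable fun n : ℕ ↦ mulFn ℓ n * (n : ℝ) ^ (-s)) :
    HasPrimeProd (fun p ↦ locF ℓ p ((p : ℝ) ^ (-s))) (dSer (mulFn ℓ) s) := by
  have key := EulerProduct.eulerProduct (f := fun n : ℕ ↦ mulFn ℓ n * (n : ℝ) ^ (-s)) (by simp)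
    (fun {m n} hmn ↦ by
      rw [mulFn_mul _ hmn, Nat.cast_mul, Real.mul_rpow m.cast_nonneg n.cast_nonneg]
      ring) h.norm (by simp)
  refine key.congr fun N ↦ Finset.prod_congr rfl fun p hp ↦ ?_
  have hp' := Nat.prime_of_mem_primesBelow hp
  have h2 : Summable fun e : ℕ ↦ mulFn ℓ (p ^ e) * ((p ^ e : ℕ) : ℝ) ^ (-s) :=
    h.comp_injective (Nat.pow_right_injective hp'.two_le)
  unfold locF
  rw [h2.tsum_eq_zero_add]
  congr 1
  · simp
  · refine tsum_congr fun k ↦ ?_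
    rw [mulFn_prime_pow _ hp', Nat.cast_pow, ← Real.rpow_natCast, ← Real.rpow_natCast,
      ← Real.rpow_mul p.cast_nonneg, ← Real.rpow_mul p.cast_nonneg, mul_comm (-s)]

lemma prime_rpow_pos {p : ℕ} (hp : p.Prime) (s : ℝ) : 0 < (p : ℝ) ^ (-s) :=
  Real.rpow_pos_of_pos (by exact_mod_cast hp.pos) _

lemma prime_rpow_le_inv {p : ℕ} (hp : p.Prime) {s : ℝ} (hs : 1 < s) :
    (p : ℝ) ^ (-s) ≤ (p : ℝ)⁻¹ := by
  rw [← Real.rpow_neg_one]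
  exact Real.rpow_le_rpow_of_exponent_le (by exact_mod_cast hp.one_lt.le) (by linarith)

lemma prime_rpow_le_half {p : ℕ} (hp : p.Prime) {s : ℝ} (hs : 1 < s) :
    (p : ℝ) ^ (-s) ≤ 1 / 2 := by
  refine (prime_rpow_le_inv hp hs).trans ?_
  rw [one_div]
  exact inv_anti₀ (by norm_num) (by exact_mod_cast hp.two_le)

section local_factors

variable {u : ℝ}

lemma locF_splitLoc_of_dvd {c : ℕ → ℕ → ℝ} {e : ℕ → ℝ} {p : ℕ} (h : (p : ℤ) ∣ D) :
    locF (splitLoc D c e) p u = 1 := by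
  simp [locF, splitLoc, h]

lemma locF_splitLoc_of_split {c : ℕ → ℕ → ℝ} {e : ℕ → ℝ} {p : ℕ} (h : ¬ (p : ℤ) ∣ D)
    (hs : IsSplit D p) : locF (splitLoc D c e) p u = 1 + ∑' k, c p (k + 1) * u ^ (k + 1) := by
  simp [locF, splitLoc, h, hs]

lemma locF_splitLoc_of_not_split {c : ℕ → ℕ → ℝ} {e : ℕ → ℝ} {p : ℕ} (h : ¬ (p : ℤ) ∣ D)
    (hs : ¬ IsSplit D p) : locF (splitLoc D c e) p u = 1 + ∑' k, e (k + 1) * u ^ (k + 1) := by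
  simp [locF, splitLoc, h, hs]

lemma hasSum_geom_succ (h0 : 0 ≤ u) (h1 : u < 1) :
    HasSum (fun k ↦ u ^ (k + 1)) (u / (1 - u)) := by
  simpa [pow_succ', div_eq_mul_inv] using (hasSum_geometric_of_lt_one h0 h1).mul_left u

lemma one_add_tsum_one (h0 : 0 ≤ u) (h1 : u < 1) :
    1 + ∑' k, (1 : ℝ) * u ^ (k + 1) = (1 - u)⁻¹ := by
  simp_rw [one_mul]
  rw [(hasSum_geom_succ h0 h1).tsum_eq]
  have : 1 - u ≠ 0 := by linarith
  field_simp
  ring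

lemma one_add_tsum_evenInd (h0 : 0 ≤ u) (h1 : u < 1) :
    1 + ∑' k, evenInd (k + 1) * u ^ (k + 1) = (1 - u ^ 2)⁻¹ := by
  have hu2 : u ^ 2 < 1 := by nlinarith
  have h2 := hasSum_geometric_of_lt_one (sq_nonneg u) hu2
  have h3 : HasSum (fun k : ℕ ↦ evenInd k * u ^ k) (1 - u ^ 2)⁻¹ := by
    have hinj : Function.Injective fun k : ℕ ↦ 2 * k := fun a b h ↦ by simpa using h
    refine (hinj.hasSum_iff (f := fun k : ℕ ↦ evenInd k * u ^ k) fun k hk ↦ ?_).1 ?_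
    · rw [evenInd, if_neg, zero_mul]
      rintro ⟨j, hj⟩
      exact hk ⟨j, by simp only; omega⟩
    · refine h2.congr_fun fun k ↦ ?_
      simp [evenInd, pow_mul]
  rw [← h3.tsum_eq, h3.summable.tsum_eq_zero_add]
  simp [evenInd]

lemma one_add_tsum_charRe {α : ℂ} (hα : ‖α‖ = 1) (h0 : 0 ≤ u) (h1 : u < 1) :
    1 + ∑' k : ℕ, 2 * (α ^ (k + 1)).re * u ^ (k + 1) =
      (1 - u ^ 2) / (1 - 2 * u * α.re + u ^ 2) := by
  have hn : ‖α * (u : ℂ)‖ < 1 := by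
    rw [norm_mul, hα, one_mul, Complex.norm_real, Real.norm_eq_abs, abs_of_nonneg h0]
    exact h1
  have h2 := ((hasSum_geometric_of_norm_lt_one hn).mul_left (α * u)).mul_left (2 : ℂ)
  have h3 := Complex.hasSum_re h2
  have e : ∀ k : ℕ, (2 * (α * (u : ℂ) * (α * (u : ℂ)) ^ k)).re =
      2 * (α ^ (k + 1)).re * u ^ (k + 1) := by
    intro k
    rw [← pow_succ', mul_pow, ← Complex.ofReal_pow, ← mul_assoc, Complex.re_mul_ofReal]
    simp
  simp_rw [e] at h3
  rw [h3.tsum_eq]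
  have hre : α.re ^ 2 + α.im ^ 2 = 1 := by
    have := Complex.sq_norm α
    rw [hα, Complex.normSq_apply] at this
    nlinarith
  have hlt : α.re ≤ 1 := by nlinarith [sq_nonneg α.im]
  have hpos : 0 < 1 - 2 * u * α.re + u ^ 2 := by nlinarith [mul_nonneg h0 (sub_nonneg.2 hlt)]
  have hns : Complex.normSq (1 - α * u) = 1 - 2 * u * α.re + u ^ 2 := by
    rw [Complex.normSq_apply]
    simp
    linear_combination u ^ 2 * hre
  have h5 : (2 * (α * (u : ℂ) * (1 - α * (u : ℂ))⁻¹)).re =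
      2 * (u * α.re - u ^ 2) / (1 - 2 * u * α.re + u ^ 2) := by
    have h6 : (2 * (α * (u : ℂ) * (starRingEnd ℂ) (1 - α * (u : ℂ)))).re =
        2 * (u * α.re - u ^ 2) := by
      simp
      linear_combination (-u ^ 2) * hre
    rw [Complex.inv_def, hns, ← mul_assoc, ← mul_assoc,
      Complex.re_mul_ofReal, mul_assoc, h6, div_eq_mul_inv]
  rw [h5]
  field_simp
  ring

lemma abs_one_add_tsum_le {c : ℕ → ℝ} (hc : ∀ k, |c k| ≤ 1) (h0 : 0 ≤ u) (h1 : u ≤ 1 / 2) :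
    |1 + ∑' k, c (k + 1) * u ^ (k + 1)| ≤ Real.exp (-(1 / 2) * ((1 - c 1) * u)) * (1 - u)⁻¹ := by
  have hu1 : u < 1 := by linarith
  have hg := hasSum_geom_succ h0 hu1
  have hb : ∀ k, |c (k + 1) * u ^ (k + 1)| ≤ u ^ (k + 1) := fun k ↦ by
    rw [abs_mul, abs_of_nonneg (pow_nonneg h0 _)]
    exact mul_le_of_le_one_left (pow_nonneg h0 _) (hc _)
  have hs : Summable fun k ↦ c (k + 1) * u ^ (k + 1) :=
    Summable.of_norm_bounded hg.summable hb
  rw [hs.tsum_eq_zero_add]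
  have hg2 : HasSum (fun k : ℕ ↦ u ^ (k + 1 + 1)) (u * (u / (1 - u))) := by
    simpa [pow_succ'] using hg.mul_left u
  have ht : |∑' k : ℕ, c (k + 1 + 1) * u ^ (k + 1 + 1)| ≤ u * (u / (1 - u)) :=
    by rw [← Real.norm_eq_abs]; exact tsum_of_norm_bounded hg2 fun k ↦ hb (k + 1)
  have hc1 := abs_le.1 (hc 1)
  have h3 : 0 ≤ 1 + c 1 * u := by nlinarith
  have hpos : 0 < 1 - u := by linarith
  calc |1 + (c (0 + 1) * u ^ (0 + 1) + ∑' k : ℕ, c (k + 1 + 1) * u ^ (k + 1 + 1))|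
      = |(1 + c 1 * u) + ∑' k : ℕ, c (k + 1 + 1) * u ^ (k + 1 + 1)| := by
        congr 1
        simp only [zero_add, pow_one]
        ring
    _ ≤ (1 + c 1 * u) + u * (u / (1 - u)) := by
        refine (abs_add_le _ _).trans ?_
        rw [abs_of_nonneg h3]
        gcongr
    _ = (-((1 - c 1) * u * (1 - u)) + 1) * (1 - u)⁻¹ := by
        field_simp
        ring
    _ ≤ Real.exp (-(1 / 2) * ((1 - c 1) * u)) * (1 - u)⁻¹ := by
        refine mul_le_mul_of_nonneg_right ?_ (by positivity)
        refine le_trans ?_ (Real.add_one_le_exp _)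
        have : 0 ≤ (1 - c 1) * u := mul_nonneg (by linarith) h0
        nlinarith

lemma ratio_le_exp {c : ℝ} (hc : c ≤ 1) (h0 : 0 ≤ u) (h1 : u ≤ 1 / 2) :
    (1 - u ^ 2) / (1 - 2 * u * 1 + u ^ 2) ≤
      Real.exp (8 * ((1 - c) * u)) * ((1 - u ^ 2) / (1 - 2 * u * c + u ^ 2)) := by
  have h2 : 0 ≤ (1 - c) * u := mul_nonneg (by linarith) h0
  have h3 : 0 < (1 - u) ^ 2 := by
    have : 0 < 1 - u := by linarith
    positivity
  have h4 : 0 < 1 - 2 * u * c + u ^ 2 := by nlinarith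
  have h5 : 0 ≤ 1 - u ^ 2 := by nlinarith
  have h6 : 1 - 2 * u * c + u ^ 2 ≤ Real.exp (8 * ((1 - c) * u)) * (1 - u) ^ 2 := by
    have h7 := Real.add_one_le_exp (8 * ((1 - c) * u))
    have h8 : (1 : ℝ) / 4 ≤ (1 - u) ^ 2 := by nlinarith
    calc 1 - 2 * u * c + u ^ 2 ≤ (8 * ((1 - c) * u) + 1) * (1 - u) ^ 2 := by nlinarith
      _ ≤ _ := mul_le_mul_of_nonneg_right h7 h3.le
  rw [show 1 - 2 * u * 1 + u ^ 2 = (1 - u) ^ 2 by ring, div_le_iff₀ h3]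
  calc 1 - u ^ 2 = (1 - 2 * u * c + u ^ 2) * ((1 - u ^ 2) / (1 - 2 * u * c + u ^ 2)) :=
        (mul_div_cancel₀ _ h4.ne').symm
    _ ≤ (Real.exp (8 * ((1 - c) * u)) * (1 - u) ^ 2) * ((1 - u ^ 2) / (1 - 2 * u * c + u ^ 2)) :=
        mul_le_mul_of_nonneg_right h6 (by positivity)
    _ = _ := by ring

end local_factors

lemma IsSplit.not_dvd {p : ℕ} (h : IsSplit D p) : ¬ (p : ℤ) ∣ D := fun hd ↦
  not_isCoprime_of_dvd h.1 hd 0 (by simpa using h.2.1)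

lemma locF_normLoc {p : ℕ} {u : ℝ} (h0 : 0 ≤ u) (h1 : u < 1) :
    locF (normLoc D) p u = open Classical in
      if (p : ℤ) ∣ D then 1 else if IsSplit D p then (1 - u)⁻¹ else (1 - u ^ 2)⁻¹ := by
  unfold normLoc
  split_ifs with h h'
  · exact locF_splitLoc_of_dvd h
  · rw [locF_splitLoc_of_split h h', one_add_tsum_one h0 h1]
  · rw [locF_splitLoc_of_not_split h h', one_add_tsum_evenInd h0 h1]

lemma locF_sqLoc {p : ℕ} {u : ℝ} (h0 : 0 ≤ u) (h1 : u < 1) :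
    locF (sqLoc D) p u = open Classical in if (p : ℤ) ∣ D then 1 else (1 - u ^ 2)⁻¹ := by
  unfold sqLoc
  split_ifs with h
  · exact locF_splitLoc_of_dvd h
  · by_cases h' : IsSplit D p
    · rw [locF_splitLoc_of_split h h', one_add_tsum_evenInd h0 h1]
    · rw [locF_splitLoc_of_not_split h h', one_add_tsum_evenInd h0 h1]

lemma locF_rootLoc [Finite (Cl D)] (φ : Cl D →* ℂˣ) {p : ℕ} {u : ℝ} (h0 : 0 ≤ u) (h1 : u < 1) :
    locF (rootLoc φ) p u = open Classical in
      if IsSplit D p then (1 - u ^ 2) / (1 - 2 * u * charRe φ p 1 + u ^ 2) else 1 := by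
  unfold rootLoc
  split_ifs with h
  · rw [locF_splitLoc_of_split h.not_dvd h]
    simpa [charRe] using one_add_tsum_charRe (norm_char φ (primeCls D p)) h0 h1
  · by_cases h' : (p : ℤ) ∣ D
    · exact locF_splitLoc_of_dvd h'
    · rw [locF_splitLoc_of_not_split h' h]
      simp

lemma charRe_one (p k : ℕ) : charRe (1 : Cl D →* ℂˣ) p k = 1 := by simp [charRe]

lemma abs_normLoc_le_one (p k : ℕ) : |normLoc D p k| ≤ 1 := by
  rw [abs_of_nonneg (normLoc_nonneg p k)]
  exact normLoc_le_one p k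

lemma hasPrimeProd_normLoc {s : ℝ} (hs : 1 < s) :
    HasPrimeProd (fun p ↦ locF (normLoc D) p ((p : ℝ) ^ (-s))) (dSer (mulFn (normLoc D)) s) :=
  hasPrimeProd_mulFn (summable_of_abs_le_one (abs_mulFn_le_one abs_normLoc_le_one) hs)

lemma dSer_nonneg {a : ℕ → ℝ} (h : ∀ n, 0 ≤ a n) (s : ℝ) : 0 ≤ dSer a s :=
  tsum_nonneg fun n ↦ mul_nonneg (h n) (by positivity)

/-- The defect of inert primes in the comparison of `S ^ 2` with the zeta function of the order. -/
lemma dSer_sq_mul_le (hD : D < -4) (h : NegDisc D) {J : Finset ℕ}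
    (hJ : ∀ p ∈ J, p.Prime ∧ ¬ (p : ℤ) ∣ D ∧ ¬ IsSplit D p) {s : ℝ} (hs : 1 < s) :
    dSer (mulFn (sqLoc D)) s * dSer (mulFn (rootLoc (1 : Cl D →* ℂˣ))) s ≤
      (∏ p ∈ J, (1 - ((p : ℝ) ^ (-s)) ^ 2)) * dSer (mulFn (normLoc D)) s ^ 2 := by
  classical
  have := h.finite
  have h1 := hasPrimeProd_mulFn (summable_of_abs_le_one
    (abs_mulFn_le_one (abs_sqLoc_le_one (D := D))) hs)
  have h2 := hasPrimeProd_mulFn (summable_rootLoc hD h 1 hs)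
  have h3 := hasPrimeProd_normLoc (D := D) hs
  rw [sq (dSer _ _)]
  refine (le_abs_self _).trans ((h1.mul h2).abs_le (h3.mul h3)
    (w := fun p ↦ if p ∈ J then 1 - ((p : ℝ) ^ (-s)) ^ 2 else 1)
    (fun p _ ↦ mul_self_nonneg _) (fun p hp ↦ ?_) ?_)
  · have u0 := prime_rpow_pos hp s
    have u1 := prime_rpow_le_half hp hs
    set u := (p : ℝ) ^ (-s)
    have hu1 : u < 1 := by linarith
    rw [locF_normLoc u0.le hu1, locF_sqLoc u0.le hu1, locF_rootLoc 1 u0.le hu1, charRe_one]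
    have h4 : 0 < 1 - u := by linarith
    have h5 : 0 < 1 - u ^ 2 := by nlinarith
    have h6 : 1 - 2 * u * 1 + u ^ 2 = (1 - u) ^ 2 := by ring
    have h7 : (1 - u ^ 2)⁻¹ ≤ 1 * ((1 - u ^ 2)⁻¹ * (1 - u ^ 2)⁻¹) := by
      rw [one_mul]
      exact le_mul_of_one_le_left (by positivity) ((one_le_inv₀ h5).2 (by nlinarith))
    by_cases hd : (p : ℤ) ∣ D
    · have hpJ : p ∉ J := fun hpJ ↦ (hJ p hpJ).2.1 hd
      have hns : ¬ IsSplit D p := fun hns ↦ hns.not_dvd hd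
      simp [hd, hpJ, hns]
    by_cases hsp : IsSplit D p
    · have hpJ : p ∉ J := fun hpJ ↦ (hJ p hpJ).2.2 hsp
      simp only [hd, hsp, hpJ, if_true, if_false, h6]
      rw [abs_of_pos (by positivity)]
      apply le_of_eq
      field_simp
    · simp only [hd, hsp, if_false, mul_one]
      rw [abs_of_pos (by positivity)]
      split_ifs
      · apply le_of_eq
        field_simp
      · exact h7
  · filter_upwards [eventually_gt_atTop (J.sup id)] with N hN
    rw [Finset.prod_ite, Finset.prod_const_one, mul_one]
    apply le_of_eq
    congr 1
    ext p
    simp only [Finset.mem_filter, Nat.mem_primesBelow]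
    exact ⟨fun hp ↦ hp.2, fun hp ↦ ⟨⟨(Finset.le_sup (f := id) hp).trans_lt hN, (hJ p hp).1⟩, hp⟩⟩

open Classical in
/-- The partial sums of `∑ (1 - c p) / p` over split primes. -/
noncomputable def splitDefect (D : ℤ) (c : ℕ → ℝ) (N : ℕ) : ℝ :=
  ∑ p ∈ Nat.primesBelow N with IsSplit D p, (1 - c p) * (p : ℝ)⁻¹

lemma exists_lt_splitDefect (hD : D < -4) (h : NegDisc D) {φ : Cl D →* ℂˣ} (hφ : φ ≠ 1) (K : ℝ) :
    ∃ N, K < splitDefect D (fun p ↦ charRe φ p 1) N := by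
  classical
  by_contra! hK
  have := h.finite
  have hle : ∀ s : ℝ, 1 < s → dSer (mulFn (rootLoc (1 : Cl D →* ℂˣ))) s ≤
      Real.exp (8 * K) * dSer (mulFn (rootLoc φ)) s := by
    intro s hs
    have h2 := hasPrimeProd_mulFn (summable_rootLoc hD h 1 hs)
    have h3 := hasPrimeProd_mulFn (summable_rootLoc hD h φ hs)
    have hc : ∀ p, charRe φ p 1 ≤ 1 := fun p ↦ (abs_le.1 (abs_charRe_le φ p 1)).2
    refine (le_abs_self _).trans (h2.abs_le h3
      (w := fun p ↦ if IsSplit D p then Real.exp (8 * ((1 - charRe φ p 1) * (p : ℝ) ^ (-s))) else 1)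
      (fun p hp ↦ ?_) (fun p hp ↦ ?_) (Eventually.of_forall fun N ↦ ?_))
    · have u0 := prime_rpow_pos hp s
      have u1 := prime_rpow_le_half hp hs
      rw [locF_rootLoc φ u0.le (by linarith)]
      split_ifs
      · refine div_nonneg (by nlinarith) ?_
        nlinarith [mul_nonneg u0.le (sub_nonneg.2 (hc p)), sq_nonneg (1 - (p : ℝ) ^ (-s))]
      · exact zero_le_one
    · have u0 := prime_rpow_pos hp s
      have u1 := prime_rpow_le_half hp hs
      rw [locF_rootLoc φ u0.le (by linarith), locF_rootLoc 1 u0.le (by linarith), charRe_one]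
      split_ifs
      · rw [abs_of_nonneg]
        · exact ratio_le_exp (hc p) u0.le u1
        · refine div_nonneg (by nlinarith) ?_
          nlinarith [sq_nonneg (1 - (p : ℝ) ^ (-s))]
      · simp
    · rw [Finset.prod_ite, Finset.prod_const_one, mul_one, ← Real.exp_sum, ← Finset.mul_sum]
      refine Real.exp_le_exp.2 (mul_le_mul_of_nonneg_left (le_trans ?_ (hK N)) (by norm_num))
      refine Finset.sum_le_sum fun p hp ↦ mul_le_mul_of_nonneg_left
        (prime_rpow_le_inv (Nat.prime_of_mem_primesBelow (Finset.mem_filter.1 hp).1) hs)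
        (by linarith [hc p])
  have t1 := tendsto_dSer_sq_mul hD h 1
  have t2 := (tendsto_dSer_sq_mul hD h φ).const_mul (Real.exp (8 * K))
  rw [finsum_char_eq_zero h hφ, zero_mul, zero_div, mul_zero] at t2
  rw [finsum_char_one h] at t1
  have h0 : (Nat.card (Cl D) : ℝ) * resConst D / 2 ≤ 0 := by
    refine le_of_tendsto_of_tendsto t1 t2 ?_
    filter_upwards [self_mem_nhdsWithin] with s (hs : 1 < s)
    have h5 : 0 ≤ (s - 1) * dSer (mulFn (sqLoc D)) s :=
      mul_nonneg (by linarith) (dSer_nonneg (mulFn_nonneg sqLoc_nonneg) s)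
    have h6 := mul_le_mul_of_nonneg_left (hle s hs) h5
    calc _ = _ := by ring
      _ ≤ _ := h6
      _ = _ := by ring
  have h7 : (0 : ℝ) < Nat.card (Cl D) := by exact_mod_cast Nat.card_pos
  have h8 := resConst_pos (D := D) (by omega)
  have : 0 < (Nat.card (Cl D) : ℝ) * resConst D / 2 := by positivity
  linarith

lemma abs_dSer_le_exp_mul {c : ℕ → ℕ → ℝ} (hc : ∀ p k, |c p k| ≤ 1) {s : ℝ} (hs : 1 < s) (N : ℕ) :
    open Classical in |dSer (mulFn (splitLoc D c evenInd)) s| ≤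
      Real.exp (∑ p ∈ Nat.primesBelow N with IsSplit D p,
        -(1 / 2) * ((1 - c p 1) * (p : ℝ) ^ (-s))) * dSer (mulFn (normLoc D)) s := by
  classical
  have hl : ∀ p k, |splitLoc D c evenInd p k| ≤ 1 := fun p k ↦
    (abs_splitLoc_le (D := D) hc (fun k ↦ by rw [abs_of_nonneg (evenInd_nonneg k)]) p k).trans
      (normLoc_le_one p k)
  have h2 := hasPrimeProd_mulFn (summable_of_abs_le_one (abs_mulFn_le_one hl) hs)
  have h3 := hasPrimeProd_normLoc (D := D) hs
  refine h2.abs_le h3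
    (w := fun p ↦ if IsSplit D p then Real.exp (-(1 / 2) * ((1 - c p 1) * (p : ℝ) ^ (-s))) else 1)
    (fun p hp ↦ ?_) (fun p hp ↦ ?_) ?_
  · have u0 := prime_rpow_pos hp s
    have u1 := prime_rpow_le_half hp hs
    rw [locF_normLoc u0.le (by linarith)]
    split_ifs
    · exact zero_le_one
    · exact inv_nonneg.2 (by linarith)
    · exact inv_nonneg.2 (by nlinarith)
  · have u0 := prime_rpow_pos hp s
    have u1 := prime_rpow_le_half hp hs
    rw [locF_normLoc u0.le (by linarith)]
    by_cases hd : (p : ℤ) ∣ D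
    · have hns : ¬ IsSplit D p := fun hns ↦ hns.not_dvd hd
      rw [locF_splitLoc_of_dvd hd]
      simp [hd, hns]
    by_cases hsp : IsSplit D p
    · rw [locF_splitLoc_of_split hd hsp]
      simp only [hd, hsp, if_true, if_false]
      exact abs_one_add_tsum_le (hc p) u0.le u1
    · rw [locF_splitLoc_of_not_split hd hsp, one_add_tsum_evenInd u0.le (by linarith)]
      simp only [hd, hsp, if_false, one_mul]
      rw [abs_of_nonneg (inv_nonneg.2 (by nlinarith))]
  · filter_upwards [eventually_ge_atTop N] with M hM
    rw [Finset.prod_ite, Finset.prod_const_one, mul_one, ← Real.exp_sum]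
    refine Real.exp_le_exp.2 ?_
    have hsub : (Nat.primesBelow N).filter (IsSplit D) ⊆ (Nat.primesBelow M).filter (IsSplit D) :=
      Finset.filter_subset_filter _ fun p hp ↦ by
        rw [Nat.mem_primesBelow] at hp ⊢
        exact ⟨hp.1.trans_le hM, hp.2⟩
    rw [← neg_le_neg_iff, ← Finset.sum_neg_distrib, ← Finset.sum_neg_distrib]
    refine Finset.sum_le_sum_of_subset_of_nonneg hsub fun p _ _ ↦ ?_
    have := (abs_le.1 (hc p 1)).2
    have : 0 ≤ (1 - c p 1) * (p : ℝ) ^ (-s) := mul_nonneg (by linarith) (by positivity)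
    linarith

lemma eventually_abs_dSer_le {c : ℕ → ℕ → ℝ} (hc : ∀ p k, |c p k| ≤ 1)
    (hinf : ∀ K, ∃ N, K < splitDefect D (fun p ↦ c p 1) N) {ε : ℝ} (hε : 0 < ε) :
    ∀ᶠ s in nhdsWithin (1 : ℝ) (Set.Ioi 1),
      |dSer (mulFn (splitLoc D c evenInd)) s| ≤ ε * dSer (mulFn (normLoc D)) s := by
  classical
  obtain ⟨N, hN⟩ := hinf (-2 * Real.log ε)
  have ht : Tendsto (fun s : ℝ ↦ Real.exp (∑ p ∈ Nat.primesBelow N with IsSplit D p,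
        -(1 / 2) * ((1 - c p 1) * (p : ℝ) ^ (-s)))) (nhdsWithin 1 (Set.Ioi 1))
      (nhds (Real.exp (∑ p ∈ Nat.primesBelow N with IsSplit D p,
        -(1 / 2) * ((1 - c p 1) * (p : ℝ) ^ (-1 : ℝ))))) := by
    refine (Real.continuous_exp.tendsto _).comp (tendsto_finsetSum _ fun p hp ↦ ?_)
    have hp' := Nat.prime_of_mem_primesBelow (Finset.mem_filter.1 hp).1
    refine ((Tendsto.const_mul _ ?_).const_mul _)
    have : ContinuousAt (fun s : ℝ ↦ (p : ℝ) ^ (-s)) 1 :=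
      (Real.continuousAt_const_rpow (by exact_mod_cast hp'.ne_zero)).comp continuousAt_neg
    exact this.tendsto.mono_left nhdsWithin_le_nhds
  have hlt : Real.exp (∑ p ∈ Nat.primesBelow N with IsSplit D p,
        -(1 / 2) * ((1 - c p 1) * (p : ℝ) ^ (-1 : ℝ))) < ε := by
    rw [← Real.lt_log_iff_exp_lt hε, ← Finset.mul_sum]
    simp_rw [Real.rpow_neg_one]
    unfold splitDefect at hN
    linarith
  filter_upwards [ht.eventually_lt_const hlt, self_mem_nhdsWithin] with s h1 (hs : 1 < s)
  exact (abs_dSer_le_exp_mul hc hs N).trans (mul_le_mul_of_nonneg_right h1.le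
    (dSer_nonneg (mulFn_nonneg normLoc_nonneg) s))

lemma splitDefect_mono {c c' : ℕ → ℝ} {K : ℝ} (h : ∀ p, K * (1 - c p) ≤ 1 - c' p) (N : ℕ) :
    K * splitDefect D c N ≤ splitDefect D c' N := by
  unfold splitDefect
  rw [Finset.mul_sum]
  refine Finset.sum_le_sum fun p _ ↦ ?_
  rw [← mul_assoc]
  exact mul_le_mul_of_nonneg_right (h p) (by positivity)

lemma eventually_abs_dSer_charLoc_le (hD : D < -4) (h : NegDisc D) {ψ : Cl D →* ℂˣ} (hψ : ψ ≠ 1)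
    {ε : ℝ} (hε : 0 < ε) : ∀ᶠ s in nhdsWithin (1 : ℝ) (Set.Ioi 1),
      |dSer (mulFn (charLoc ψ)) s| ≤ ε * dSer (mulFn (normLoc D)) s := by
  have := h.finite
  exact eventually_abs_dSer_le (abs_charRe_le ψ) (exists_lt_splitDefect hD h hψ) hε

lemma eventually_dSer_abs_charLoc_le (hD : D < -4) (h : NegDisc D) {ψ : Cl D →* ℂˣ}
    (hψ : ψ ^ 2 ≠ 1) {ε : ℝ} (hε : 0 < ε) : ∀ᶠ s in nhdsWithin (1 : ℝ) (Set.Ioi 1),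
      dSer (fun n ↦ |mulFn (charLoc ψ) n|) s ≤ ε * dSer (mulFn (normLoc D)) s := by
  have := h.finite
  have e : (fun n ↦ |mulFn (charLoc ψ) n|) =
      mulFn (splitLoc D (fun p k ↦ |charRe ψ p k|) evenInd) := by
    funext n
    rw [abs_mulFn]
    congr 1
    funext p k
    unfold charLoc splitLoc
    split_ifs
    · simp
    · rfl
    · exact abs_of_nonneg (evenInd_nonneg k)
  rw [e]
  have hle : ∀ p, 1 / 4 * (1 - charRe (ψ ^ 2) p 1) ≤ 1 - |charRe ψ p 1| := by
    intro p
    have h1 := norm_char ψ (primeCls D p)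
    have h2 := Complex.sq_norm (ψ (primeCls D p) : ℂ)
    rw [h1, Complex.normSq_apply] at h2
    have h3 : charRe (ψ ^ 2) p 1 = 2 * |charRe ψ p 1| ^ 2 - 1 := by
      rw [sq_abs]
      simp only [charRe, pow_one, MonoidHom.pow_apply, Units.val_pow_eq_pow_val]
      rw [sq, Complex.mul_re]
      linarith
    have h4 := abs_charRe_le ψ p 1
    rw [h3]
    nlinarith [abs_nonneg (charRe ψ p 1)]
  filter_upwards [eventually_abs_dSer_le (D := D) (c := fun p k ↦ |charRe ψ p k|)
    (fun p k ↦ by rw [abs_abs]; exact abs_charRe_le ψ p k) (fun K ↦ by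
      obtain ⟨N, hN⟩ := exists_lt_splitDefect hD h hψ (4 * K)
      exact ⟨N, by linarith [splitDefect_mono (D := D) hle N]⟩) hε] with s hs
  exact (le_abs_self _).trans hs

open Classical in
/-- The indicator function of the positive integers represented by `f` and not divisible by any
element of `P`. -/
noncomputable def repInd (f : QF) (P : Finset ℕ) (n : ℕ) : ℝ :=
  if 0 < n ∧ (∀ p ∈ P, ¬ p ∣ n) ∧ ∃ u v, f.eval u v = n then 1 else 0

lemma repInd_nonneg (f : QF) (P : Finset ℕ) (n : ℕ) : 0 ≤ repInd f P n := by
  unfold repInd; split_ifs <;> norm_num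

lemma abs_repInd_le_one (f : QF) (P : Finset ℕ) (n : ℕ) : |repInd f P n| ≤ 1 := by
  unfold repInd; split_ifs <;> norm_num

/-- `c` is a lower bound for the limit of `√(s - 1) ∑ n ^ (-s)` as `s → 1`, where `n` runs over the
integers without divisors in `P` represented by a form of discriminant `D`. -/
def LowerBd (D : ℤ) (P : Finset ℕ) (c : ℝ) : Prop :=
  ∀ f : QF, f.Good D → ∀ c' < c, ∀ᶠ s in nhdsWithin (1 : ℝ) (Set.Ioi 1),
    c' ≤ √(s - 1) * dSer (repInd f P) s

lemma dSer_sum {ι : Type*} (t : Finset ι) {a : ι → ℕ → ℝ} (h : ∀ i ∈ t, ∀ n, |a i n| ≤ 1)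
    {s : ℝ} (hs : 1 < s) (r : ι → ℝ) :
    dSer (fun n ↦ ∑ i ∈ t, r i * a i n) s = ∑ i ∈ t, r i * dSer (a i) s := by
  unfold dSer
  simp_rw [Finset.sum_mul, mul_assoc]
  rw [Summable.tsum_finsetSum fun i hi ↦ (summable_of_abs_le_one (h i hi) hs).mul_left _]
  simp_rw [tsum_mul_left]

lemma charLoc_one : charLoc (1 : Cl D →* ℂˣ) = normLoc D := by
  unfold charLoc normLoc
  congr 1
  funext p k
  exact charRe_one p k

lemma dSer_le_card_mul (hD : D < -4) {f : QF} (hf : f.Good D) [Finite (Cl D)]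
    [Fintype (Cl D →* ℂˣ)] [DecidableEq (Cl D →* ℂˣ)] {s : ℝ} (hs : 1 < s) :
    ∑ ψ : Cl D →* ℂˣ with ψ ^ 2 = 1, (ψ (cls D f) : ℂ).re * dSer (mulFn (charLoc ψ)) s -
      ∑ ψ : Cl D →* ℂˣ with ¬ ψ ^ 2 = 1, dSer (fun n ↦ |mulFn (charLoc ψ) n|) s ≤
        (({A : Cl D | A ^ 2 = 1}.ncard : ℕ) : ℝ) * dSer (repInd f D.natAbs.primeFactors) s := by
  have hb : ∀ ψ : Cl D →* ℂˣ, ∀ n, |mulFn (charLoc ψ) n| ≤ 1 := fun ψ ↦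
    abs_mulFn_le_one fun p k ↦ (abs_charLoc_le ψ p k).trans (normLoc_le_one p k)
  have h1 := dSer_sum {ψ : Cl D →* ℂˣ | ψ ^ 2 = 1} (fun ψ _ ↦ hb ψ) hs
    fun ψ ↦ (ψ (cls D f) : ℂ).re
  have h2 := dSer_sum {ψ : Cl D →* ℂˣ | ¬ ψ ^ 2 = 1} (a := fun ψ n ↦ |mulFn (charLoc ψ) n|)
    (fun ψ _ n ↦ by rw [abs_abs]; exact hb ψ n) hs fun ψ ↦ (1 : ℝ)
  simp_rw [one_mul] at h2
  rw [← h1, ← h2]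
  unfold dSer
  have s1 : Summable fun n : ℕ ↦ (∑ ψ : Cl D →* ℂˣ with ψ ^ 2 = 1,
      (ψ (cls D f) : ℂ).re * mulFn (charLoc ψ) n) * (n : ℝ) ^ (-s) := by
    simp_rw [Finset.sum_mul, mul_assoc]
    exact summable_sum fun ψ _ ↦ (summable_of_abs_le_one (hb ψ) hs).mul_left _
  have s2 : Summable fun n : ℕ ↦ (∑ ψ : Cl D →* ℂˣ with ¬ ψ ^ 2 = 1,
      |mulFn (charLoc ψ) n|) * (n : ℝ) ^ (-s) := by
    simp_rw [Finset.sum_mul]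
    exact summable_sum fun ψ _ ↦ summable_of_abs_le_one (a := fun n ↦ |mulFn (charLoc ψ) n|)
      (fun n ↦ by rw [abs_abs]; exact hb ψ n) hs
  have s3 := summable_of_abs_le_one (abs_repInd_le_one f D.natAbs.primeFactors) hs
  rw [← tsum_mul_left, ← s1.tsum_sub s2]
  refine (s1.sub s2).tsum_le_tsum (fun n ↦ ?_) (s3.mul_left _)
  rw [← sub_mul, ← mul_assoc]
  refine mul_le_mul_of_nonneg_right ?_ (by positivity)
  refine le_card_mul_indicator hD hf (repInd_nonneg _ _ _) fun hn hco hrep ↦ ?_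
  exact if_pos ⟨hn, fun p hp hpn ↦ (Nat.prime_iff_prime_int.1
    (Nat.prime_of_mem_primeFactors hp)).not_isUnit (hco.isUnit_of_dvd'
      (Int.natCast_dvd_natCast.2 hpn)
      (Int.natCast_dvd.2 (Nat.dvd_of_mem_primeFactors hp))), hrep⟩

/-- The lower bound for the integers coprime to the discriminant. -/
theorem lowerBd_primeFactors (hD : D < -4) (h : NegDisc D) {J : Finset ℕ}
    (hJ : ∀ p ∈ J, p.Prime ∧ ¬ (p : ℤ) ∣ D ∧ ¬ IsSplit D p) {G c : ℝ}
    (hG : (({A : Cl D | A ^ 2 = 1}.ncard : ℕ) : ℝ) ≤ G)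
    (hc : c ^ 2 * (2 * G * ∏ p ∈ J, (1 - ((p : ℝ)⁻¹) ^ 2)) ≤ resConst D) :
    LowerBd D D.natAbs.primeFactors c := by
  classical
  intro f hf c' hc'
  have := h.finite
  have := Fintype.ofFinite (Cl D →* ℂˣ)
  set g : ℝ := (({A : Cl D | A ^ 2 = 1}.ncard : ℕ) : ℝ) with hg
  have hg1 : 1 ≤ g := by
    have : 0 < {A : Cl D | A ^ 2 = 1}.ncard :=
      (Set.ncard_pos (Set.toFinite _)).2 ⟨1, by simp⟩
    rw [hg]
    exact_mod_cast this
  have hgh : g ≤ Nat.card (Cl D) := by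
    rw [hg]
    exact_mod_cast Set.ncard_le_card _
  by_cases hc'0 : c' < 0
  · filter_upwards with s
    exact hc'0.le.trans (mul_nonneg (Real.sqrt_nonneg _) (dSer_nonneg (repInd_nonneg _ _) s))
  push Not at hc'0
  set W : ℝ := ∏ p ∈ J, (1 - ((p : ℝ)⁻¹) ^ 2) with hW
  have hW0 : 0 < W := Finset.prod_pos fun p hp ↦ by
    have h2 : (2 : ℝ) ≤ p := by exact_mod_cast (hJ p hp).1.two_le
    have h3 : (p : ℝ)⁻¹ ≤ 2⁻¹ := inv_anti₀ (by norm_num) h2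
    have h4 : 0 < (p : ℝ)⁻¹ := by positivity
    nlinarith
  obtain ⟨c₁, hc₁, hc₂⟩ := exists_between hc'
  have hc10 : 0 < c₁ := hc'0.trans_lt hc₁
  -- the second moment
  have hmom : ∀ᶠ s in nhdsWithin (1 : ℝ) (Set.Ioi 1),
      g * c₁ ≤ √(s - 1) * dSer (mulFn (normLoc D)) s := by
    have t1 := tendsto_dSer_sq_mul hD h 1
    rw [finsum_char_one h] at t1
    have t2 : Tendsto (fun s : ℝ ↦ (g * c₁) ^ 2 * ∏ p ∈ J, (1 - ((p : ℝ) ^ (-s)) ^ 2))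
        (nhdsWithin 1 (Set.Ioi 1)) (nhds ((g * c₁) ^ 2 * W)) := by
      refine (tendsto_finsetProd _ fun p hp ↦ ?_).const_mul _
      have : ContinuousAt (fun s : ℝ ↦ 1 - ((p : ℝ) ^ (-s)) ^ 2) 1 :=
        continuousAt_const.sub (((Real.continuousAt_const_rpow
          (by exact_mod_cast (hJ p hp).1.ne_zero)).comp continuousAt_neg).pow 2)
      have := this.tendsto.mono_left (nhdsWithin_le_nhds (s := Set.Ioi 1))
      rwa [Real.rpow_neg_one] at this
    have hlt : (g * c₁) ^ 2 * W < Nat.card (Cl D) * resConst D / 2 := by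
      have h1 : c₁ ^ 2 < c ^ 2 := by nlinarith
      have h2 : c ^ 2 * (2 * g * W) ≤ resConst D := le_trans (by gcongr) hc
      have h3 : c₁ ^ 2 * (2 * g * W) < resConst D :=
        lt_of_lt_of_le (mul_lt_mul_of_pos_right h1 (by positivity)) h2
      have h4 := resConst_pos (D := D) (by omega)
      calc (g * c₁) ^ 2 * W = g * (c₁ ^ 2 * (2 * g * W)) / 2 := by ring
        _ < g * resConst D / 2 := by gcongr
        _ ≤ _ := by gcongr
    filter_upwards [t2.eventually_lt t1 hlt, self_mem_nhdsWithin] with s h1 (hs : 1 < s)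
    have h2 := mul_le_mul_of_nonneg_left (dSer_sq_mul_le hD h hJ hs) (sub_nonneg.2 hs.le)
    have h3 := h1.le.trans h2
    have h4 : 0 < ∏ p ∈ J, (1 - ((p : ℝ) ^ (-s)) ^ 2) := Finset.prod_pos fun p hp ↦ by
      have := prime_rpow_pos (hJ p hp).1 s
      have := prime_rpow_le_half (hJ p hp).1 hs
      nlinarith
    have h5 : (g * c₁) ^ 2 ≤ (s - 1) * dSer (mulFn (normLoc D)) s ^ 2 := by
      refine le_of_mul_le_mul_right ?_ h4
      calc _ ≤ _ := h3
        _ = _ := by ring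
    refine le_of_sq_le_sq ?_ (mul_nonneg (Real.sqrt_nonneg _)
      (dSer_nonneg (mulFn_nonneg normLoc_nonneg) s))
    rw [mul_pow √(s - 1), Real.sq_sqrt (by linarith)]
    exact h5
  -- the error terms
  obtain ⟨ε, hε, hεc⟩ : ∃ ε : ℝ, 0 < ε ∧
      c' ≤ c₁ * (1 - ε * (Fintype.card (Cl D →* ℂˣ) : ℝ)) := by
    have hcard : (0 : ℝ) < Fintype.card (Cl D →* ℂˣ) := by
      exact_mod_cast Fintype.card_pos
    refine ⟨(1 - c' / c₁) / Fintype.card (Cl D →* ℂˣ), div_pos ?_ hcard, le_of_eq ?_⟩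
    · rw [sub_pos, div_lt_one hc10]
      exact hc₁
    · field_simp
      ring
  have hev1 : ∀ᶠ s in nhdsWithin (1 : ℝ) (Set.Ioi 1), ∀ ψ : Cl D →* ℂˣ, ψ ≠ 1 →
      |dSer (mulFn (charLoc ψ)) s| ≤ ε * dSer (mulFn (normLoc D)) s := by
    rw [eventually_all]
    intro ψ
    by_cases hψ : ψ = 1
    · simp [hψ]
    · filter_upwards [eventually_abs_dSer_charLoc_le hD h hψ hε] with s hs _
      exact hs
  have hev2 : ∀ᶠ s in nhdsWithin (1 : ℝ) (Set.Ioi 1), ∀ ψ : Cl D →* ℂˣ, ¬ ψ ^ 2 = 1 →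
      dSer (fun n ↦ |mulFn (charLoc ψ) n|) s ≤ ε * dSer (mulFn (normLoc D)) s := by
    rw [eventually_all]
    intro ψ
    by_cases hψ : ψ ^ 2 = 1
    · simp [hψ]
    · filter_upwards [eventually_dSer_abs_charLoc_le hD h hψ hε] with s hs _
      exact hs
  filter_upwards [hmom, hev1, hev2, self_mem_nhdsWithin] with s h1 h2 h3 (hs : 1 < s)
  have key := dSer_le_card_mul hD hf hs
  set S := dSer (mulFn (normLoc D)) s with hS
  have hS0 : 0 ≤ S := dSer_nonneg (mulFn_nonneg normLoc_nonneg) s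
  have e1 : S - ∑ ψ : Cl D →* ℂˣ with ψ ^ 2 = 1, ε * S ≤
      ∑ ψ : Cl D →* ℂˣ with ψ ^ 2 = 1, (ψ (cls D f) : ℂ).re * dSer (mulFn (charLoc ψ)) s := by
    have h1mem : (1 : Cl D →* ℂˣ) ∈ ({ψ : Cl D →* ℂˣ | ψ ^ 2 = 1} : Finset _) :=
      Finset.mem_filter.2 ⟨Finset.mem_univ _, by ext; simp⟩
    rw [← Finset.add_sum_erase _ _ h1mem, ← Finset.add_sum_erase _ _ h1mem, charLoc_one, ← hS]
    have h5 : -∑ ψ ∈ ({ψ : Cl D →* ℂˣ | ψ ^ 2 = 1} : Finset _).erase 1, ε * S ≤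
        ∑ ψ ∈ ({ψ : Cl D →* ℂˣ | ψ ^ 2 = 1} : Finset _).erase 1,
          (ψ (cls D f) : ℂ).re * dSer (mulFn (charLoc ψ)) s := by
      rw [← Finset.sum_neg_distrib]
      refine Finset.sum_le_sum fun ψ hψ ↦ ?_
      have h6 := h2 ψ (Finset.ne_of_mem_erase hψ)
      have h7 := abs_re_char_le ψ (cls D f)
      have h8 : |(ψ (cls D f) : ℂ).re * dSer (mulFn (charLoc ψ)) s| ≤ 1 * (ε * S) := by
        rw [abs_mul]
        exact mul_le_mul h7 h6 (abs_nonneg _) zero_le_one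
      linarith [(abs_le.1 h8).1]
    have : 0 ≤ ε * S := by positivity
    simp only [MonoidHom.one_apply, Units.val_one, Complex.one_re, one_mul]
    linarith
  have e2 : ∑ ψ : Cl D →* ℂˣ with ¬ ψ ^ 2 = 1, dSer (fun n ↦ |mulFn (charLoc ψ) n|) s ≤
      ∑ ψ : Cl D →* ℂˣ with ¬ ψ ^ 2 = 1, ε * S :=
    Finset.sum_le_sum fun ψ hψ ↦ h3 ψ (Finset.mem_filter.1 hψ).2
  have e3 := Finset.sum_filter_add_sum_filter_not (Finset.univ : Finset (Cl D →* ℂˣ))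
    (fun ψ ↦ ψ ^ 2 = 1) fun _ ↦ ε * S
  rw [Finset.sum_const (s := Finset.univ), Finset.card_univ, nsmul_eq_mul] at e3
  have e4 : S * (1 - ε * (Fintype.card (Cl D →* ℂˣ) : ℝ)) ≤
      g * dSer (repInd f D.natAbs.primeFactors) s := by
    refine le_trans ?_ key
    linarith
  have hpos : 0 ≤ 1 - ε * (Fintype.card (Cl D →* ℂˣ) : ℝ) := by
    by_contra! hneg
    nlinarith
  have e5 := mul_le_mul_of_nonneg_left e4 (Real.sqrt_nonneg (s - 1))
  have e6 := mul_le_mul_of_nonneg_right h1 hpos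
  have e7 : g * c' ≤ g * (√(s - 1) * dSer (repInd f D.natAbs.primeFactors) s) := by
    calc g * c' ≤ g * (c₁ * (1 - ε * (Fintype.card (Cl D →* ℂˣ) : ℝ))) := by gcongr
      _ = g * c₁ * (1 - ε * (Fintype.card (Cl D →* ℂˣ) : ℝ)) := by ring
      _ ≤ _ := e6
      _ = _ := by ring
      _ ≤ _ := e5
      _ = _ := by ring
  exact le_of_mul_le_mul_left e7 (by linarith)

lemma dSer_eq_mul_integral {a : ℕ → ℝ} (h0 : ∀ n, 0 ≤ a n) (h1 : ∀ n, a n ≤ 1) {s : ℝ}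
    (hs : 1 < s) : dSer a s =
      s * ∫ t in Set.Ioi (1 : ℝ), (∑ k ∈ Finset.Icc 1 ⌊t⌋₊, a k) * t ^ (-(s + 1)) := by
  have hO : (fun n : ℕ ↦ ∑ k ∈ Finset.Icc 1 n, a k) =O[atTop] fun n : ℕ ↦ (n : ℝ) ^ (1 : ℝ) := by
    refine Asymptotics.isBigO_of_le _ fun n ↦ ?_
    rw [Real.rpow_one, Real.norm_of_nonneg (Finset.sum_nonneg fun k _ ↦ h0 k),
      Real.norm_of_nonneg n.cast_nonneg]
    simpa using Finset.sum_le_card_nsmul (Finset.Icc 1 n) a 1 fun k _ ↦ h1 k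
  have key := LSeries_eq_mul_integral_of_nonneg a zero_le_one (s := (s : ℂ))
      (by simpa using hs) hO h0
  rw [lSeries_ofReal a (by linarith)] at key
  have e : ∫ t in Set.Ioi (1 : ℝ),
      (∑ k ∈ Finset.Icc 1 ⌊t⌋₊, (a k : ℂ)) * (t : ℂ) ^ (-((s : ℂ) + 1)) =
      ((∫ t in Set.Ioi (1 : ℝ), (∑ k ∈ Finset.Icc 1 ⌊t⌋₊, a k) * t ^ (-(s + 1)) : ℝ) : ℂ) := by
    refine Eq.trans ?_ (integral_ofReal (𝕜 := ℂ))
    refine MeasureTheory.setIntegral_congr_fun measurableSet_Ioi fun t (ht : 1 < t) ↦ ?_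
    simp only [Complex.coe_algebraMap]
    rw [Complex.ofReal_mul, Complex.ofReal_sum, Complex.ofReal_cpow (by linarith)]
    simp
  rw [e] at key
  exact_mod_cast key

lemma integral_sqrt_log_mul_rpow {s : ℝ} (hs : 1 < s) :
    ∫ t in Set.Ioi (1 : ℝ), (√(Real.log t))⁻¹ * t ^ (-s) = √Real.pi / √(s - 1) := by
  have hi : Real.exp '' Set.Ioi 0 = Set.Ioi 1 := by
    rw [← Real.exp_zero]
    ext y
    constructor
    · rintro ⟨x, hx, rfl⟩
      exact Real.exp_lt_exp.2 hx
    · intro (hy : Real.exp 0 < y)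
      have hy0 : 0 < y := (Real.exp_pos 0).trans hy
      exact ⟨Real.log y, (Real.lt_log_iff_exp_lt hy0).2 hy, Real.exp_log hy0⟩
  rw [← hi, MeasureTheory.integral_image_eq_integral_abs_deriv_smul measurableSet_Ioi
    (fun x _ ↦ (Real.hasDerivAt_exp x).hasDerivWithinAt) Real.exp_injective.injOn]
  have key := Real.integral_rpow_mul_exp_neg_mul_Ioi (a := 1 / 2) (r := s - 1) (by norm_num)
    (by linarith)
  rw [Real.Gamma_one_half_eq, ← Real.sqrt_eq_rpow, Real.sqrt_div zero_le_one, Real.sqrt_one,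
    div_mul_eq_mul_div, one_mul] at key
  rw [← key]
  refine MeasureTheory.setIntegral_congr_fun measurableSet_Ioi fun v (hv : 0 < v) ↦ ?_
  simp only [smul_eq_mul, Real.log_exp]
  rw [abs_of_pos (Real.exp_pos v), ← Real.exp_mul, show (1 / 2 - 1 : ℝ) = -(1 / 2) by norm_num,
    Real.rpow_neg hv.le, ← Real.sqrt_eq_rpow, mul_left_comm, ← Real.exp_add]
  congr 2
  ring

lemma dSer_le_of_eventually_le {a : ℕ → ℝ} (h0 : ∀ n, 0 ≤ a n) (h1 : ∀ n, a n ≤ 1) {C x₀ : ℝ}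
    (hC : 0 ≤ C) (hx₀ : 1 ≤ x₀)
    (h : ∀ x, x₀ ≤ x → ∑ k ∈ Finset.Icc 1 ⌊x⌋₊, a k ≤ C * (x / √(Real.log x)))
    {s : ℝ} (hs : 1 < s) : dSer a s ≤ s * (x₀ + C * (√Real.pi / √(s - 1))) := by
  rw [dSer_eq_mul_integral h0 h1 hs]
  refine mul_le_mul_of_nonneg_left ?_ (by linarith)
  have hintg : MeasureTheory.IntegrableOn (fun t ↦ (√(Real.log t))⁻¹ * t ^ (-s))
      (Set.Ioi (1 : ℝ)) := by
    refine .of_integral_ne_zero ?_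
    rw [integral_sqrt_log_mul_rpow hs]
    have : 0 < s - 1 := by linarith
    positivity
  have hint1 : MeasureTheory.IntegrableOn (Set.indicator (Set.Ioc 1 x₀) fun _ ↦ (1 : ℝ))
      (Set.Ioi (1 : ℝ)) := by
    refine MeasureTheory.Integrable.integrableOn ?_
    rw [MeasureTheory.integrable_indicator_iff measurableSet_Ioc]
    simp
  have e1 : ∫ t in Set.Ioi (1 : ℝ), Set.indicator (Set.Ioc 1 x₀) (fun _ ↦ (1 : ℝ)) t ≤ x₀ := by
    rw [MeasureTheory.setIntegral_indicator measurableSet_Ioc,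
      Set.inter_eq_self_of_subset_right Set.Ioc_subset_Ioi_self]
    simp [hx₀]
  calc ∫ t in Set.Ioi (1 : ℝ), (∑ k ∈ Finset.Icc 1 ⌊t⌋₊, a k) * t ^ (-(s + 1))
      ≤ ∫ t in Set.Ioi (1 : ℝ), (Set.indicator (Set.Ioc 1 x₀) (fun _ ↦ (1 : ℝ)) t +
          C * ((√(Real.log t))⁻¹ * t ^ (-s))) := by
        refine MeasureTheory.integral_mono_of_nonneg ?_ (hint1.add (hintg.const_mul C)) ?_
        · filter_upwards [MeasureTheory.ae_restrict_mem measurableSet_Ioi] with t (ht : 1 < t)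
          exact mul_nonneg (Finset.sum_nonneg fun k _ ↦ h0 k) (Real.rpow_nonneg (by linarith) _)
        · filter_upwards [MeasureTheory.ae_restrict_mem measurableSet_Ioi] with t (ht : 1 < t)
          have ht0 : 0 < t := by linarith
          have hsplit : t * t ^ (-(s + 1)) = t ^ (-s) := by
            rw [mul_comm, ← Real.rpow_add_one ht0.ne']
            congr 1
            ring
          have hr : 0 < t ^ (-(s + 1)) := Real.rpow_pos_of_pos ht0 _
          have hr' : 0 < t ^ (-s) := Real.rpow_pos_of_pos ht0 _
          rcases le_or_gt t x₀ with htx | htx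
          · rw [Set.indicator_of_mem (show t ∈ Set.Ioc 1 x₀ from ⟨ht, htx⟩)]
            have hA : ∑ k ∈ Finset.Icc 1 ⌊t⌋₊, a k ≤ t := by
              refine le_trans (Finset.sum_le_card_nsmul _ a 1 fun k _ ↦ h1 k) ?_
              simpa using Nat.floor_le ht0.le
            have h2 : (∑ k ∈ Finset.Icc 1 ⌊t⌋₊, a k) * t ^ (-(s + 1)) ≤ t ^ (-s) := by
              rw [← hsplit]
              exact mul_le_mul_of_nonneg_right hA hr.le
            have h3 : t ^ (-s) ≤ 1 := Real.rpow_le_one_of_one_le_of_nonpos ht.le (by linarith)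
            have h4 : 0 ≤ C * ((√(Real.log t))⁻¹ * t ^ (-s)) := by positivity
            linarith
          · rw [Set.indicator_of_notMem (fun h : t ∈ Set.Ioc 1 x₀ ↦ absurd h.2 (by linarith)),
              zero_add, ← hsplit]
            calc _ ≤ (C * (t / √(Real.log t))) * t ^ (-(s + 1)) :=
                  mul_le_mul_of_nonneg_right (h t htx.le) hr.le
              _ = _ := by ring
    _ = (∫ t in Set.Ioi (1 : ℝ), Set.indicator (Set.Ioc 1 x₀) (fun _ ↦ (1 : ℝ)) t) +
          C * (√Real.pi / √(s - 1)) := by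
        rw [MeasureTheory.integral_add hint1 (hintg.const_mul C), MeasureTheory.integral_const_mul,
          integral_sqrt_log_mul_rpow hs]
    _ ≤ _ := by gcongr

/-- The Abelian comparison of the counting function with the Dirichlet series. -/
lemma le_mul_sqrt_pi {a : ℕ → ℝ} (h0 : ∀ n, 0 ≤ a n) (h1 : ∀ n, a n ≤ 1) {C c : ℝ}
    (hC : Tendsto (fun x : ℝ ↦ (∑ k ∈ Finset.Icc 1 ⌊x⌋₊, a k) * √(Real.log x) / x)
      atTop (nhds C))
    (hc : ∀ c' < c, ∀ᶠ s in nhdsWithin (1 : ℝ) (Set.Ioi 1), c' ≤ √(s - 1) * dSer a s) :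
    c ≤ C * √Real.pi := by
  have hC0 : 0 ≤ C := by
    refine ge_of_tendsto hC ?_
    filter_upwards [eventually_ge_atTop 0] with x hx
    exact div_nonneg (mul_nonneg (Finset.sum_nonneg fun k _ ↦ h0 k) (Real.sqrt_nonneg _)) hx
  have hstep : ∀ C₁ > C, c ≤ C₁ * √Real.pi := by
    intro C₁ hC₁
    obtain ⟨x₁, hx₁⟩ := eventually_atTop.1 (hC.eventually_lt_const hC₁)
    have hle : ∀ x, max x₁ 2 ≤ x →
        ∑ k ∈ Finset.Icc 1 ⌊x⌋₊, a k ≤ C₁ * (x / √(Real.log x)) := by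
      intro x hx
      have h2 : 2 ≤ x := (le_max_right _ _).trans hx
      have h3 : 0 < √(Real.log x) := Real.sqrt_pos.2 (Real.log_pos (by linarith))
      have h4 := (hx₁ x ((le_max_left _ _).trans hx)).le
      rw [div_le_iff₀ (by linarith)] at h4
      rw [← mul_div_assoc, le_div_iff₀ h3]
      exact h4
    refine le_of_forall_lt_imp_le_of_dense fun c' hc' ↦ ?_
    have t1 : Tendsto (fun s : ℝ ↦ s * (√(s - 1) * max x₁ 2 + C₁ * √Real.pi))
        (nhdsWithin 1 (Set.Ioi 1)) (nhds (C₁ * √Real.pi)) := by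
      have : ContinuousAt (fun s : ℝ ↦ s * (√(s - 1) * max x₁ 2 + C₁ * √Real.pi)) 1 := by fun_prop
      simpa using this.tendsto.mono_left (nhdsWithin_le_nhds (s := Set.Ioi 1))
    refine ge_of_tendsto t1 ?_
    filter_upwards [hc c' hc', self_mem_nhdsWithin] with s h2 (hs : 1 < s)
    have h3 := dSer_le_of_eventually_le h0 h1 (hC0.trans hC₁.le)
      (one_le_two.trans (le_max_right x₁ 2)) hle hs
    have h4 : 0 < √(s - 1) := Real.sqrt_pos.2 (by linarith)
    calc c' ≤ _ := h2
      _ ≤ √(s - 1) * (s * (max x₁ 2 + C₁ * (√Real.pi / √(s - 1)))) :=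
          mul_le_mul_of_nonneg_left h3 h4.le
      _ = _ := by field_simp
  refine le_of_forall_gt_imp_ge_of_dense fun y hy ↦ ?_
  have hπ : 0 < √Real.pi := Real.sqrt_pos.2 Real.pi_pos
  have := hstep (y / √Real.pi) ((lt_div_iff₀ hπ).2 hy)
  rwa [div_mul_cancel₀ _ hπ.ne'] at this

open QF

lemma repInd_eq_one {f : QF} {P : Finset ℕ} {n : ℕ} (h0 : 0 < n) (h1 : ∀ p ∈ P, ¬ p ∣ n)
    (h2 : ∃ u v, f.eval u v = n) : repInd f P n = 1 :=
  if_pos ⟨h0, h1, h2⟩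

lemma repInd_eq_zero_or {f : QF} {P : Finset ℕ} {n : ℕ} :
    repInd f P n = 0 ∨ (0 < n ∧ (∀ p ∈ P, ¬ p ∣ n) ∧ ∃ u v, f.eval u v = n) := by
  unfold repInd
  split_ifs with h
  · exact Or.inr h
  · exact Or.inl rfl

/-- Splitting off the multiples of `m` in the set of represented integers. -/
lemma dSer_add_le {f f₁ : QF} {P : Finset ℕ} (hP : ∀ q ∈ P, q.Prime) {p m : ℕ} (hp : p ∈ P)
    (hm : 0 < m) (hpm : p ∣ m) (hmp : ∀ q : ℕ, q.Prime → q ∣ m → q = p)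
    (h : ∀ u v, ∃ u' v', f.eval u' v' = m * f₁.eval u v) {s : ℝ} (hs : 1 < s) :
    dSer (repInd f P) s + (m : ℝ) ^ (-s) * dSer (repInd f₁ (P.erase p)) s ≤
      dSer (repInd f (P.erase p)) s := by
  have s1 := summable_of_abs_le_one (abs_repInd_le_one f P) hs
  have s2 := summable_of_abs_le_one (abs_repInd_le_one f₁ (P.erase p)) hs
  have s3 := summable_of_abs_le_one (abs_repInd_le_one f (P.erase p)) hs
  have hinj : Function.Injective fun k : ℕ ↦ m * k := fun a b hab ↦
    Nat.eq_of_mul_eq_mul_left hm hab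
  set F : ℕ → ℝ := fun n ↦ repInd f (P.erase p) n * (n : ℝ) ^ (-s) -
    repInd f P n * (n : ℝ) ^ (-s) with hF
  have sF : Summable F := s3.sub s1
  have hF0 : ∀ n, 0 ≤ F n := fun n ↦ by
    have hn : (0 : ℝ) ≤ (n : ℝ) ^ (-s) := by positivity
    rw [hF, sub_nonneg]
    refine mul_le_mul_of_nonneg_right ?_ hn
    rcases repInd_eq_zero_or (f := f) (P := P) (n := n) with h0 | ⟨h1, h2, h3⟩
    · rw [h0]; exact repInd_nonneg _ _ _
    · rw [repInd_eq_one h1 (fun q hq ↦ h2 q (Finset.mem_of_mem_erase hq)) h3]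
      exact (le_abs_self _).trans (abs_repInd_le_one _ _ _)
  have hFm : ∀ k, (m : ℝ) ^ (-s) * (repInd f₁ (P.erase p) k * (k : ℝ) ^ (-s)) ≤ F (m * k) := by
    intro k
    have hk : ((m * k : ℕ) : ℝ) ^ (-s) = (m : ℝ) ^ (-s) * (k : ℝ) ^ (-s) := by
      rw [Nat.cast_mul, Real.mul_rpow (by positivity) (by positivity)]
    rcases repInd_eq_zero_or (f := f₁) (P := P.erase p) (n := k) with h0 | ⟨h1, h2, u, v, h3⟩
    · rw [h0, zero_mul, mul_zero]; exact hF0 _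
    · have e1 : repInd f₁ (P.erase p) k = 1 := repInd_eq_one h1 h2 ⟨u, v, h3⟩
      have e2 : repInd f P (m * k) = 0 := by
        unfold repInd
        rw [if_neg]
        rintro ⟨-, h4, -⟩
        exact h4 p hp (hpm.mul_right k)
      have e3 : repInd f (P.erase p) (m * k) = 1 := by
        refine repInd_eq_one (Nat.mul_pos hm h1) (fun q hq hd ↦ ?_) ?_
        · have hqp := hP q (Finset.mem_of_mem_erase hq)
          rcases hqp.dvd_mul.1 hd with h5 | h5
          · exact Finset.ne_of_mem_erase hq (hmp q hqp h5)
          · exact h2 q hq h5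
        · obtain ⟨u', v', h'⟩ := h u v
          exact ⟨u', v', by rw [h', h3]; push_cast; rfl⟩
      simp only [hF]
      rw [e1, e2, e3, hk]
      linarith
  have key : (m : ℝ) ^ (-s) * dSer (repInd f₁ (P.erase p)) s ≤ ∑' n, F n := by
    unfold dSer
    rw [← tsum_mul_left]
    exact ((s2.mul_left _).tsum_le_tsum hFm (sF.comp_injective hinj)).trans
      (tsum_comp_le_tsum_of_inj sF hF0 hinj)
  have : ∑' n, F n = dSer (repInd f (P.erase p)) s - dSer (repInd f P) s := s3.tsum_sub s1
  linarith

lemma lowerBd_zero (P : Finset ℕ) : LowerBd D P 0 := fun f _ _ hc' ↦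
  Eventually.of_forall fun s ↦ hc'.le.trans
    (mul_nonneg (Real.sqrt_nonneg _) (dSer_nonneg (repInd_nonneg f P) s))

lemma lowerBd_of_forall_lt {P : Finset ℕ} {c : ℝ} (h : ∀ d < c, ∃ e, d < e ∧ LowerBd D P e) :
    LowerBd D P c := fun f hf c' hc' ↦ by
  obtain ⟨e, he, h'⟩ := h c' hc'
  exact h' f hf c' he

lemma LowerBd.add {D D' : ℤ} {P : Finset ℕ} (hP : ∀ q ∈ P, q.Prime) {p m : ℕ} (hp : p ∈ P)
    (hm : 0 < m) (hpm : p ∣ m) (hmp : ∀ q : ℕ, q.Prime → q ∣ m → q = p)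
    (h : ∀ f : QF, f.Good D → ∃ f₁ : QF, f₁.Good D' ∧
      ∀ u v, ∃ u' v', f.eval u' v' = m * f₁.eval u v) {c d : ℝ} (hc : LowerBd D P c)
    (hd : LowerBd D' (P.erase p) d) : LowerBd D (P.erase p) (c + d / m) := by
  intro f hf c' hc'
  obtain ⟨f₁, hf₁, hff⟩ := h f hf
  have hm0 : (0 : ℝ) < m := by exact_mod_cast hm
  obtain ⟨δ, hδ, hlt⟩ : ∃ δ > 0, c' < (c - δ) + (m : ℝ) ^ (-1 : ℝ) * (d - δ) := by
    have hmi : (m : ℝ) ^ (-1 : ℝ) = (m : ℝ)⁻¹ := Real.rpow_neg_one _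
    have hmi0 : 0 < (m : ℝ)⁻¹ := by positivity
    refine ⟨(c + d / m - c') / (2 * (1 + (m : ℝ)⁻¹)), by
      have : 0 < c + d / m - c' := by linarith
      positivity, ?_⟩
    rw [hmi]
    have : (c + d / m - c') / (2 * (1 + (m : ℝ)⁻¹)) * (1 + (m : ℝ)⁻¹) = (c + d / m - c') / 2 := by
      field_simp
    rw [div_eq_mul_inv d] at *
    linarith
  have hcont : Tendsto (fun s : ℝ ↦ (c - δ) + (m : ℝ) ^ (-s) * (d - δ))
      (nhdsWithin 1 (Set.Ioi 1)) (nhds ((c - δ) + (m : ℝ) ^ (-1 : ℝ) * (d - δ))) := by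
    refine Tendsto.mono_left ?_ nhdsWithin_le_nhds
    refine (tendsto_const_nhds).add (Tendsto.mul_const _ ?_)
    exact ((Real.continuous_const_rpow hm0.ne').comp continuous_neg).tendsto 1
  filter_upwards [hc f hf (c - δ) (by linarith), hd f₁ hf₁ (d - δ) (by linarith),
    hcont.eventually (lt_mem_nhds hlt), self_mem_nhdsWithin] with s h1 h2 h3 hs
  have h4 := mul_le_mul_of_nonneg_left (dSer_add_le hP hp hm hpm hmp hff hs)
    (Real.sqrt_nonneg (s - 1))
  have h5 := mul_le_mul_of_nonneg_left h2 (show 0 ≤ (m : ℝ) ^ (-s) by positivity)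
  linarith

lemma LowerBd.iterate {P : Finset ℕ} {c r : ℝ} (hr0 : 0 ≤ r) (hr1 : r < 1)
    (h : ∀ d, LowerBd D P d → LowerBd D P (c + d * r)) : LowerBd D P (c / (1 - r)) := by
  have hn : ∀ n : ℕ, LowerBd D P (c * ∑ i ∈ Finset.range n, r ^ i) := by
    intro n
    induction n with
    | zero => simpa using lowerBd_zero P
    | succ n ih =>
      have := h _ ih
      rw [Finset.sum_range_succ']
      simp_rw [pow_succ]
      rw [← Finset.sum_mul]
      convert this using 1
      ring
  refine lowerBd_of_forall_lt fun d hd ↦ ?_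
  have ht : Tendsto (fun n : ℕ ↦ c * ∑ i ∈ Finset.range n, r ^ i) atTop (nhds (c / (1 - r))) := by
    rw [div_eq_mul_inv]
    exact (hasSum_geometric_of_lt_one hr0 hr1).tendsto_sum_nat.const_mul c
  obtain ⟨n, hn'⟩ := (ht.eventually (lt_mem_nhds hd)).exists
  exact ⟨_, hn', hn n⟩

lemma LowerBd.div {P : Finset ℕ} (hP : ∀ q ∈ P, q.Prime) {p : ℕ} (hp : p ∈ P)
    (h : ∀ f : QF, f.Good D → ∃ f₁ : QF, f₁.Good D ∧
      ∀ u v, ∃ u' v', f.eval u' v' = p * f₁.eval u v) {c : ℝ} (hc : LowerBd D P c) :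
    LowerBd D (P.erase p) (c / (1 - (p : ℝ)⁻¹)) := by
  have hpp := hP p hp
  refine LowerBd.iterate (by positivity) (inv_lt_one_of_one_lt₀ (by exact_mod_cast hpp.one_lt))
    fun d hd ↦ ?_
  rw [← div_eq_mul_inv]
  exact hc.add hP hp hpp.pos dvd_rfl (fun q hq hqp ↦ (Nat.prime_dvd_prime_iff_eq hq hpp).1 hqp) h hd

/-- Every value of `g` is a value of `f`. -/
def QF.Covers (f g : QF) : Prop := ∀ u v, ∃ u' v', f.eval u' v' = g.eval u v

lemma QF.covers_act (f : QF) (p q r s : ℤ) : f.Covers (f.act p q r s) := fun u v ↦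
  ⟨_, _, (f.eval_act p q r s u v).symm⟩

lemma QF.Covers.trans {f g h : QF} (h1 : f.Covers g) (h2 : g.Covers h) : f.Covers h := fun u v ↦ by
  obtain ⟨x, y, hxy⟩ := h2 u v
  obtain ⟨x', y', h'⟩ := h1 x y
  exact ⟨x', y', h'.trans hxy⟩

lemma LowerBd.of_covers {D' : ℤ} {P : Finset ℕ} {c : ℝ}
    (h : ∀ f : QF, f.Good D' → ∃ g : QF, g.Good D ∧ f.Covers g) (hc : LowerBd D P c) :
    LowerBd D' P c := fun f hf c' hc' ↦ by
  obtain ⟨g, hg, hfg⟩ := h f hf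
  filter_upwards [hc g hg c' hc', self_mem_nhdsWithin] with s h1 hs
  refine h1.trans (mul_le_mul_of_nonneg_left ?_ (Real.sqrt_nonneg _))
  refine (summable_of_abs_le_one (abs_repInd_le_one g P) hs).tsum_le_tsum (fun n ↦ ?_)
    (summable_of_abs_le_one (abs_repInd_le_one f P) hs)
  refine mul_le_mul_of_nonneg_right ?_ (by positivity)
  rcases repInd_eq_zero_or (f := g) (P := P) (n := n) with h0 | ⟨h2, h3, u, v, h4⟩
  · rw [h0]; exact repInd_nonneg _ _ _
  · obtain ⟨u', v', h'⟩ := hfg u v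
    rw [repInd_eq_one (f := f) h2 h3 ⟨u', v', h'.trans h4⟩]
    exact (le_abs_self _).trans (abs_repInd_le_one _ _ _)

lemma QF.Good.exists_not_dvd {f : QF} (hf : f.Good D) (hD : D < 0) {p : ℕ} (hp : p.Prime) :
    ∃ g : QF, g.Good D ∧ f.Covers g ∧ ¬ (p : ℤ) ∣ g.a := by
  obtain ⟨x, y, hxy, hco⟩ := hf.exists_coprime (N := p) (by exact_mod_cast hp.ne_zero)
  obtain ⟨u, v, huv⟩ := hxy
  have hdet : x * u - (-v) * y = 1 := by linarith
  refine ⟨f.act x (-v) y u, hf.act hD hdet, f.covers_act _ _ _ _, fun h ↦ ?_⟩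
  exact (Nat.prime_iff_prime_int.1 hp).not_isUnit (IsCoprime.isUnit_of_dvd' hco h dvd_rfl)

lemma QF.Good.shift {f : QF} (hf : f.Good D) (hD : D < 0) (k : ℤ) :
    (⟨f.a, f.b + 2 * f.a * k, f.eval k 1⟩ : QF).Good D ∧
      f.Covers ⟨f.a, f.b + 2 * f.a * k, f.eval k 1⟩ := by
  rw [← act_shift]
  exact ⟨hf.act hD (by ring), f.covers_act _ _ _ _⟩

lemma QF.Good.exists_dvd {f : QF} (hf : f.Good D) (hD : D < 0) {p : ℕ} (hp : p.Prime)
    (hp2 : p ≠ 2) :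
    ∃ g : QF, g.Good D ∧ f.Covers g ∧ ¬ (p : ℤ) ∣ g.a ∧ (p : ℤ) ∣ g.b := by
  obtain ⟨g, hg, hfg, ha⟩ := hf.exists_not_dvd hD hp
  have hpi := Nat.prime_iff_prime_int.1 hp
  have h2 : ¬ (p : ℤ) ∣ 2 := fun h ↦ by
    rw [show (2 : ℤ) = (2 : ℕ) by rfl, Int.natCast_dvd_natCast] at h
    exact hp2 ((Nat.prime_dvd_prime_iff_eq hp Nat.prime_two).1 h)
  have hco : IsCoprime (p : ℤ) (2 * g.a) :=
    (hpi.irreducible.coprime_iff_not_dvd).2 fun h ↦ (hpi.dvd_or_dvd h).elim h2 ha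
  obtain ⟨u, v, huv⟩ := hco
  obtain ⟨h3, h4⟩ := hg.shift hD (-v * g.b)
  refine ⟨_, h3, hfg.trans h4, ha, ⟨u * g.b, ?_⟩⟩
  linear_combination (-g.b) * huv

lemma QF.Good.exists_even {m : ℤ} {f : QF} (hf : f.Good (4 * m)) (hm : m < 0) :
    ∃ g : QF, g.Good (4 * m) ∧ f.Covers g ∧ ¬ 2 ∣ g.a ∧ ∃ β, g.b = 2 * β ∧ 2 ∣ β - m := by
  obtain ⟨g, hg, hfg, ha⟩ := hf.exists_not_dvd (by linarith) Nat.prime_two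
  have hb : 2 ∣ g.b := by
    have := hg.disc_eq
    unfold disc at this
    refine Int.prime_two.dvd_of_dvd_pow (n := 2) ⟨2 * m + 2 * g.a * g.c, by linarith⟩
  obtain ⟨β, hβ⟩ := hb
  obtain ⟨h3, h4⟩ := hg.shift (by linarith) (β - m)
  refine ⟨_, h3, hfg.trans h4, ha, β + g.a * (β - m), ?_, ?_⟩
  · dsimp only
    rw [hβ]; ring
  · have ha' : ¬ 2 ∣ g.a := ha
    obtain ⟨k, hk⟩ : 2 ∣ g.a + 1 := by omega
    exact ⟨k * (β - m), by linear_combination (β - m) * hk⟩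

/-- The case where the form represents `p` times the values of a form of the same discriminant. -/
lemma exists_mul_eval_of_dvd {f : QF} {p : ℤ} (hf : f.Good D) (hp : Prime p) (hp0 : 0 < p)
    (hc : p ∣ f.c) (hc2 : ¬ p ^ 2 ∣ f.c) :
    ∃ f₁ : QF, f₁.Good D ∧ ∀ u v, ∃ u' v', f.eval u' v' = p * f₁.eval u v := by
  obtain ⟨γ, hγ⟩ := hc
  refine ⟨⟨p * f.a, f.b, γ⟩, ⟨mul_pos hp0 hf.pos, ?_, ?_⟩, fun u v ↦ ⟨p * u, v, ?_⟩⟩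
  · rw [← hf.disc_eq]; unfold disc; rw [hγ]; ring
  · intro d h1 h2 h3
    refine isUnit_of_forall_prime fun q hq hqd ↦ ?_
    have hqi := Nat.prime_iff_prime_int.1 hq
    rcases hqi.dvd_or_dvd (hqd.trans h1) with h4 | h4
    · have h5 : p ∣ γ := ((hqi.associated_of_dvd hp h4).dvd_iff_dvd_left).1 (hqd.trans h3)
      exact hc2 (by rw [hγ, sq]; exact mul_dvd_mul_left p h5)
    · exact hf.not_all_dvd hq h4 (hqd.trans h2) (hγ ▸ (hqd.trans h3).mul_left p)
  · unfold eval
    dsimp only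
    rw [hγ]; ring

/-- The case where the form represents `p ^ 2` times the values of a form of discriminant
`D / p ^ 2`. -/
lemma exists_sq_mul_eval_of_dvd {f : QF} {p D' : ℤ} (hf : f.Good (p ^ 2 * D')) (hp : p ≠ 0)
    (hb : p ∣ f.b) (hc : p ^ 2 ∣ f.c) :
    ∃ f₁ : QF, f₁.Good D' ∧ ∀ u v, ∃ u' v', f.eval u' v' = p ^ 2 * f₁.eval u v := by
  obtain ⟨γ, hγ⟩ := hc
  obtain ⟨β, hβ⟩ := hb
  refine ⟨⟨f.a, β, γ⟩, ⟨hf.pos, ?_, ?_⟩, fun u v ↦ ⟨p * u, v, ?_⟩⟩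
  · have := hf.disc_eq
    unfold disc at this ⊢
    rw [hγ, hβ] at this
    refine mul_left_cancel₀ (pow_ne_zero 2 hp) (Eq.trans ?_ this)
    ring
  · intro d h1 h2 h3
    exact hf.prim d h1 (hβ ▸ h2.mul_left p) (hγ ▸ h3.mul_left _)
  · unfold eval
    dsimp only
    rw [hγ, hβ]; ring

lemma QF.Good.exists_sq_mul {D' : ℤ} (hD' : D' < 0) {f : QF} (hf : f.Good D') {p : ℕ}
    (hp : p.Prime) : ∃ g : QF, g.Good ((p : ℤ) ^ 2 * D') ∧ f.Covers g := by
  obtain ⟨g, hg, hfg, ha⟩ := hf.exists_not_dvd hD' hp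
  have hpi := Nat.prime_iff_prime_int.1 hp
  refine ⟨⟨g.a, g.b * p, g.c * p ^ 2⟩, ⟨hg.pos, ?_, ?_⟩, hfg.trans fun u v ↦ ⟨u, p * v, ?_⟩⟩
  · rw [← hg.disc_eq]; unfold disc; ring
  · intro d h1 h2 h3
    have hco : IsCoprime d p := by
      rw [isCoprime_comm]
      exact hpi.irreducible.coprime_iff_not_dvd.2 fun h ↦ ha (h.trans h1)
    exact hg.prim d h1 (hco.dvd_of_dvd_mul_right h2) ((hco.pow_right).dvd_of_dvd_mul_right h3)
  · unfold eval
    ring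

lemma QF.Good.sq_dvd_of_dvd {f : QF} {p D' : ℤ} (hf : f.Good (p ^ 2 * D')) (hp : Prime p)
    (hp2 : ¬ p ∣ 2) (ha : ¬ p ∣ f.a) (hb : p ∣ f.b) : p ^ 2 ∣ f.c := by
  have := hf.disc_eq
  unfold disc at this
  obtain ⟨β, hβ⟩ := hb
  rw [hβ] at this
  have h1 : p ^ 2 ∣ 4 * f.a * f.c := ⟨β ^ 2 - D', by linear_combination -this⟩
  have hco : IsCoprime p (4 * f.a) := hp.irreducible.coprime_iff_not_dvd.2 fun h ↦ by
    rcases hp.dvd_or_dvd h with h | h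
    · exact hp2 (hp.dvd_of_dvd_pow (n := 2) (by norm_num; exact h))
    · exact ha h
  exact (hco.pow_left).dvd_of_dvd_mul_left h1

lemma QF.Good.dvd_of_dvd {f : QF} {p : ℤ} (hf : f.Good D) (hp : Prime p)
    (hp2 : ¬ p ∣ 2) (hpD : p ∣ D) (ha : ¬ p ∣ f.a) (hb : p ∣ f.b) : p ∣ f.c := by
  have := hf.disc_eq
  unfold disc at this
  have h1 : p ∣ 4 * f.a * f.c := by
    have : 4 * f.a * f.c = f.b * f.b - D := by rw [← this]; ring
    rw [this]
    exact dvd_sub (hb.mul_right _) hpD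
  have hco : IsCoprime p (4 * f.a) := hp.irreducible.coprime_iff_not_dvd.2 fun h ↦ by
    rcases hp.dvd_or_dvd h with h | h
    · exact hp2 (hp.dvd_of_dvd_pow (n := 2) (by norm_num; exact h))
    · exact ha h
  exact hco.dvd_of_dvd_mul_left h1

lemma not_dvd_two {p : ℕ} (hp : p.Prime) (hp2 : p ≠ 2) : ¬ (p : ℤ) ∣ 2 := fun h ↦ by
  rw [show (2 : ℤ) = (2 : ℕ) by rfl, Int.natCast_dvd_natCast] at h
  exact hp2 ((Nat.prime_dvd_prime_iff_eq hp Nat.prime_two).1 h)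

section

variable {P : Finset ℕ} (hP : ∀ q ∈ P, q.Prime) {c : ℝ} (hc : LowerBd D P c)
include hP hc

lemma LowerBd.erase_odd (hD : D < 0) {p : ℕ} (hp : p ∈ P) (hp2 : p ≠ 2) (hpD : (p : ℤ) ∣ D)
    (hpD2 : ¬ (p : ℤ) ^ 2 ∣ D) : LowerBd D (P.erase p) (c / (1 - (p : ℝ)⁻¹)) := by
  refine hc.div hP hp fun f hf ↦ ?_
  have hpp := hP p hp
  have hpi := Nat.prime_iff_prime_int.1 hpp
  obtain ⟨g, hg, hfg, ha, hb⟩ := hf.exists_dvd hD hpp hp2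
  obtain ⟨f₁, h1, h2⟩ := exists_mul_eval_of_dvd hg hpi (by exact_mod_cast hpp.pos)
    (hg.dvd_of_dvd hpi (not_dvd_two hpp hp2) hpD ha hb) fun h ↦ hpD2 (by
      rw [← hg.disc_eq]
      unfold disc
      exact dvd_sub (pow_dvd_pow_of_dvd hb 2) (h.mul_left _))
  refine ⟨f₁, h1, fun u v ↦ ?_⟩
  obtain ⟨x, y, hxy⟩ := h2 u v
  obtain ⟨x', y', h'⟩ := hfg x y
  exact ⟨x', y', h'.trans hxy⟩

omit hP hc in
lemma QF.Good.exists_sq {D' : ℤ} {f : QF} {p : ℕ} (hp : p.Prime) (hD' : D' < 0)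
    (h2 : p = 2 → D' % 4 = 0 ∨ D' % 4 = 1) (hf : f.Good ((p : ℤ) ^ 2 * D')) :
    ∃ f₁ : QF, f₁.Good D' ∧ ∀ u v, ∃ u' v', f.eval u' v' = (p ^ 2 : ℕ) * f₁.eval u v := by
  have hpi := Nat.prime_iff_prime_int.1 hp
  have hD : (p : ℤ) ^ 2 * D' < 0 := mul_neg_of_pos_of_neg (by
    have : (0 : ℤ) < p := by exact_mod_cast hp.pos
    positivity) hD'
  obtain ⟨g, hg, hfg, hb, hc⟩ : ∃ g : QF, g.Good ((p : ℤ) ^ 2 * D') ∧ f.Covers g ∧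
      (p : ℤ) ∣ g.b ∧ (p : ℤ) ^ 2 ∣ g.c := by
    by_cases hp2 : p = 2
    · subst hp2
      have h4 : ((2 : ℕ) : ℤ) ^ 2 * D' = 4 * D' := by norm_num
      rw [h4] at hf ⊢
      obtain ⟨g, hg, hfg, ha, β, hβ, h3⟩ := hf.exists_even hD'
      refine ⟨g, hg, hfg, ⟨β, hβ⟩, ?_⟩
      have hd := hg.disc_eq
      unfold disc at hd
      rw [hβ] at hd
      have h5 : g.a * g.c = β ^ 2 - D' := by linarith
      have h6 : (4 : ℤ) ∣ β ^ 2 - D' := by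
        rcases h2 rfl with h | h
        · obtain ⟨k, hk⟩ : 2 ∣ β := by omega
          obtain ⟨l, hl⟩ : 4 ∣ D' := by omega
          exact ⟨k ^ 2 - l, by rw [hk, hl]; ring⟩
        · obtain ⟨k, hk⟩ : 2 ∣ β - 1 := by omega
          obtain ⟨l, hl⟩ : 4 ∣ D' - 1 := by omega
          exact ⟨k ^ 2 + k - l, by
            rw [show β = 2 * k + 1 by linarith, show D' = 4 * l + 1 by linarith]; ring⟩
      have hco : IsCoprime (2 : ℤ) g.a := Int.prime_two.irreducible.coprime_iff_not_dvd.2 ha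
      refine (hco.pow_left (m := 2)).dvd_of_dvd_mul_left ?_
      rw [h5]
      exact h6
    · obtain ⟨g, hg, hfg, ha, hb⟩ := hf.exists_dvd hD hp hp2
      exact ⟨g, hg, hfg, hb, hg.sq_dvd_of_dvd hpi (not_dvd_two hp hp2) ha hb⟩
  obtain ⟨f₁, h3, h4⟩ := exists_sq_mul_eval_of_dvd hg hpi.ne_zero hb hc
  refine ⟨f₁, h3, fun u v ↦ ?_⟩
  obtain ⟨x, y, hxy⟩ := h4 u v
  obtain ⟨x', y', h'⟩ := hfg x y
  exact ⟨x', y', h'.trans (hxy.trans (by push_cast; rfl))⟩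

lemma LowerBd.erase_two {m : ℤ} (hm : m < 0) (hD : D = 4 * m) (h2 : 2 ∈ P)
    (h4 : m % 4 = 2 ∨ m % 4 = 3) : LowerBd D (P.erase 2) (2 * c) := by
  subst hD
  have : LowerBd (4 * m) (P.erase 2) (c / (1 - ((2 : ℕ) : ℝ)⁻¹)) := by
    refine hc.div hP h2 fun f hf ↦ ?_
    obtain ⟨g, hg, hfg, ha, β, hβ, h3⟩ := hf.exists_even hm
    have hd := hg.disc_eq
    unfold disc at hd
    rw [hβ] at hd
    have h5 : g.a * g.c = β ^ 2 - m := by linarith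
    have h6 : (β ^ 2 - m) % 4 = 2 := by
      rcases h4 with h | h
      · obtain ⟨k, hk⟩ : 2 ∣ β := by omega
        have : β ^ 2 = 4 * k ^ 2 := by rw [hk]; ring
        omega
      · obtain ⟨k, hk⟩ : 2 ∣ β - 1 := by omega
        have : β ^ 2 = 4 * (k ^ 2 + k) + 1 := by rw [show β = 2 * k + 1 by linarith]; ring
        omega
    have hc2 : (2 : ℤ) ∣ g.c := by
      refine (Int.prime_two.dvd_or_dvd (a := g.a) ?_).resolve_left ha
      rw [h5]
      omega
    have hc4 : ¬ (2 : ℤ) ^ 2 ∣ g.c := fun h ↦ by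
      have : (2 : ℤ) ^ 2 ∣ β ^ 2 - m := h5 ▸ h.mul_left _
      omega
    obtain ⟨f₁, h7, h8⟩ := exists_mul_eval_of_dvd hg Int.prime_two two_pos hc2 hc4
    refine ⟨f₁, h7, fun u v ↦ ?_⟩
    obtain ⟨x, y, hxy⟩ := h8 u v
    obtain ⟨x', y', h'⟩ := hfg x y
    exact ⟨x', y', h'.trans hxy⟩
  convert this using 1
  push_cast
  ring

lemma LowerBd.add_sq {D' : ℤ} (hD' : D' < 0) {p : ℕ} (hp : p ∈ P)
    (hD : D = (p : ℤ) ^ 2 * D') (h2 : p = 2 → D' % 4 = 0 ∨ D' % 4 = 1) {d : ℝ}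
    (hd : LowerBd D' (P.erase p) d) : LowerBd D (P.erase p) (c + d / (p : ℝ) ^ 2) := by
  subst hD
  have hpp := hP p hp
  have := hc.add hP hp (pow_pos hpp.pos 2) (dvd_pow_self p two_ne_zero)
    (fun q hq hqp ↦ (Nat.prime_dvd_prime_iff_eq hq hpp).1 (hq.dvd_of_dvd_pow hqp))
    (fun f hf ↦ hf.exists_sq hpp hD' h2) hd
  push_cast at this
  exact this

lemma LowerBd.erase_sq {D' : ℤ} (hD' : D' < 0) {p : ℕ} (hp : p ∈ P)
    (hD : D = (p : ℤ) ^ 2 * D') (h2 : p = 2 → D' % 4 = 0 ∨ D' % 4 = 1) :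
    LowerBd D (P.erase p) (c / (1 - ((p : ℝ) ^ 2)⁻¹)) := by
  have hpp := hP p hp
  refine LowerBd.iterate (by positivity)
    (inv_lt_one_of_one_lt₀ (one_lt_pow₀ (by exact_mod_cast hpp.one_lt) two_ne_zero))
    fun d hd ↦ ?_
  rw [← div_eq_mul_inv]
  refine hc.add_sq hP hD' hp hD h2 (hd.of_covers fun f hf ↦ ?_)
  rw [hD]
  exact hf.exists_sq_mul hD' hpp

end

lemma QF.Good.cls_act {f : QF} (hf : f.Good D) (hD : D < 0) {p q r s : ℤ}
    (h : p * s - q * r = 1) : cls D (f.act p q r s) = cls D f :=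
  (cls_eq_iff hD (hf.act hD h) hf).2 ⟨p, q, r, s, h, rfl⟩

/-- The minimum of a reduced form with distinct coefficients is attained only at `±(1, 0)`. -/
lemma QF.Good.eq_zero_of_eval_eq {f : QF} (hf : f.Good D) (hb : |f.b| < f.a) (hc : f.a < f.c)
    {x y : ℤ} (h : f.eval x y = f.a) : y = 0 := by
  have h4 := f.four_a_eval x y
  have ha := hf.pos
  have hb2 : f.b ^ 2 < f.a ^ 2 := by
    rw [← sq_abs f.b]
    exact pow_lt_pow_left₀ hb (abs_nonneg _) two_ne_zero
  have hy : y ^ 2 < 2 ^ 2 := by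
    rw [h] at h4
    unfold disc at h4
    by_contra hy
    push Not at hy
    nlinarith [sq_nonneg (2 * f.a * x + f.b * y), mul_lt_mul_of_pos_left hc ha,
      mul_le_mul_of_nonneg_left hy (show 0 ≤ 4 * f.a * f.c - f.b ^ 2 by nlinarith)]
  have hy1 := abs_lt_of_sq_lt_sq' hy (by norm_num)
  by_contra hy0
  obtain ⟨h1, h2⟩ := abs_lt.1 hb
  have h3 : y = 1 ∨ y = -1 := by omega
  unfold eval at h
  rcases lt_trichotomy x 0 with hx | hx | hx
  · rcases h3 with rfl | rfl <;>
      nlinarith [mul_nonneg (show 0 ≤ -x by linarith) (show 0 ≤ f.a * (-x) - f.a by nlinarith)]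
  · subst hx
    rcases h3 with rfl | rfl <;> linarith
  · rcases h3 with rfl | rfl <;>
      nlinarith [mul_nonneg (show 0 ≤ x by linarith) (show 0 ≤ f.a * x - f.a by nlinarith)]

/-- A class of order dividing two contains an ambiguous form. -/
lemma NegDisc.exists_ambiguous (h : NegDisc D) {A : Cl D} (hA : A ^ 2 = 1) :
    ∃ f : QF, f.Good D ∧ cls D f = A ∧ (f.b = 0 ∨ f.a = f.c) := by
  obtain ⟨f₀, hf₀, rfl⟩ := h.exists_cls_eq A
  obtain ⟨f, hf, h1, h2, h3⟩ := QF.Good.exists_reduced h.neg _ hf₀ le_rfl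
  have hcls : cls D f = cls D f₀ := cls_ext ((cls_val hf).trans (h1.trans (cls_val hf₀).symm))
  rw [← hcls] at hA ⊢
  rcases h3.eq_or_lt with h3 | h3
  · exact ⟨f, hf, rfl, Or.inr h3⟩
  rcases h2.eq_or_lt with h2 | h2
  · rcases abs_eq hf.pos.le |>.1 h2 with hb | hb
    · have hdet : (0 : ℤ) * 1 - (-1) * 1 = 1 := by norm_num
      refine ⟨_, hf.act h.neg hdet, hf.cls_act h.neg hdet, Or.inr ?_⟩
      simp only [QF.act, eval]
      rw [hb]; ring
    · have hdet : (0 : ℤ) * (-1) - (-1) * 1 = 1 := by norm_num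
      refine ⟨_, hf.act h.neg hdet, hf.cls_act h.neg hdet, Or.inr ?_⟩
      simp only [QF.act, eval]
      rw [hb]; ring
  · refine ⟨f, hf, rfl, Or.inl ?_⟩
    have hcc : cls D f.conj = cls D f := by
      rw [cls_conj hf, inv_eq_iff_mul_eq_one, ← sq, hA]
    obtain ⟨p, q, r, s, hdet, he⟩ := (cls_eq_iff h.neg hf.conj hf).1 hcc
    have e1 : f.a = f.eval p r := congrArg QF.a he
    have e2 : -f.b = 2 * f.a * p * q + f.b * (p * s + q * r) + 2 * f.c * r * s :=
      congrArg QF.b he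
    have hr := hf.eq_zero_of_eval_eq h2 h3 e1.symm
    subst hr
    have e3 : f.b = -(f.a * (p * q)) := by
      have : p * s = 1 := by linarith
      rw [mul_zero, add_zero, this] at e2
      linarith
    have : f.a ∣ f.b := ⟨-(p * q), by rw [e3]; ring⟩
    exact Int.eq_zero_of_abs_lt_dvd this h2

lemma card_filter_coprime_le {N : ℕ} (hN : N ≠ 0) (p : ℕ) :
    ({u ∈ N.divisors | u.Coprime (N / u) ∧ ¬ p ∣ u} : Finset ℕ).card ≤
      2 ^ (N.primeFactors.erase p).card := by
  rw [← Finset.card_powerset]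
  refine Finset.card_le_card_of_injOn Nat.primeFactors (fun u hu ↦ ?_) ?_
  · rw [Finset.mem_coe, Finset.mem_filter, Nat.mem_divisors] at hu
    rw [Finset.mem_coe, Finset.mem_powerset]
    intro q hq
    rw [Finset.mem_erase]
    refine ⟨?_, Nat.primeFactors_mono hu.1.1 hN hq⟩
    rintro rfl
    exact hu.2.2 (Nat.dvd_of_mem_primeFactors hq)
  · have key : ∀ u v : ℕ, u ∣ N → v ∣ N → u.primeFactors = v.primeFactors →
        v.Coprime (N / v) → u ∣ v := by
      intro u v hu hv huv hco
      have h1 : u.Coprime (N / v) := by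
        refine Nat.Coprime.symm (Nat.coprime_of_dvd fun q hq h1 h2 ↦ ?_)
        have h3 : q ∈ v.primeFactors := huv ▸ Nat.mem_primeFactors.2
          ⟨hq, h2, ne_zero_of_dvd_ne_zero hN hu⟩
        exact hq.not_dvd_one (hco ▸ Nat.dvd_gcd (Nat.dvd_of_mem_primeFactors h3) h1)
      refine h1.dvd_of_dvd_mul_right ?_
      rwa [Nat.mul_div_cancel' hv]
    intro u hu v hv huv
    rw [Finset.mem_coe, Finset.mem_filter, Nat.mem_divisors] at hu hv
    exact Nat.dvd_antisymm (key u v hu.1.1 hv.1.1 huv hv.2.1)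
      (key v u hv.1.1 hu.1.1 huv.symm hu.2.1)

lemma ncard_le_of_forall_exists {α : Type*} {S : Set α} {N : ℕ} (hN : N ≠ 0) (p : ℕ)
    (F : ℤ → ℤ → α) (h : ∀ A ∈ S, ∃ u v : ℕ, u * v = N ∧ u.Coprime v ∧ ¬ p ∣ u ∧ F u v = A) :
    S.ncard ≤ 2 ^ (N.primeFactors.erase p).card := by
  classical
  refine le_trans ?_ (card_filter_coprime_le hN p)
  refine (Set.ncard_le_ncard (t := ((Finset.image (fun u : ℕ ↦ F u (N / u : ℕ))
    {u ∈ N.divisors | u.Coprime (N / u) ∧ ¬ p ∣ u} : Finset α) : Set α)) ?_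
    (Finset.finite_toSet _)).trans ?_
  · intro A hA
    obtain ⟨u, v, huv, hco, hpu, rfl⟩ := h A hA
    rw [Finset.mem_coe, Finset.mem_image]
    have hu : 0 < u := by
      rcases Nat.eq_zero_or_pos u with h0 | h0
      · rw [h0, zero_mul] at huv; exact absurd huv.symm hN
      · exact h0
    have hv : N / u = v := by rw [← huv]; exact Nat.mul_div_cancel_left v hu
    refine ⟨u, Finset.mem_filter.2 ⟨Nat.mem_divisors.2 ⟨⟨v, huv.symm⟩, hN⟩, ?_, hpu⟩, ?_⟩
    · rwa [hv]
    · simp only [hv]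
  · rw [Set.ncard_coe_finset]
    exact Finset.card_image_le

/-- The classes of forms `a X² + c Y²`. -/
lemma ncard_diag_le {m : ℕ} (hm : m ≠ 0) {p : ℕ} (hp : p.Prime) (hD : D = -4 * m) :
    {A : Cl D | ∃ f : QF, f.Good D ∧ cls D f = A ∧ f.b = 0}.ncard ≤
      2 ^ (m.primeFactors.erase p).card := by
  have hm0 : (0 : ℤ) < m := by exact_mod_cast Nat.pos_of_ne_zero hm
  have hD0 : D < 0 := by linarith
  refine ncard_le_of_forall_exists hm p (fun u v ↦ cls D ⟨u, 0, v⟩) ?_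
  have key : ∀ f : QF, f.Good D → f.b = 0 → ¬ (p : ℤ) ∣ f.a →
      ∃ u v : ℕ, u * v = m ∧ u.Coprime v ∧ ¬ p ∣ u ∧ cls D ⟨u, 0, v⟩ = cls D f := by
    intro f hf hb hpa
    have hd := hf.disc_eq
    unfold disc at hd
    rw [hb] at hd
    have hac : f.a * f.c = m := by linarith
    have ha := hf.pos
    have hc : 0 < f.c := by
      by_contra hc
      push Not at hc
      nlinarith
    obtain ⟨u, hu⟩ := Int.eq_ofNat_of_zero_le ha.le
    obtain ⟨v, hv⟩ := Int.eq_ofNat_of_zero_le hc.le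
    rw [hu, hv] at hac
    refine ⟨u, v, by exact_mod_cast hac, Nat.coprime_of_dvd fun q hq h1 h2 ↦ ?_, ?_, ?_⟩
    · exact hf.not_all_dvd hq (hu ▸ Int.natCast_dvd_natCast.2 h1) (hb ▸ dvd_zero _)
        (hv ▸ Int.natCast_dvd_natCast.2 h2)
    · exact fun h ↦ hpa (hu ▸ Int.natCast_dvd_natCast.2 h)
    · congr 1
      ext
      · exact hu.symm
      · exact hb.symm
      · exact hv.symm
  rintro A ⟨f, hf, rfl, hb⟩
  by_cases hpa : (p : ℤ) ∣ f.a
  · have hdet : (0 : ℤ) * 0 - (-1) * 1 = 1 := by norm_num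
    rw [← hf.cls_act hD0 hdet]
    refine key _ (hf.act hD0 hdet) (by simp [QF.act, hb]) ?_
    have : (f.act 0 (-1) 1 0).a = f.c := by simp [QF.act, eval]
    rw [this]
    exact fun h ↦ hf.not_all_dvd hp hpa (hb ▸ dvd_zero _) h
  · exact key f hf hb hpa

/-- The classes of forms `a X² + b X Y + a Y²`. -/
lemma ncard_symm_le {N k : ℕ} (hN : N ≠ 0) (hk : k ≠ 0) {p : ℕ} (hp : p.Prime)
    (hD : D = -((k : ℤ) ^ 2 * N))
    (h : ∀ f : QF, f.Good D → f.a = f.c →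
      ∃ u v : ℤ, 2 * f.a - f.b = k * u ∧ 2 * f.a + f.b = k * v ∧ IsCoprime u v) :
    {A : Cl D | ∃ f : QF, f.Good D ∧ cls D f = A ∧ f.a = f.c}.ncard ≤
      2 ^ (N.primeFactors.erase p).card := by
  have hN0 : (0 : ℤ) < N := by exact_mod_cast Nat.pos_of_ne_zero hN
  have hk0 : (0 : ℤ) < k := by exact_mod_cast Nat.pos_of_ne_zero hk
  have hD0 : D < 0 := by
    rw [hD]
    have : (0 : ℤ) < (k : ℤ) ^ 2 * N := by positivity
    linarith
  refine ncard_le_of_forall_exists hN p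
    (fun u v ↦ cls D ⟨k * (u + v) / 4, k * (v - u) / 2, k * (u + v) / 4⟩) ?_
  have key : ∀ f : QF, f.Good D → f.a = f.c → ∀ u v : ℤ, 2 * f.a - f.b = k * u →
      2 * f.a + f.b = k * v → IsCoprime u v → ¬ (p : ℤ) ∣ u →
      ∃ u v : ℕ, u * v = N ∧ u.Coprime v ∧ ¬ p ∣ u ∧
        cls D ⟨k * (u + v) / 4, k * (v - u) / 2, k * (u + v) / 4⟩ = cls D f := by
    intro f hf hac u v hu hv hco hpu
    have hd := hf.disc_eq
    unfold disc at hd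
    have huv : u * v = N := by
      refine mul_left_cancel₀ (pow_ne_zero 2 hk0.ne') (?_ : (k : ℤ) ^ 2 * (u * v) = k ^ 2 * N)
      have : (k : ℤ) ^ 2 * (u * v) = (k * u) * (k * v) := by ring
      rw [this, ← hu, ← hv]
      rw [hac] at hd ⊢
      linarith
    have huv2 : 0 < k * (u + v) := by
      have := hf.pos
      linarith
    have huv3 : 0 < u + v := pos_of_mul_pos_right huv2 hk0.le
    have hu0 : 0 < u := by
      by_contra hu0
      push Not at hu0
      nlinarith
    have hv0 : 0 < v := by
      by_contra hv0
      push Not at hv0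
      nlinarith
    lift u to ℕ using hu0.le
    lift v to ℕ using hv0.le
    refine ⟨u, v, by exact_mod_cast huv, Nat.isCoprime_iff_coprime.1 hco,
      fun h ↦ hpu (Int.natCast_dvd_natCast.2 h), ?_⟩
    congr 1
    ext
    · dsimp only
      rw [mul_add]; omega
    · dsimp only
      rw [mul_sub]; omega
    · dsimp only
      rw [mul_add]; omega
  rintro A ⟨f, hf, rfl, hac⟩
  obtain ⟨u, v, hu, hv, hco⟩ := h f hf hac
  by_cases hpu : (p : ℤ) ∣ u
  · have hdet : (0 : ℤ) * 0 - (-1) * 1 = 1 := by norm_num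
    rw [← hf.cls_act hD0 hdet]
    have e1 : (f.act 0 (-1) 1 0).a = f.a := by simp [QF.act, eval, hac]
    have e2 : (f.act 0 (-1) 1 0).b = -f.b := by simp [QF.act]
    have e3 : (f.act 0 (-1) 1 0).c = f.a := by simp [QF.act, eval]
    refine key _ (hf.act hD0 hdet) (e1.trans e3.symm) v u (by rw [e1, e2]; linarith)
      (by rw [e1, e2]; linarith) hco.symm fun hpv ↦ ?_
    exact (Nat.prime_iff_prime_int.1 hp).not_isUnit (hco.isUnit_of_dvd' hpu hpv)
  · exact key f hf hac u v hu hv hco hpu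

lemma NegDisc.ncard_le_add (h : NegDisc D) :
    {A : Cl D | A ^ 2 = 1}.ncard ≤ {A : Cl D | ∃ f : QF, f.Good D ∧ cls D f = A ∧ f.b = 0}.ncard +
      {A : Cl D | ∃ f : QF, f.Good D ∧ cls D f = A ∧ f.a = f.c}.ncard := by
  have := h.finite
  refine (Set.ncard_le_ncard (fun A hA ↦ ?_) (Set.toFinite _)).trans (Set.ncard_union_le _ _)
  obtain ⟨f, hf, hA, h1 | h1⟩ := h.exists_ambiguous hA
  · exact Or.inl ⟨f, hf, hA, h1⟩
  · exact Or.inr ⟨f, hf, hA, h1⟩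

lemma card_erase_minFac {N : ℕ} (hN : 1 < N) :
    2 * 2 ^ (N.primeFactors.erase N.minFac).card = 2 ^ N.primeFactors.card := by
  rw [← pow_succ', Finset.card_erase_add_one]
  exact Nat.mem_primeFactors.2 ⟨Nat.minFac_prime hN.ne', Nat.minFac_dvd N, by omega⟩

lemma erase_two_of_odd {N : ℕ} (hN : ¬ 2 ∣ N) : N.primeFactors.erase 2 = N.primeFactors :=
  Finset.erase_eq_of_notMem fun h ↦ hN (Nat.dvd_of_mem_primeFactors h)

lemma NegDisc.ncard_le_of_odd (h : NegDisc D) (h2 : D % 2 = 1) (h1 : D < -1) :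
    2 * {A : Cl D | A ^ 2 = 1}.ncard ≤ 2 ^ (D.natAbs.primeFactors.erase 2).card := by
  have hN : 1 < D.natAbs := by omega
  have hdiag : {A : Cl D | ∃ f : QF, f.Good D ∧ cls D f = A ∧ f.b = 0} = ∅ := by
    refine Set.eq_empty_of_forall_notMem ?_
    rintro A ⟨f, hf, -, hb⟩
    have hd := hf.disc_eq
    unfold disc at hd
    rw [hb] at hd
    have : D = 2 * (-(2 * f.a * f.c)) := by rw [← hd]; ring
    omega
  have hsymm := ncard_symm_le (D := D) (N := D.natAbs) (k := 1) (by omega) one_ne_zero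
    (Nat.minFac_prime hN.ne') (by push_cast; rw [abs_of_neg h.neg]; ring) fun f hf hac ↦
      ⟨2 * f.a - f.b, 2 * f.a + f.b, by simp, by simp, isCoprime_of_forall_prime fun q hq h3 h4 ↦ by
        have hd := hf.disc_eq
        unfold disc at hd
        rw [← hac] at hd
        have hqi := Nat.prime_iff_prime_int.1 hq
        have hqD : (q : ℤ) ∣ D := by
          have : D = -((2 * f.a - f.b) * (2 * f.a + f.b)) := by rw [← hd]; ring
          rw [this]
          exact (h3.mul_right _).neg_right
        have hq2 : ¬ (q : ℤ) ∣ 2 := not_dvd_two hq (by rintro rfl; omega)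
        have h5 : (q : ℤ) ∣ 2 * (2 * f.a) := by
          have := dvd_add h3 h4
          rwa [show 2 * f.a - f.b + (2 * f.a + f.b) = 2 * (2 * f.a) by ring] at this
        have h6 : (q : ℤ) ∣ 2 * f.b := by
          have := dvd_sub h4 h3
          rwa [show 2 * f.a + f.b - (2 * f.a - f.b) = 2 * f.b by ring] at this
        have h7 := (hqi.dvd_or_dvd ((hqi.dvd_or_dvd h5).resolve_left hq2)).resolve_left hq2
        exact hf.not_all_dvd hq h7 ((hqi.dvd_or_dvd h6).resolve_left hq2) (hac ▸ h7)⟩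
  have hle := h.ncard_le_add
  rw [hdiag, Set.ncard_empty] at hle
  rw [erase_two_of_odd (by omega), ← card_erase_minFac hN]
  omega

section

variable {m : ℕ} (hm : 1 < m) (hD : D = -4 * m)
include hm hD

omit hm in
lemma NegDisc.exists_half {f : QF} (hf : f.Good D) (hac : f.a = f.c) :
    ∃ β, f.b = 2 * β ∧ (f.a - β) * (f.a + β) = m := by
  have hd := hf.disc_eq
  unfold disc at hd
  rw [← hac, hD] at hd
  obtain ⟨β, hβ⟩ : 2 ∣ f.b := Int.prime_two.dvd_of_dvd_pow (n := 2)
    ⟨2 * (f.a * f.a) - 2 * m, by linarith⟩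
  refine ⟨β, hβ, ?_⟩
  rw [hβ] at hd
  linarith

lemma NegDisc.primeFactors_natAbs :
    D.natAbs.primeFactors.erase 2 = m.primeFactors.erase 2 := by
  have : D.natAbs = 2 ^ 2 * m := by rw [hD]; omega
  rw [this, Nat.primeFactors_mul (by norm_num) (by omega), Nat.primeFactors_prime_pow two_ne_zero
    Nat.prime_two, Finset.erase_union_distrib]
  simp

lemma NegDisc.ncard_diag_le_of_odd (hm2 : m % 2 = 1) :
    2 * {A : Cl D | ∃ f : QF, f.Good D ∧ cls D f = A ∧ f.b = 0}.ncard ≤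
      2 ^ (D.natAbs.primeFactors.erase 2).card := by
  rw [NegDisc.primeFactors_natAbs hm hD, erase_two_of_odd (by omega), ← card_erase_minFac hm]
  exact Nat.mul_le_mul_left 2 (ncard_diag_le (by omega) (Nat.minFac_prime hm.ne') hD)

lemma NegDisc.ncard_le_of_one (h : NegDisc D) (hm4 : m % 4 = 1) :
    {A : Cl D | A ^ 2 = 1}.ncard ≤ 2 ^ (D.natAbs.primeFactors.erase 2).card := by
  have hdiag := NegDisc.ncard_diag_le_of_odd hm hD (by omega)
  have hsymm := ncard_symm_le (D := D) (N := m) (k := 2) (by omega) two_ne_zero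
    (Nat.minFac_prime hm.ne') (by rw [hD]; norm_num) fun f hf hac ↦ by
      obtain ⟨β, hβ, hmul⟩ := NegDisc.exists_half hD hf hac
      refine ⟨f.a - β, f.a + β, by rw [hβ]; push_cast; ring, by rw [hβ]; push_cast; ring,
        isCoprime_of_forall_prime fun q hq h3 h4 ↦ ?_⟩
      have hqi := Nat.prime_iff_prime_int.1 hq
      have hqD : (q : ℤ) ∣ m := hmul ▸ h3.mul_right _
      have hq2 : ¬ (q : ℤ) ∣ 2 := not_dvd_two hq (by rintro rfl; omega)
      have h5 : (q : ℤ) ∣ 2 * f.a := by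
        have := dvd_add h3 h4
        rwa [show f.a - β + (f.a + β) = 2 * f.a by ring] at this
      have h6 : (q : ℤ) ∣ f.b := by
        have := dvd_sub h4 h3
        rwa [show f.a + β - (f.a - β) = 2 * β by ring, ← hβ] at this
      have h7 := (hqi.dvd_or_dvd h5).resolve_left hq2
      exact hf.not_all_dvd hq h7 h6 (hac ▸ h7)
  have hle := h.ncard_le_add
  rw [NegDisc.primeFactors_natAbs hm hD, erase_two_of_odd (by omega),
    ← card_erase_minFac hm] at hdiag ⊢
  omega

lemma NegDisc.ncard_le_of_three (h : NegDisc D) (hm4 : m % 4 = 3) :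
    2 * {A : Cl D | A ^ 2 = 1}.ncard ≤ 2 ^ (D.natAbs.primeFactors.erase 2).card := by
  have hdiag := NegDisc.ncard_diag_le_of_odd hm hD (by omega)
  have hsymm : {A : Cl D | ∃ f : QF, f.Good D ∧ cls D f = A ∧ f.a = f.c} = ∅ := by
    refine Set.eq_empty_of_forall_notMem ?_
    rintro A ⟨f, hf, -, hac⟩
    obtain ⟨β, hβ, hmul⟩ := NegDisc.exists_half hD hf hac
    have h2 : ¬ 2 ∣ f.a := fun h2 ↦
      hf.not_all_dvd Nat.prime_two h2 ⟨β, hβ⟩ (by rw [← hac]; exact h2)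
    obtain ⟨k, hk⟩ : 2 ∣ f.a - 1 := by omega
    have hk' : f.a = 2 * k + 1 := by linarith
    rw [hk'] at hmul
    rcases Int.emod_two_eq_zero_or_one β with hb | hb
    · obtain ⟨l, hl⟩ : 2 ∣ β := by omega
      rw [hl, show (2 * k + 1 - 2 * l) * (2 * k + 1 + 2 * l) = 4 * (k ^ 2 + k - l ^ 2) + 1 by
        ring] at hmul
      omega
    · obtain ⟨l, hl⟩ : 2 ∣ β - 1 := by omega
      rw [show β = 2 * l + 1 by linarith, show (2 * k + 1 - (2 * l + 1)) * (2 * k + 1 + (2 * l + 1))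
        = 4 * ((k - l) * (k + l + 1)) by ring] at hmul
      omega
  have hle := h.ncard_le_add
  rw [hsymm, Set.ncard_empty] at hle
  omega

omit hm in
lemma NegDisc.exists_quarter (hm2 : m % 2 = 0) {f : QF} (hf : f.Good D) (hac : f.a = f.c) :
    ∃ u v : ℤ, f.a = u + v ∧ f.b = 2 * (v - u) ∧ 4 * (u * v) = m ∧ IsCoprime u v ∧ 2 ∣ u * v := by
  obtain ⟨β, hβ, hmul⟩ := NegDisc.exists_half hD hf hac
  have h2 : ¬ 2 ∣ f.a := fun h2 ↦
    hf.not_all_dvd Nat.prime_two h2 ⟨β, hβ⟩ (by rw [← hac]; exact h2)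
  have hpar : 2 ∣ f.a - β := by
    have h3 : (2 : ℤ) ∣ (f.a - β) * (f.a + β) := by rw [hmul]; omega
    rcases Int.prime_two.dvd_or_dvd h3 with h3 | h3 <;> omega
  obtain ⟨u, hu⟩ := hpar
  have hv : β = f.a - 2 * u := by linarith
  subst hv
  refine ⟨u, f.a - u, by ring, by rw [hβ]; ring, by rw [← hmul]; ring,
    isCoprime_of_forall_prime fun q hq h3 h4 ↦ ?_, ?_⟩
  · have h5 : (q : ℤ) ∣ f.a := by
      have := dvd_add h3 h4
      rwa [add_sub_cancel] at this
    exact hf.not_all_dvd hq h5 (hβ ▸ ((dvd_sub h5 (h3.mul_left 2)).mul_left 2)) (hac ▸ h5)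
  · rcases Int.emod_two_eq_zero_or_one u with hb | hb
    · exact Dvd.dvd.mul_right (by omega) _
    · exact Dvd.dvd.mul_left (by omega) _

lemma NegDisc.ncard_le_of_even (h : NegDisc D) (hm2 : m % 2 = 0) (hm8 : m % 8 ≠ 0) :
    {A : Cl D | A ^ 2 = 1}.ncard ≤ 2 ^ (D.natAbs.primeFactors.erase 2).card := by
  have hdiag := ncard_diag_le (D := D) (by omega) Nat.prime_two hD
  have hsymm : {A : Cl D | ∃ f : QF, f.Good D ∧ cls D f = A ∧ f.a = f.c} = ∅ := by
    refine Set.eq_empty_of_forall_notMem ?_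
    rintro A ⟨f, hf, -, hac⟩
    obtain ⟨u, v, -, -, h3, -, h4⟩ := NegDisc.exists_quarter hD hm2 hf hac
    omega
  have hle := h.ncard_le_add
  rw [hsymm, Set.ncard_empty] at hle
  rw [NegDisc.primeFactors_natAbs hm hD]
  omega

lemma NegDisc.ncard_le_of_eight_dvd (h : NegDisc D) (hm8 : m % 8 = 0) :
    {A : Cl D | A ^ 2 = 1}.ncard ≤ 2 * 2 ^ (D.natAbs.primeFactors.erase 2).card := by
  have hdiag := ncard_diag_le (D := D) (by omega) Nat.prime_two hD
  have hm4 : m = 2 ^ 2 * (m / 4) := by omega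
  have hsymm := ncard_symm_le (D := D) (N := m / 4) (k := 4) (by omega) (by norm_num)
    Nat.prime_two (by rw [hD]; omega) fun f hf hac ↦ by
      obtain ⟨u, v, h3, h4, h5, h6, -⟩ := NegDisc.exists_quarter hD (by omega) hf hac
      exact ⟨u, v, by rw [h3, h4]; push_cast; ring, by rw [h3, h4]; push_cast; ring, h6⟩
  have hpf : m.primeFactors.erase 2 = (m / 4).primeFactors.erase 2 := by
    conv_lhs => rw [hm4]
    rw [Nat.primeFactors_mul (by norm_num) (by omega), Nat.primeFactors_prime_pow two_ne_zero
      Nat.prime_two, Finset.erase_union_distrib]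
    simp
  have hle := h.ncard_le_add
  rw [NegDisc.primeFactors_natAbs hm hD]
  rw [← hpf] at hsymm
  omega

end

/-- The gain from allowing multiples of the odd prime `p` in `LowerBd`. -/
noncomputable def gain (D : ℤ) (p : ℕ) : ℝ :=
  if (p : ℤ) ^ 2 ∣ D then (1 - ((p : ℝ) ^ 2)⁻¹)⁻¹ else (1 - (p : ℝ)⁻¹)⁻¹

lemma gain_pos {p : ℕ} (hp : p.Prime) : 0 < gain D p := by
  have h1 : (1 : ℝ) < p := by exact_mod_cast hp.one_lt
  unfold gain
  split_ifs
  · exact inv_pos.2 (sub_pos.2 (inv_lt_one_of_one_lt₀ (one_lt_pow₀ h1 two_ne_zero)))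
  · exact inv_pos.2 (sub_pos.2 (inv_lt_one_of_one_lt₀ h1))

lemma LowerBd.mul_prod_gain (hD : D < 0) (O : Finset ℕ)
    (hO : ∀ p ∈ O, p.Prime ∧ p ≠ 2 ∧ (p : ℤ) ∣ D) :
    ∀ {c : ℝ}, LowerBd D O c → LowerBd D ∅ (c * ∏ p ∈ O, gain D p) := by
  induction O using Finset.induction_on with
  | empty => intro c hc; simpa using hc
  | insert p O hpO ih =>
    intro c hc
    rw [Finset.prod_insert hpO, ← mul_assoc]
    refine ih (fun q hq ↦ hO q (Finset.mem_insert_of_mem hq)) ?_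
    obtain ⟨hp, hp2, hpD⟩ := hO p (Finset.mem_insert_self p O)
    rw [← Finset.erase_insert hpO]
    unfold gain
    split_ifs with h
    · obtain ⟨D', hD'⟩ := h
      have hD0 : D' < 0 := by
        by_contra h0
        push Not at h0
        have : 0 ≤ (p : ℤ) ^ 2 * D' := by positivity
        omega
      exact LowerBd.erase_sq (fun q hq ↦ (hO q hq).1) hc hD0 (Finset.mem_insert_self p O) hD'
        fun h ↦ absurd h hp2
    · exact LowerBd.erase_odd (fun q hq ↦ (hO q hq).1) hc hD (Finset.mem_insert_self p O) hp2 hpD h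

/-- The contribution of the odd prime `p` to the final estimate. -/
noncomputable def contrib (D : ℤ) (p : ℕ) : ℝ :=
  gain D p ^ 4 * (1 - (p : ℝ)⁻¹) ^ 2 * (p : ℝ) ^ D.natAbs.factorization p / 4

lemma two_pow_mul_prod_le (hD : D ≠ 0) {e : ℕ} (he : 2 ^ e ∣ D.natAbs) :
    2 ^ e * ∏ p ∈ D.natAbs.primeFactors.erase 2, p ^ D.natAbs.factorization p ≤ D.natAbs := by
  have hN : D.natAbs ≠ 0 := Int.natAbs_ne_zero.2 hD
  have h := Nat.prod_factorization_pow_eq_self hN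
  have hev : e ≤ D.natAbs.factorization 2 := (Nat.prime_two.pow_dvd_iff_le_factorization hN).1 he
  conv_rhs => rw [← h]
  rw [Finsupp.prod, Nat.support_factorization]
  by_cases h2 : 2 ∈ D.natAbs.primeFactors
  · rw [← Finset.mul_prod_erase _ _ h2]
    exact Nat.mul_le_mul_right _ (Nat.pow_le_pow_right two_pos hev)
  · have : e = 0 := by
      rw [← Nat.support_factorization, Finsupp.notMem_support_iff] at h2
      omega
    rw [this, pow_zero, one_mul, Finset.erase_eq_of_notMem h2]

/-- The combination of all estimates for a fixed discriminant. -/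
theorem NegDisc.lowerBd_empty (h : NegDisc D) {γ κ w ε : ℝ} {e : ℕ} (hκ : 0 < κ) (hε : 0 < ε)
    (hstep : ∀ c : ℝ, c ^ 2 * (2 * (γ * 2 ^ (D.natAbs.primeFactors.erase 2).card) * w) ≤
      resConst D → LowerBd D (D.natAbs.primeFactors.erase 2) (c * κ))
    (he : 2 ^ e ∣ D.natAbs) (hε2 : ε = if 2 ∣ D.natAbs then 1 / 2 else 1)
    (hnum : 16 * γ ^ 2 * w ^ 2 ≤
      κ ^ 4 * 2 ^ e * ε ^ 2 * ∏ p ∈ D.natAbs.primeFactors.erase 2, contrib D p) :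
    LowerBd D ∅ (2 * √Real.pi / √(-D)) := by
  set O := D.natAbs.primeFactors.erase 2 with hOdef
  have hOp : ∀ p ∈ O, p.Prime := fun p hp ↦
    Nat.prime_of_mem_primeFactors (Finset.mem_of_mem_erase hp)
  have hO : ∀ p ∈ O, p.Prime ∧ p ≠ 2 ∧ (p : ℤ) ∣ D := fun p hp ↦
    ⟨hOp p hp, Finset.ne_of_mem_erase hp,
      Int.natCast_dvd.2 (Nat.dvd_of_mem_primeFactors (Finset.mem_of_mem_erase hp))⟩
  set K := ∏ p ∈ O, gain D p with hK
  have hK0 : 0 < K := Finset.prod_pos fun p hp ↦ gain_pos (hOp p hp)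
  have hD0 : (0 : ℝ) < -D := by exact_mod_cast neg_pos.2 h.neg
  set R := √(-D : ℝ) with hR
  have hR0 : 0 < R := Real.sqrt_pos.2 hD0
  have hR2 : R ^ 2 = -D := Real.sq_sqrt hD0.le
  set t := √Real.pi with hpi
  have hpi0 : 0 < t := Real.sqrt_pos.2 Real.pi_pos
  have hpi2 : t ^ 2 = Real.pi := Real.sq_sqrt Real.pi_pos.le
  set q := ∏ p ∈ O, (1 - (p : ℝ)⁻¹) with hq
  have hq0 : 0 < q := Finset.prod_pos fun p hp ↦ sub_pos.2
    (inv_lt_one_of_one_lt₀ (by exact_mod_cast (hOp p hp).one_lt))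
  have hres : resConst D = 2 * Real.pi / R * (ε * q) := by
    unfold resConst
    rw [← hR, hε2]
    congr 1
    split_ifs with h2
    · rw [← Finset.mul_prod_erase _ _
        (Nat.mem_primeFactors.2 ⟨Nat.prime_two, h2, Int.natAbs_ne_zero.2 h.neg.ne⟩)]
      norm_num
      rfl
    · rw [one_mul, hq, hOdef, erase_two_of_odd h2]
  have hmain : 4 * (γ * 2 ^ O.card) * w ≤ κ ^ 2 * K ^ 2 * R * (ε * q) := by
    refine abs_le_of_sq_le_sq' ?_ (by positivity) |>.2
    have hprod : ∏ p ∈ O, contrib D p = K ^ 4 * q ^ 2 *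
        (∏ p ∈ O, p ^ D.natAbs.factorization p : ℕ) / 4 ^ O.card := by
      unfold contrib
      rw [Finset.prod_div_distrib, Finset.prod_mul_distrib, Finset.prod_mul_distrib,
        Finset.prod_const, Finset.prod_pow, Finset.prod_pow]
      push_cast
      rfl
    have hle : (2 : ℝ) ^ e * (∏ p ∈ O, p ^ D.natAbs.factorization p : ℕ) ≤ R ^ 2 := by
      have h1 := two_pow_mul_prod_le h.neg.ne he
      have h2 : ((D.natAbs : ℕ) : ℝ) = R ^ 2 := by
        rw [hR2, Nat.cast_natAbs, abs_of_neg h.neg]; push_cast; rfl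
      rw [← h2]
      exact_mod_cast h1
    rw [hprod] at hnum
    have h4 : (0 : ℝ) < 4 ^ O.card := by positivity
    have h24 : ((2 : ℝ) ^ O.card) ^ 2 = 4 ^ O.card := by
      rw [← pow_mul, mul_comm, pow_mul]; norm_num
    calc (4 * (γ * 2 ^ O.card) * w) ^ 2 = (16 * γ ^ 2 * w ^ 2) * 4 ^ O.card := by
          rw [← h24]; ring
      _ ≤ (κ ^ 4 * 2 ^ e * ε ^ 2 * (K ^ 4 * q ^ 2 *
        (∏ p ∈ O, p ^ D.natAbs.factorization p : ℕ) / 4 ^ O.card)) * 4 ^ O.card :=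
          mul_le_mul_of_nonneg_right hnum h4.le
      _ = κ ^ 4 * ε ^ 2 * K ^ 4 * q ^ 2 *
          (2 ^ e * (∏ p ∈ O, p ^ D.natAbs.factorization p : ℕ)) := by
          field_simp
      _ ≤ κ ^ 4 * ε ^ 2 * K ^ 4 * q ^ 2 * R ^ 2 :=
          mul_le_mul_of_nonneg_left hle (by positivity)
      _ = (κ ^ 2 * K ^ 2 * R * (ε * q)) ^ 2 := by ring
  have := LowerBd.mul_prod_gain h.neg O hO (hstep (2 * t / (R * K * κ)) ?_)
  · convert this using 1
    rw [← hK]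
    field_simp
  · rw [hres, div_pow, mul_pow, hpi2]
    have e1 : 2 ^ 2 * Real.pi / (R * K * κ) ^ 2 * (2 * (γ * 2 ^ O.card) * w) =
        2 * Real.pi / (R ^ 2 * K ^ 2 * κ ^ 2) * (4 * (γ * 2 ^ O.card) * w) := by ring
    have e2 : 2 * Real.pi / R * (ε * q) =
        2 * Real.pi / (R ^ 2 * K ^ 2 * κ ^ 2) * (κ ^ 2 * K ^ 2 * R * (ε * q)) := by
      field_simp
    rw [e1, e2]
    exact mul_le_mul_of_nonneg_left hmain (by positivity)

lemma contrib_of_eq_one (hD : D ≠ 0) {p : ℕ} (hp : p.Prime) (h1 : D.natAbs.factorization p = 1) :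
    contrib D p = (p : ℝ) ^ 3 / (4 * ((p : ℝ) - 1) ^ 2) := by
  have h2 : ¬ (p : ℤ) ^ 2 ∣ D := fun h ↦ by
    have h3 : p ^ 2 ∣ D.natAbs := Int.natCast_dvd.1 (by exact_mod_cast h)
    rw [hp.pow_dvd_iff_le_factorization (Int.natAbs_ne_zero.2 hD)] at h3
    omega
  have hp1 : (1 : ℝ) < p := by exact_mod_cast hp.one_lt
  have hp2 : (p : ℝ) - 1 ≠ 0 := by linarith
  unfold contrib gain
  rw [if_neg h2, h1]
  have : 1 - (p : ℝ)⁻¹ = (p - 1) / p := by field_simp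
  rw [this]
  field_simp

lemma le_contrib_of_two_le (hD : D ≠ 0) {p k : ℕ} (hp : p.Prime) (hk : 2 ≤ k)
    (h1 : k ≤ D.natAbs.factorization p) :
    (p : ℝ) ^ (k + 6) / (4 * (((p : ℝ) - 1) ^ 2 * ((p : ℝ) + 1) ^ 4)) ≤ contrib D p := by
  have h2 : (p : ℤ) ^ 2 ∣ D := by
    have h3 := (hp.pow_dvd_iff_le_factorization (Int.natAbs_ne_zero.2 hD)).2 (hk.trans h1)
    exact_mod_cast Int.natCast_dvd.2 h3
  have hp1 : (1 : ℝ) < p := by exact_mod_cast hp.one_lt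
  have hp2 : 0 < (p : ℝ) - 1 := by linarith
  have hp3 : 0 < (p : ℝ) + 1 := by linarith
  have hle : (p : ℝ) ^ k ≤ (p : ℝ) ^ D.natAbs.factorization p := pow_le_pow_right₀ hp1.le h1
  unfold contrib gain
  rw [if_pos h2]
  have e1 : 1 - (p : ℝ)⁻¹ = (p - 1) / p := by field_simp
  have e2 : 1 - ((p : ℝ) ^ 2)⁻¹ = (p - 1) * (p + 1) / p ^ 2 := by field_simp; ring
  rw [e1, e2]
  refine le_trans (le_of_eq ?_) (div_le_div_of_nonneg_right
    (mul_le_mul_of_nonneg_left hle (by positivity)) (by norm_num))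
  field_simp
  ring

lemma four_le_contrib_of_two_le (hD : D ≠ 0) {p : ℕ} (hp : p.Prime) (hp5 : 5 ≤ p)
    (h1 : 2 ≤ D.natAbs.factorization p) : 4 ≤ contrib D p := by
  refine le_trans ?_ (le_contrib_of_two_le hD hp le_rfl h1)
  have hp5' : (5 : ℝ) ≤ p := by exact_mod_cast hp5
  obtain ⟨x, hx⟩ : ∃ x : ℝ, (p : ℝ) = x + 5 := ⟨p - 5, by ring⟩
  have hx0 : 0 ≤ x := by linarith
  rw [hx, le_div_iff₀ (mul_pos (by norm_num) (mul_pos (pow_pos (by linarith) 2) (by positivity)))]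
  have h2 : 4 * ((x + 5 - 1) * (x + 5 + 1) ^ 2) ≤ (x + 5) ^ 4 := by
    have : (x + 5) ^ 4 - 4 * ((x + 5 - 1) * (x + 5 + 1) ^ 2) =
      x ^ 4 + 16 * x ^ 3 + 86 * x ^ 2 + 164 * x + 49 := by ring
    have : 0 ≤ x ^ 4 + 16 * x ^ 3 + 86 * x ^ 2 + 164 * x + 49 := by positivity
    linarith
  have h3 := pow_le_pow_left₀ (by positivity [show 0 ≤ x + 5 - 1 by linarith]) h2 2
  calc 4 * (4 * ((x + 5 - 1) ^ 2 * (x + 5 + 1) ^ 4)) =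
      (4 * ((x + 5 - 1) * (x + 5 + 1) ^ 2)) ^ 2 := by ring
    _ ≤ ((x + 5) ^ 4) ^ 2 := h3
    _ = (x + 5) ^ (2 + 6) := by ring

lemma four_le_contrib_of_le (hD : D ≠ 0) {p : ℕ} (hp : p.Prime) (hp5 : 17 ≤ p)
    (h1 : 1 ≤ D.natAbs.factorization p) : 4 ≤ contrib D p := by
  rcases h1.eq_or_lt with h1 | h1
  · rw [contrib_of_eq_one hD hp h1.symm]
    have hp5' : (17 : ℝ) ≤ p := by exact_mod_cast hp5
    rw [le_div_iff₀ (mul_pos (by norm_num) (pow_pos (by linarith) 2))]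
    nlinarith [mul_nonneg (show (0 : ℝ) ≤ p by linarith) (show (0 : ℝ) ≤ p - 17 by linarith),
      mul_nonneg (mul_nonneg (show (0 : ℝ) ≤ p by linarith) (show (0 : ℝ) ≤ p by linarith))
        (show (0 : ℝ) ≤ p - 17 by linarith)]
  · exact four_le_contrib_of_two_le hD hp (by omega) h1

lemma le_contrib (hD : D ≠ 0) {p : ℕ} (hp : p.Prime) (hp2 : p ≠ 2)
    (h1 : 1 ≤ D.natAbs.factorization p) : 8 / 5 ≤ contrib D p := by
  have hp3 : 3 ≤ p := by
    have := hp.two_le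
    omega
  rcases h1.eq_or_lt with h1 | h1
  · rw [contrib_of_eq_one hD hp h1.symm]
    have hp3' : (3 : ℝ) ≤ p := by exact_mod_cast hp3
    rw [le_div_iff₀ (mul_pos (by norm_num) (pow_pos (by linarith) 2))]
    obtain ⟨x, hx⟩ : ∃ x : ℝ, (p : ℝ) = x + 3 := ⟨p - 3, by ring⟩
    have hx0 : 0 ≤ x := by linarith
    rw [hx]
    have h2 : (x + 3) ^ 3 - 8 / 5 * (4 * (x + 3 - 1) ^ 2) =
      x ^ 3 + 13 / 5 * x ^ 2 + 7 / 5 * x + 7 / 5 := by ring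
    have : 0 ≤ x ^ 3 + 13 / 5 * x ^ 2 + 7 / 5 * x + 7 / 5 := by positivity
    linarith
  · rcases hp3.eq_or_lt with h3 | h3
    · subst h3
      refine le_trans ?_ (le_contrib_of_two_le hD hp le_rfl h1)
      norm_num
    · have h5 : 5 ≤ p := by
        by_contra h5
        have h4 : p = 4 := by omega
        rw [h4] at hp
        exact absurd hp (by norm_num)
      exact le_trans (by norm_num) (four_le_contrib_of_two_le hD hp h5 h1)

lemma prod_le_prod_contrib (hD : D ≠ 0) {S : Finset ℕ}
    (hS : S ⊆ D.natAbs.primeFactors.erase 2) :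
    ∏ p ∈ S, contrib D p ≤ ∏ p ∈ D.natAbs.primeFactors.erase 2, contrib D p := by
  have h1 : ∀ p ∈ D.natAbs.primeFactors.erase 2, 1 ≤ contrib D p := fun p hp ↦ by
    obtain ⟨hp2, hp⟩ := Finset.mem_erase.1 hp
    refine le_trans (by norm_num) (le_contrib hD (Nat.prime_of_mem_primeFactors hp) hp2 ?_)
    rw [← Nat.support_factorization, Finsupp.mem_support_iff] at hp
    omega
  rw [← Finset.prod_sdiff hS]
  refine le_mul_of_one_le_left (Finset.prod_nonneg fun p hp ↦ ?_) ?_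
  · linarith [h1 p (hS hp)]
  · have := Finset.prod_le_prod (fun p _ ↦ zero_le_one' ℝ)
      fun p hp ↦ h1 p (Finset.sdiff_subset (t := S) hp)
    rwa [Finset.prod_const_one] at this

lemma one_le_prod_contrib (hD : D ≠ 0) :
    1 ≤ ∏ p ∈ D.natAbs.primeFactors.erase 2, contrib D p := by
  simpa using prod_le_prod_contrib hD (Finset.empty_subset _)

lemma le_prod_contrib_of_nonempty (hD : D ≠ 0) (h : (D.natAbs.primeFactors.erase 2).Nonempty) :
    8 / 5 ≤ ∏ p ∈ D.natAbs.primeFactors.erase 2, contrib D p := by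
  obtain ⟨p, hp⟩ := h
  refine le_trans ?_ (prod_le_prod_contrib hD (Finset.singleton_subset_iff.2 hp))
  rw [Finset.prod_singleton]
  obtain ⟨hp2, hp⟩ := Finset.mem_erase.1 hp
  refine le_contrib hD (Nat.prime_of_mem_primeFactors hp) hp2 ?_
  rw [← Nat.support_factorization, Finsupp.mem_support_iff] at hp
  omega

lemma four_le_prod_contrib (hD : D < -4) (hD4 : D % 4 = 1) (h7 : D ≠ -7) (h15 : D ≠ -15) :
    4 ≤ ∏ p ∈ D.natAbs.primeFactors.erase 2, contrib D p ∨ D = -11 ∨ D = -63 := by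
  have hD0 : D ≠ 0 := by omega
  set N := D.natAbs with hN
  have hN0 : N ≠ 0 := by omega
  set v := N.factorization with hv
  by_contra hcon
  push Not at hcon
  obtain ⟨hlt, h11, h63⟩ := hcon
  have hmem : ∀ p, v p ≠ 0 → p ∈ N.primeFactors.erase 2 := fun p hp ↦ by
    have h1 : p ∈ N.primeFactors := by
      rw [← Nat.support_factorization, Finsupp.mem_support_iff]; exact hp
    refine Finset.mem_erase.2 ⟨?_, h1⟩
    rintro rfl
    have := Nat.dvd_of_mem_primeFactors h1
    omega
  have hpr : ∀ p, v p ≠ 0 → p.Prime := fun p hp ↦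
    Nat.prime_of_mem_primeFactors (Finset.mem_of_mem_erase (hmem p hp))
  have hone : ∀ p, v p ≠ 0 → contrib D p < 4 := fun p hp ↦ by
    have := prod_le_prod_contrib hD0 (Finset.singleton_subset_iff.2 (hmem p hp))
    rw [Finset.prod_singleton] at this
    exact this.trans_lt hlt
  have htwo : ∀ p q, p ≠ q → v p ≠ 0 → v q ≠ 0 → contrib D p * contrib D q < 4 :=
    fun p q hpq hp hq ↦ by
      have := prod_le_prod_contrib hD0 (S := {p, q}) (by
        intro r hr
        rcases Finset.mem_insert.1 hr with rfl | hr
        · exact hmem r hp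
        · rw [Finset.mem_singleton.1 hr]; exact hmem q hq)
      rw [Finset.prod_pair hpq] at this
      exact this.trans_lt hlt
  have hsmall : ∀ p, v p ≠ 0 → p ∈ ({3, 5, 7, 11, 13} : Finset ℕ) := fun p hp ↦ by
    have h1 : p < 17 := by
      by_contra h1
      exact absurd (hone p hp) (not_lt.2
        (four_le_contrib_of_le hD0 (hpr p hp) (by omega) (Nat.one_le_iff_ne_zero.2 hp)))
    have h2 := hpr p hp
    have h3 := Finset.ne_of_mem_erase (hmem p hp)
    interval_cases p <;> first | decide | exact absurd rfl h3 | exact absurd h2 (by norm_num)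
  have hle1 : ∀ p, 5 ≤ p → v p ≤ 1 := fun p hp ↦ by
    by_contra h1
    have hp0 : v p ≠ 0 := by omega
    exact absurd (hone p hp0) (not_lt.2
      (four_le_contrib_of_two_le hD0 (hpr p hp0) hp (show 2 ≤ v p by omega)))
  have h3le : v 3 ≤ 2 := by
    by_contra h1
    have := le_contrib_of_two_le hD0 (k := 3) Nat.prime_three (by norm_num)
      (show 3 ≤ v 3 by omega)
    have h2 := hone 3 (by omega)
    norm_num at this
    linarith
  have hprod : N = 3 ^ v 3 * 5 ^ v 5 * 7 ^ v 7 * 11 ^ v 11 * 13 ^ v 13 := by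
    conv_lhs => rw [← Nat.prod_factorization_pow_eq_self hN0]
    rw [Finsupp.prod_of_support_subset (s := {3, 5, 7, 11, 13}) _ (fun p hp ↦
      hsmall p (Finsupp.mem_support_iff.1 hp)) _ (fun p _ ↦ pow_zero p)]
    simp [Finset.prod_insert, mul_assoc]
  have hc : ∀ p, p.Prime → v p = 1 → contrib D p = (p : ℝ) ^ 3 / (4 * ((p : ℝ) - 1) ^ 2) :=
    fun p hp h1 ↦ contrib_of_eq_one hD0 hp h1
  have hge : ∀ p, v p ≠ 0 → 8 / 5 ≤ contrib D p := fun p hp ↦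
    le_contrib hD0 (hpr p hp) (Finset.ne_of_mem_erase (hmem p hp)) (Nat.one_le_iff_ne_zero.2 hp)
  have hbig : ∀ p q, p ≠ q → v p = 1 → v q ≠ 0 →
      5 / 2 ≤ (p : ℝ) ^ 3 / (4 * ((p : ℝ) - 1) ^ 2) → False := fun p q hpq hp hq h1 ↦ by
    have h2 := htwo p q hpq (by omega) hq
    have h3 := hge q hq
    rw [hc p (hpr p (by omega)) hp] at h2
    nlinarith
  have h5 := hle1 5 le_rfl
  have h7' := hle1 7 (by norm_num)
  have h11' := hle1 11 (by norm_num)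
  have h13' := hle1 13 (by norm_num)
  have k13 : ∀ q, q ≠ 13 → v 13 = 1 → v q = 0 := fun q hq h1 ↦ by
    by_contra h2
    exact hbig 13 q hq.symm h1 h2 (by norm_num)
  have k11 : ∀ q, q ≠ 11 → v 11 = 1 → v q = 0 := fun q hq h1 ↦ by
    by_contra h2
    exact hbig 11 q hq.symm h1 h2 (by norm_num)
  have k75 : v 7 = 1 → v 5 = 0 := fun h1 ↦ by
    by_contra h2
    have h3 := htwo 7 5 (by norm_num) (by omega) h2
    rw [hc 7 (by norm_num) h1, hc 5 (by norm_num) (by omega)] at h3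
    norm_num at h3
  have k73 : v 7 = 1 → v 3 ≠ 1 := fun h1 h2 ↦ by
    have h3 := htwo 7 3 (by norm_num) (by omega) (by omega)
    rw [hc 7 (by norm_num) h1, hc 3 (by norm_num) h2] at h3
    norm_num at h3
  have a1 := k13 3 (by norm_num)
  have a2 := k13 5 (by norm_num)
  have a3 := k13 7 (by norm_num)
  have a4 := k13 11 (by norm_num)
  have b1 := k11 3 (by norm_num)
  have b2 := k11 5 (by norm_num)
  have b3 := k11 7 (by norm_num)
  clear_value v
  generalize v 3 = i3 at *
  generalize v 5 = i5 at *
  generalize v 7 = i7 at *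
  generalize v 11 = i11 at *
  generalize v 13 = i13 at *
  clear hmem hpr hone htwo hsmall hle1 hc hge hbig hlt k13 k11
  interval_cases i13
  · interval_cases i11
    · interval_cases i7 <;> interval_cases i5 <;> interval_cases i3 <;> norm_num at * <;> omega
    · rw [b1 rfl, b2 rfl, b3 rfl] at hprod
      norm_num at hprod; omega
  · rw [a1 rfl, a2 rfl, a3 rfl, a4 rfl] at hprod
    norm_num at hprod; omega

lemma NegDisc.emod_four (h : NegDisc D) : D % 4 = 0 ∨ D % 4 = 1 := by
  have h1 := h.eq
  unfold parD at h1
  rcases Int.emod_two_eq_zero_or_one D with h2 | h2 <;> rw [h2] at h1 <;> omega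

lemma negDisc_of_emod (h0 : D < 0) (h : D % 4 = 0 ∨ D % 4 = 1) : NegDisc D := by
  refine ⟨h0, ?_⟩
  unfold parD nrmD
  rcases Int.emod_two_eq_zero_or_one D with h2 | h2 <;> rw [h2] <;> omega

lemma NegDisc.lowerBd_of_odd (h : NegDisc D) (hD : D < -4) (hD4 : D % 4 = 1) {J : Finset ℕ}
    (hJ : ∀ p ∈ J, p.Prime ∧ ¬ (p : ℤ) ∣ D ∧ ¬ IsSplit D p)
    (hnum : 4 * (∏ p ∈ J, (1 - ((p : ℝ)⁻¹) ^ 2)) ^ 2 ≤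
      ∏ p ∈ D.natAbs.primeFactors.erase 2, contrib D p) :
    LowerBd D ∅ (2 * √Real.pi / √(-D)) := by
  have h2 : ¬ 2 ∣ D.natAbs := by omega
  refine h.lowerBd_empty (γ := 1 / 2) (κ := 1) (w := ∏ p ∈ J, (1 - ((p : ℝ)⁻¹) ^ 2)) (ε := 1)
    (e := 0) one_pos one_pos (fun c hc ↦ ?_) (one_dvd _) (by rw [if_neg h2]) (by linarith)
  rw [erase_two_of_odd h2, mul_one]
  refine lowerBd_primeFactors hD h hJ ?_ hc
  have := h.ncard_le_of_odd (by omega) (by omega)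
  have h3 : (2 : ℝ) * {A : Cl D | A ^ 2 = 1}.ncard ≤ 2 ^ (D.natAbs.primeFactors.erase 2).card := by
    exact_mod_cast this
  linarith

lemma not_isSplit_of_forall {p : ℕ} (hp : 0 < p)
    (h : ∀ t < p, ¬ (p : ℤ) ∣ polD D (t : ℕ)) : ¬ IsSplit D p := by
  rintro ⟨-, -, t, ht⟩
  have hp' : (0 : ℤ) < p := by exact_mod_cast hp
  have h0 := Int.emod_nonneg t hp'.ne'
  have h1 := Int.emod_lt_of_pos t hp'
  refine h (t % p).toNat (by omega) ?_
  rw [Int.toNat_of_nonneg h0]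
  have : polD D (t % p) = polD D t - p * ((t / p) * (t + t % p + parD D)) := by
    unfold polD
    have := Int.emod_add_mul_ediv t p
    linear_combination (t + t % p + parD D) * this
  rw [this]
  exact dvd_sub ht (dvd_mul_right _ _)

lemma lowerBd_odd (hD : D < -4) (hD4 : D % 4 = 1) (h7 : D ≠ -7) (h15 : D ≠ -15) :
    LowerBd D ∅ (2 * √Real.pi / √(-D)) := by
  have h : NegDisc D := negDisc_of_emod (by omega) (Or.inr hD4)
  rcases four_le_prod_contrib hD hD4 h7 h15 with h4 | rfl | rfl
  · exact h.lowerBd_of_odd hD hD4 (J := ∅) (by simp) (by simpa using h4)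
  · refine h.lowerBd_of_odd (J := {2}) (by norm_num) (by norm_num) ?_ ?_
    · simp only [Finset.mem_singleton, forall_eq]
      exact ⟨Nat.prime_two, by norm_num, not_isSplit_of_forall two_pos (by decide)⟩
    · refine le_trans ?_ (prod_le_prod_contrib (S := {11}) (by norm_num) ?_)
      · rw [Finset.prod_singleton, Finset.prod_singleton,
          contrib_of_eq_one (by norm_num) (by norm_num)]
        · norm_num
        · exact (Nat.Prime.factorization_self (by norm_num : Nat.Prime 11))
      · rw [Finset.singleton_subset_iff]
        exact Finset.mem_erase.2 ⟨by norm_num, Nat.mem_primeFactors.2 (by norm_num)⟩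
  · refine h.lowerBd_of_odd (J := {5}) (by norm_num) (by norm_num) ?_ ?_
    · simp only [Finset.mem_singleton, forall_eq]
      exact ⟨by norm_num, by norm_num, not_isSplit_of_forall (by norm_num) (by decide)⟩
    · have e63 : (-63 : ℤ).natAbs = 3 ^ 2 * 7 := by norm_num
      have h3 := le_contrib_of_two_le (D := -63) (p := 3) (k := 2) (by norm_num) (by norm_num)
        le_rfl ((Nat.prime_three.pow_dvd_iff_le_factorization (by norm_num)).1 (by norm_num))
      have h7 : contrib (-63) 7 = _ :=
        contrib_of_eq_one (by norm_num) (by norm_num) (by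
          rw [e63, Nat.factorization_mul (by norm_num) (by norm_num), Finsupp.add_apply,
            Nat.Prime.factorization_self (by norm_num : Nat.Prime 7),
            Nat.factorization_eq_zero_of_not_dvd (by norm_num)])
      refine le_trans ?_ (prod_le_prod_contrib (S := {3, 7}) (by norm_num) ?_)
      · rw [Finset.prod_singleton, Finset.prod_pair (by norm_num), h7]
        refine le_trans ?_ (mul_le_mul_of_nonneg_right h3 (by norm_num))
        norm_num
      · intro p hp
        simp only [Finset.mem_insert, Finset.mem_singleton] at hp
        rcases hp with rfl | rfl
        · exact Finset.mem_erase.2 ⟨by norm_num, Nat.mem_primeFactors.2 (by norm_num)⟩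
        · exact Finset.mem_erase.2 ⟨by norm_num, Nat.mem_primeFactors.2 (by norm_num)⟩

lemma NegDisc.prime_of_mem {q : ℕ} (hq : q ∈ D.natAbs.primeFactors) : q.Prime :=
  Nat.prime_of_mem_primeFactors hq

section

variable {m : ℕ} (hm : 1 < m) (hD : D = -4 * m)
include hm hD

lemma two_mem_primeFactors : 2 ∈ D.natAbs.primeFactors :=
  Nat.mem_primeFactors.2 ⟨Nat.prime_two, by omega, by omega⟩

lemma NegDisc.lowerBd_of_even (h : NegDisc D) {γ κ : ℝ} {e : ℕ} {J : Finset ℕ}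
    (hJ : ∀ p ∈ J, p.Prime ∧ ¬ (p : ℤ) ∣ D ∧ ¬ IsSplit D p) (hκ : 0 < κ)
    (hγ : (({A : Cl D | A ^ 2 = 1}.ncard : ℕ) : ℝ) ≤
      γ * 2 ^ (D.natAbs.primeFactors.erase 2).card)
    (hstep : ∀ c : ℝ, c ^ 2 * (2 * (γ * 2 ^ (D.natAbs.primeFactors.erase 2).card) *
      ∏ p ∈ J, (1 - ((p : ℝ)⁻¹) ^ 2)) ≤ resConst D → LowerBd D D.natAbs.primeFactors c →
      LowerBd D (D.natAbs.primeFactors.erase 2) (c * κ))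
    (he : 2 ^ e ∣ D.natAbs)
    (hnum : 64 * γ ^ 2 * (∏ p ∈ J, (1 - ((p : ℝ)⁻¹) ^ 2)) ^ 2 ≤
      κ ^ 4 * 2 ^ e * ∏ p ∈ D.natAbs.primeFactors.erase 2, contrib D p) :
    LowerBd D ∅ (2 * √Real.pi / √(-D)) := by
  refine h.lowerBd_empty (γ := γ) (κ := κ) (w := ∏ p ∈ J, (1 - ((p : ℝ)⁻¹) ^ 2)) (ε := 1 / 2)
    (e := e) hκ (by norm_num)
    (fun c hc ↦ hstep c hc (lowerBd_primeFactors (by omega) h hJ hγ hc)) he ?_ (by linarith)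
  rw [if_pos (by omega)]

lemma NegDisc.lowerBd_of_one (h : NegDisc D) (hm4 : m % 4 = 1) :
    LowerBd D ∅ (2 * √Real.pi / √(-D)) := by
  refine h.lowerBd_of_even hm hD (γ := 1) (κ := 2) (e := 2) (J := ∅) (by simp) two_pos ?_ ?_
    (by omega) ?_
  · rw [one_mul]; exact_mod_cast NegDisc.ncard_le_of_one hm hD h hm4
  · intro c _ hc
    rw [mul_comm]
    exact LowerBd.erase_two (fun q ↦ NegDisc.prime_of_mem) hc (m := -m) (by omega) (by omega)
      (two_mem_primeFactors hm hD) (by omega)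
  · have := one_le_prod_contrib h.neg.ne
    simp only [Finset.prod_empty]
    linarith

lemma NegDisc.lowerBd_of_two (h : NegDisc D) (hm4 : m % 4 = 2) :
    LowerBd D ∅ (2 * √Real.pi / √(-D)) := by
  refine h.lowerBd_of_even hm hD (γ := 1) (κ := 2) (e := 3) (J := ∅) (by simp) two_pos ?_ ?_
    (by omega) ?_
  · rw [one_mul]; exact_mod_cast NegDisc.ncard_le_of_even hm hD h (by omega) (by omega)
  · intro c _ hc
    rw [mul_comm]
    exact LowerBd.erase_two (fun q ↦ NegDisc.prime_of_mem) hc (m := -m) (by omega) (by omega)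
      (two_mem_primeFactors hm hD) (by omega)
  · have := one_le_prod_contrib h.neg.ne
    simp only [Finset.prod_empty]
    linarith

lemma LowerBd.mul_four_thirds (hm4 : m % 4 = 0 ∨ m % 4 = 3) {c : ℝ}
    (hc : LowerBd D D.natAbs.primeFactors c) :
    LowerBd D (D.natAbs.primeFactors.erase 2) (c * (4 / 3)) := by
  have := LowerBd.erase_sq (fun q ↦ NegDisc.prime_of_mem) hc (D' := -m) (by omega)
    (two_mem_primeFactors hm hD) (by push_cast; omega) (fun _ ↦ by omega)
  convert this using 1
  norm_num
  ring

lemma nonempty_of_not_two_pow (h : ∀ k, m ≠ 2 ^ k) : (D.natAbs.primeFactors.erase 2).Nonempty := by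
  rw [NegDisc.primeFactors_natAbs hm hD, Finset.nonempty_iff_ne_empty]
  intro h0
  refine h _ (Nat.eq_prime_pow_of_unique_prime_dvd (by omega) fun {d} hd hdm ↦ ?_)
  by_contra h2
  exact (Finset.eq_empty_iff_forall_notMem.1 h0) d
    (Finset.mem_erase.2 ⟨h2, Nat.mem_primeFactors.2 ⟨hd, hdm, by omega⟩⟩)

lemma NegDisc.lowerBd_of_three (h : NegDisc D) (hm4 : m % 4 = 3) :
    LowerBd D ∅ (2 * √Real.pi / √(-D)) := by
  refine h.lowerBd_of_even hm hD (γ := 1 / 2) (κ := 4 / 3) (e := 2) (J := ∅) (by simp)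
    (by norm_num) ?_ (fun c _ hc ↦ hc.mul_four_thirds hm hD (by omega)) (by omega) ?_
  · have : (2 : ℝ) * {A : Cl D | A ^ 2 = 1}.ncard ≤
        2 ^ (D.natAbs.primeFactors.erase 2).card := by
      exact_mod_cast NegDisc.ncard_le_of_three hm hD h hm4
    linarith
  · have := le_prod_contrib_of_nonempty h.neg.ne
      (nonempty_of_not_two_pow hm hD fun k hk ↦ by
        rcases k with _ | k
        · omega
        · rw [pow_succ] at hk; omega)
    simp only [Finset.prod_empty]
    linarith

lemma NegDisc.lowerBd_of_four (h : NegDisc D) (hm8 : m % 8 = 4) :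
    LowerBd D ∅ (2 * √Real.pi / √(-D)) := by
  have hg : (({A : Cl D | A ^ 2 = 1}.ncard : ℕ) : ℝ) ≤
      1 * 2 ^ (D.natAbs.primeFactors.erase 2).card := by
    rw [one_mul]; exact_mod_cast NegDisc.ncard_le_of_even hm hD h (by omega) (by omega)
  by_cases hm2 : ∃ k, m = 2 ^ k
  · obtain ⟨k, hk⟩ := hm2
    have hm4 : m = 4 := by
      rcases k with _ | _ | _ | k
      · omega
      · omega
      · omega
      · rw [pow_succ, pow_succ, pow_succ] at hk; omega
    subst hm4
    have hD16 : D = -16 := by omega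
    refine h.lowerBd_of_even hm hD (κ := 4 / 3) (e := 4) (J := {3, 7}) ?_ (by norm_num)
      hg (fun c _ hc ↦ hc.mul_four_thirds hm hD (by omega)) (by omega) ?_
    · subst hD16
      intro p hp
      simp only [Finset.mem_insert, Finset.mem_singleton] at hp
      rcases hp with rfl | rfl
      · exact ⟨by norm_num, by norm_num, not_isSplit_of_forall (by norm_num) (by decide)⟩
      · exact ⟨by norm_num, by norm_num, not_isSplit_of_forall (by norm_num) (by decide)⟩
    · have := one_le_prod_contrib h.neg.ne
      rw [Finset.prod_pair (by norm_num)]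
      norm_num at this ⊢
      linarith
  · push Not at hm2
    refine h.lowerBd_of_even hm hD (κ := 4 / 3) (e := 4) (J := ∅) (by simp) (by norm_num)
      hg (fun c _ hc ↦ hc.mul_four_thirds hm hD (by omega)) (by omega) ?_
    have := le_prod_contrib_of_nonempty h.neg.ne (nonempty_of_not_two_pow hm hD hm2)
    simp only [Finset.prod_empty]
    linarith

lemma NegDisc.ncard_le_two_mul (h : NegDisc D) (hm8 : m % 8 = 0) :
    (({A : Cl D | A ^ 2 = 1}.ncard : ℕ) : ℝ) ≤
      2 * 2 ^ (D.natAbs.primeFactors.erase 2).card := by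
  exact_mod_cast NegDisc.ncard_le_of_eight_dvd hm hD h hm8

lemma NegDisc.lowerBd_of_dvd (h : NegDisc D) (hm32 : 32 ∣ m) :
    LowerBd D ∅ (2 * √Real.pi / √(-D)) := by
  refine h.lowerBd_of_even hm hD (γ := 2) (κ := 4 / 3) (e := 7) (J := ∅) (by simp) (by norm_num)
    (NegDisc.ncard_le_two_mul hm hD h (by omega))
    (fun c _ hc ↦ hc.mul_four_thirds hm hD (by omega)) (by omega) ?_
  have := one_le_prod_contrib h.neg.ne
  simp only [Finset.prod_empty]
  linarith

lemma resConst_neg (h2 : 2 ∣ m) : resConst (-m) = 2 * resConst D := by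
  have hpf : ((-m : ℤ)).natAbs.primeFactors = D.natAbs.primeFactors := by
    have : D.natAbs = 2 ^ 2 * m := by omega
    rw [this, Int.natAbs_neg, Int.natAbs_natCast, Nat.primeFactors_mul (by norm_num) (by omega),
      Nat.primeFactors_prime_pow two_ne_zero Nat.prime_two, Finset.union_eq_right.2]
    exact Finset.singleton_subset_iff.2 (Nat.mem_primeFactors.2 ⟨Nat.prime_two, h2, by omega⟩)
  unfold resConst
  rw [hpf]
  have hs : √(-D : ℝ) = 2 * √(m : ℝ) := by
    rw [hD]
    push_cast
    rw [show (-(-4 * (m : ℝ))) = 2 ^ 2 * m by ring, Real.sqrt_mul (by norm_num),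
      Real.sqrt_sq (by norm_num)]
  have hs0 : √(m : ℝ) ≠ 0 := (Real.sqrt_pos.2 (by exact_mod_cast (by omega : 0 < m))).ne'
  rw [hs]
  push_cast
  rw [neg_neg]
  field_simp

lemma LowerBd.of_quarter {m' : ℕ} (hm' : m = 4 * m') (h2' : m' % 2 = 0) (hm8 : m' % 8 ≠ 0)
    {κ' c : ℝ} (hκ : ∀ d : ℝ, LowerBd (-m) (-m : ℤ).natAbs.primeFactors d →
      LowerBd (-m) ((-m : ℤ).natAbs.primeFactors.erase 2) (d * κ'))
    (hc : c ^ 2 * (2 * (2 * 2 ^ (D.natAbs.primeFactors.erase 2).card)) ≤ resConst D)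
    (hcD : LowerBd D D.natAbs.primeFactors c) :
    LowerBd D (D.natAbs.primeFactors.erase 2) (c * (1 + κ' / 2)) := by
  have hpf : ((-m : ℤ)).natAbs.primeFactors = D.natAbs.primeFactors := by
    have : D.natAbs = 2 ^ 2 * m := by omega
    rw [this, Int.natAbs_neg, Int.natAbs_natCast, Nat.primeFactors_mul (by norm_num) (by omega),
      Nat.primeFactors_prime_pow two_ne_zero Nat.prime_two, Finset.union_eq_right.2]
    exact Finset.singleton_subset_iff.2
      (Nat.mem_primeFactors.2 ⟨Nat.prime_two, by omega, by omega⟩)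
  have h' : NegDisc (-m) := negDisc_of_emod (by omega) (by omega)
  have hg : (({A : Cl (-m) | A ^ 2 = 1}.ncard : ℕ) : ℝ) ≤
      2 ^ (D.natAbs.primeFactors.erase 2).card := by
    rw [← hpf]
    exact_mod_cast NegDisc.ncard_le_of_even (m := m') (by omega) (by omega) h' h2' hm8
  have h1 : LowerBd (-m) (-m : ℤ).natAbs.primeFactors (2 * c) := by
    refine lowerBd_primeFactors (by omega) h' (J := ∅) (by simp) hg ?_
    rw [resConst_neg hm hD (by omega), Finset.prod_empty]
    linarith
  have h3 := hκ _ h1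
  rw [hpf] at h3
  have := LowerBd.add_sq (fun q ↦ NegDisc.prime_of_mem) hcD (D' := -m) (by omega)
    (two_mem_primeFactors hm hD) (by push_cast; omega) (fun _ ↦ by omega) h3
  convert this using 1
  push_cast
  ring

lemma NegDisc.lowerBd_of_eight (h : NegDisc D) (hm16 : m % 16 = 8) :
    LowerBd D ∅ (2 * √Real.pi / √(-D)) := by
  refine h.lowerBd_of_even hm hD (γ := 2) (κ := 1 + 2 / 2) (e := 5) (J := ∅) (by simp)
    (by norm_num) (NegDisc.ncard_le_two_mul hm hD h (by omega)) (fun c hc hcD ↦ ?_) (by omega) ?_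
  · rw [Finset.prod_empty, mul_one] at hc
    refine hcD.of_quarter hm hD (m' := m / 4) (by omega) (by omega) (by omega) (fun d hd ↦ ?_) hc
    rw [mul_comm]
    exact LowerBd.erase_two (fun q ↦ NegDisc.prime_of_mem) hd (m := -(m / 4 : ℕ)) (by omega)
      (by omega) (two_mem_primeFactors (m := m / 4) (by omega) (by omega)) (by omega)
  · have := one_le_prod_contrib h.neg.ne
    simp only [Finset.prod_empty]
    linarith

lemma NegDisc.lowerBd_of_sixteen (h : NegDisc D) (hm32 : m % 32 = 16) :
    LowerBd D ∅ (2 * √Real.pi / √(-D)) := by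
  refine h.lowerBd_of_even hm hD (γ := 2) (κ := 1 + 4 / 3 / 2) (e := 6) (J := ∅) (by simp)
    (by norm_num) (NegDisc.ncard_le_two_mul hm hD h (by omega)) (fun c hc hcD ↦ ?_) (by omega) ?_
  · rw [Finset.prod_empty, mul_one] at hc
    exact hcD.of_quarter hm hD (m' := m / 4) (by omega) (by omega) (by omega)
      (fun d hd ↦ hd.mul_four_thirds (m := m / 4) (by omega) (by omega) (by omega)) hc
  · have := one_le_prod_contrib h.neg.ne
    simp only [Finset.prod_empty]
    linarith

end

theorem NegDisc.lowerBd (h : NegDisc D) (h3 : D ≠ -3) (h4 : D ≠ -4) (h7 : D ≠ -7)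
    (h15 : D ≠ -15) : LowerBd D ∅ (2 * √Real.pi / √(-D)) := by
  have h0 := h.neg
  rcases h.emod_four with hD | hD
  · obtain ⟨m, hm⟩ : ∃ m : ℕ, D = -4 * m := ⟨(-(D / 4)).toNat, by omega⟩
    have hm1 : 1 < m := by omega
    have : m % 4 = 1 ∨ m % 4 = 2 ∨ m % 4 = 3 ∨ m % 8 = 4 ∨ m % 16 = 8 ∨ m % 32 = 16 ∨ 32 ∣ m := by
      omega
    rcases this with h | h | h | h | h | h | h
    · exact ‹NegDisc D›.lowerBd_of_one hm1 hm h
    · exact ‹NegDisc D›.lowerBd_of_two hm1 hm h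
    · exact ‹NegDisc D›.lowerBd_of_three hm1 hm h
    · exact ‹NegDisc D›.lowerBd_of_four hm1 hm h
    · exact ‹NegDisc D›.lowerBd_of_eight hm1 hm h
    · exact ‹NegDisc D›.lowerBd_of_sixteen hm1 hm h
    · exact ‹NegDisc D›.lowerBd_of_dvd hm1 hm h
  · exact lowerBd_odd (by omega) hD h7 h15

lemma Bcount_eq_sum (a b c : ℤ) {x : ℝ} (hx : 0 ≤ x) :
    (Bcount a b c x : ℝ) = ∑ k ∈ Finset.Icc 1 ⌊x⌋₊, repInd ⟨a, b, c⟩ ∅ k := by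
  classical
  have hset : {n : ℕ | 0 < n ∧ (n : ℝ) ≤ x ∧
      ∃ u v : ℤ, (n : ℤ) = a * u ^ 2 + b * u * v + c * v ^ 2} =
      ((Finset.Icc 1 ⌊x⌋₊).filter fun n : ℕ ↦ ∃ u v, (⟨a, b, c⟩ : QF).eval u v = n : Finset ℕ) := by
    ext n
    rw [Set.mem_ofPred_eq, Finset.mem_coe, Finset.mem_filter, Finset.mem_Icc, Nat.le_floor_iff hx,
      Nat.succ_le_iff, and_assoc]
    simp only [QF.eval, eq_comm (a := (n : ℤ))]
  unfold Bcount
  rw [hset, Set.ncard_coe_finset, Finset.card_filter, Nat.cast_sum]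
  refine Finset.sum_congr rfl fun k hk ↦ ?_
  have hk0 : 0 < k := (Finset.mem_Icc.1 hk).1
  unfold repInd
  by_cases h : ∃ u v, (⟨a, b, c⟩ : QF).eval u v = k <;> simp [h, hk0]

end

theorem stmt18 (a b c : ℤ) (ha : 0 < a) (hprim : Int.gcd (Int.gcd a b) c = 1)
    (hD : b ^ 2 - 4 * a * c < 0) (C : ℝ)
    (hC : Tendsto (fun x : ℝ => (Bcount a b c x : ℝ) * Real.sqrt (Real.log x) / x)
      atTop (nhds C))
    (hlt : Real.sqrt |((b ^ 2 - 4 * a * c : ℤ) : ℝ)| / 2 * C < 1) :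
    b ^ 2 - 4 * a * c ∈ ({-3, -4, -7, -15} : Set ℤ) := by
  have hf : (⟨a, b, c⟩ : QF).Good (b ^ 2 - 4 * a * c) := by
    refine ⟨ha, rfl, fun d h1 h2 h3 ↦ ?_⟩
    have := Int.dvd_coe_gcd (Int.dvd_coe_gcd h1 h2) h3
    rw [hprim] at this
    exact isUnit_of_dvd_one this
  generalize b ^ 2 - 4 * a * c = D at *
  by_contra h
  simp only [Set.mem_insert_iff, Set.mem_singleton_iff, not_or] at h
  have hlow := (hf.negDisc hD).lowerBd h.1 h.2.1 h.2.2.1 h.2.2.2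
  have hC' : Tendsto (fun x : ℝ ↦ (∑ k ∈ Finset.Icc 1 ⌊x⌋₊, repInd ⟨a, b, c⟩ ∅ k) *
      √(Real.log x) / x) atTop (nhds C) := by
    refine hC.congr' ?_
    filter_upwards [eventually_ge_atTop 0] with x hx
    rw [Bcount_eq_sum a b c hx]
  have hle := le_mul_sqrt_pi (repInd_nonneg _ _)
    (fun n ↦ (le_abs_self _).trans (abs_repInd_le_one _ _ n)) hC' (hlow _ hf)
  have hpi : 0 < √Real.pi := Real.sqrt_pos.2 Real.pi_pos
  have hD0 : (0 : ℝ) < -D := by exact_mod_cast neg_pos.2 hD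
  have hR : 0 < √(-D : ℝ) := Real.sqrt_pos.2 hD0
  rw [abs_of_neg (by linarith)] at hlt
  rw [div_le_iff₀ hR] at hle
  nlinarith [mul_pos hpi hR]
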